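/- Let β, μ be real and k an integer with k ≠ 1. Let τ ∈ ℂ with Re τ > 0, q := e^{−2πτ}, q̂ := e^{−2π/τ}. Then δ(β)·ζ(k,−μ) + 𝒮_k(β,−μ;0,0;q) + (−1)^{k−1}·𝒮_k(−β,μ;0,0;q) − (−2π)^k·Σ_{j=0}^{k+1} ((−i)^j·A_j(e(μ))·B_{k+1−j}(⟨β⟩)/(j!(k+1−j)!))·τ^{k−j} = (−iτ)^{k−1}·( ζ_{−β}(k) + 𝒮_k(0,0;μ,−β;q̂) + (−1)^{k−1}·𝒮_k(0,0;−μ,β;q̂) ), the j-sum being empty when k+1 < 0. -/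

import Mathlib

noncomputable section

open Complex MeasureTheory
open scoped Real Classical

/-- `e(s) = exp(2 π i s)`. -/
def ee (s : ℂ) : ℂ := Complex.exp (2 * (Real.pi : ℂ) * Complex.I * s)

/-- `δ(x) = 1` if `x ∈ ℤ`, `0` otherwise. -/
def dInt (x : ℝ) : ℂ := if ∃ n : ℤ, (n : ℝ) = x then 1 else 0

/-- The Lerch zeta function `ψ(r,γ,κ) = Σ_{k ∈ ℤ, γ+k>0} e((γ+k)κ) (γ+k)^{-r}`
(a convergent series when `Re r > 1`). -/
def psiL (r : ℂ) (γ κ : ℝ) : ℂ :=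
  ∑' k : {k : ℤ // 0 < γ + (k : ℝ)},
    ee ((((γ + (k.1 : ℝ)) * κ : ℝ)) : ℂ) * (((γ + (k.1 : ℝ)) : ℝ) : ℂ) ^ (-r)

/-- The `q`-series `𝒮_r(γ,δ;κ,λ;q)`, where `q = e^{-2πt}` with `Re t > 0`, and the power
`q^{(γ+k)(δ+l)}` is interpreted as `exp (-2πt(γ+k)(δ+l))`. -/
def Scal (r : ℂ) (γ δ' κ lam : ℝ) (t : ℂ) : ℂ :=
  ∑' (k : {k : ℤ // 0 < γ + (k : ℝ)}) (l : {l : ℤ // 0 < δ' + (l : ℝ)}),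
    ee ((((γ + (k.1 : ℝ)) * κ + (δ' + (l.1 : ℝ)) * lam : ℝ)) : ℂ) *
      (((δ' + (l.1 : ℝ)) : ℝ) : ℂ) ^ (-r) *
      Complex.exp (-2 * (Real.pi : ℂ) * t * ((γ + (k.1 : ℝ) : ℝ) : ℂ) * ((δ' + (l.1 : ℝ) : ℝ) : ℂ))

/-- The generalized Eisenstein series `F_{ℤ²}(s;α,β;μ,ν;z)` (mean of the two branch
conventions), defined by an absolutely convergent series for `Re s > 2`. -/
def Fz2 (s : ℂ) (α β μ ν : ℝ) (z : ℂ) : ℂ :=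
  (∑' p : {p : ℤ × ℤ // β + (p.2 : ℝ) ≠ 0},
      ee ((((α + (p.1.1 : ℝ)) * μ + (β + (p.1.2 : ℝ)) * ν : ℝ)) : ℂ) *
        ((((α + (p.1.1 : ℝ)) : ℝ) : ℂ) + (((β + (p.1.2 : ℝ)) : ℝ) : ℂ) * z) ^ (-s)) +
  dInt β *
    ((∑' m : {m : ℤ // 0 < α + (m : ℝ)},
        ee ((((α + (m.1 : ℝ)) * μ : ℝ)) : ℂ) * (((α + (m.1 : ℝ)) : ℝ) : ℂ) ^ (-s)) +
      Complex.cos ((Real.pi : ℂ) * s) *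
        ∑' m : {m : ℤ // α + (m : ℝ) < 0},
          ee ((((α + (m.1 : ℝ)) * μ : ℝ)) : ℂ) * ((|α + (m.1 : ℝ)| : ℝ) : ℂ) ^ (-s))

/-- `𝒜(s,α,μ) = cos(πs) ψ(s,-α,-μ) + ψ(s,α,μ)`. -/
def Acal (s : ℂ) (α μ : ℝ) : ℂ :=
  Complex.cos ((Real.pi : ℂ) * s) * psiL s (-α) (-μ) + psiL s α μ

/-- `ψ(k,γ,κ)` at an integer `k`: the convergent series for `k ≥ 2`, the value
`-𝒞_{1-k}(⟨γ⟩,κ)/(1-k) - δ_{k0} δ(γ)` of the analytic continuation for `k ≤ 0`,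
and the (irrelevant) value `0` for `k = 1`; here `C` is the family of Taylor
coefficients `𝒞`. -/
def psiIntC (C : ℕ → ℂ → ℝ → ℂ) (k : ℤ) (γ κ : ℝ) : ℂ :=
  if 2 ≤ k then
    ∑' n : {n : ℤ // 0 < γ + (n : ℝ)},
      ee ((((γ + (n.1 : ℝ)) * κ : ℝ)) : ℂ) * (((γ + (n.1 : ℝ)) : ℝ) : ℂ) ^ (-k)
  else if k ≤ 0 then
    -C (1 - k).toNat ((Int.fract γ : ℝ) : ℂ) κ / ((1 : ℂ) - (k : ℂ)) -
      (if k = 0 then dInt γ else 0)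
  else 0

/-- The Bernoulli polynomial `B_j(x)` evaluated in `ℂ`. -/
def BpolyC (j : ℕ) (x : ℂ) : ℂ := Polynomial.aeval x (Polynomial.bernoulli j)

/-- Weierstrass `℘`-function with periods `(1, z)`. -/
def wpFn (z w : ℂ) : ℂ :=
  w ^ (-2 : ℤ) + ∑' p : {p : ℤ × ℤ // p ≠ (0, 0)},
    ((w - (p.1.1 : ℂ) - (p.1.2 : ℂ) * z) ^ (-2 : ℤ) -
      ((p.1.1 : ℂ) + (p.1.2 : ℂ) * z) ^ (-2 : ℤ))

/-- Weierstrass zeta function with periods `(1, z)`. -/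
def wzetaFn (z w : ℂ) : ℂ :=
  1 / w + ∑' p : {p : ℤ × ℤ // p ≠ (0, 0)},
    (1 / (w - (p.1.1 : ℂ) - (p.1.2 : ℂ) * z) + 1 / ((p.1.1 : ℂ) + (p.1.2 : ℂ) * z) +
      w / ((p.1.1 : ℂ) + (p.1.2 : ℂ) * z) ^ 2)

/-- Weierstrass sigma function with periods `(1, z)`. -/
def wsigmaFn (z w : ℂ) : ℂ :=
  w * ∏' p : {p : ℤ × ℤ // p ≠ (0, 0)},
    ((1 - w / ((p.1.1 : ℂ) + (p.1.2 : ℂ) * z)) *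
      Complex.exp (w / ((p.1.1 : ℂ) + (p.1.2 : ℂ) * z) +
        w ^ 2 / (2 * ((p.1.1 : ℂ) + (p.1.2 : ℂ) * z) ^ 2)))

/-- The `q`-Pochhammer symbol `(Z;q)_∞`. -/
def qPoch (Z q : ℂ) : ℂ := ∏' l : ℕ, (1 - Z * q ^ l)

/-- `⟨x⟩' = 1 - ⟨-x⟩`. -/
def fracP (x : ℝ) : ℝ := 1 - Int.fract (-x)

/-- The Eisenstein series `E₂`. -/
def E2cl (z : ℂ) : ℂ := 1 - 24 * ∑' l : ℕ+, (l : ℂ) * ee z ^ (l : ℕ) / (1 - ee z ^ (l : ℕ))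

/-- `a_{2k}`: `ζ(1-2k)` for `k ≠ 0` and `2ζ'(0) = -log 2π` for `k = 0`. -/
def acoef (k : ℤ) : ℂ :=
  if k = 0 then -(Real.log (2 * Real.pi) : ℂ) else riemannZeta ((1 - 2 * k : ℤ) : ℂ)

/-- The classical Eisenstein series `E_{2k}`. -/
def Ecl (k : ℤ) (z : ℂ) : ℂ :=
  1 + (2 / acoef k) * ∑' l : ℕ+, (l : ℂ) ^ (2 * k - 1) * ee z ^ (l : ℕ) / (1 - ee z ^ (l : ℕ))

/-- The bilateral Lerch zeta function `ψ_ℤ^ε(r,γ,κ) = e^{-επir} ψ(r,-γ,-κ) + ψ(r,γ,κ)`. -/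
def psiZpm (ε : ℤ) (r : ℂ) (γ κ : ℝ) : ℂ :=
  Complex.exp (-(ε : ℂ) * (Real.pi : ℂ) * Complex.I * r) * psiL r (-γ) (-κ) + psiL r γ κ

lemma fracP_pos (x : ℝ) : 0 < fracP x := by
  unfold fracP; linarith [Int.fract_lt_one (-x)]

lemma fracP_le_one (x : ℝ) : fracP x ≤ 1 := by
  unfold fracP; linarith [Int.fract_nonneg (-x)]

/-- The integers `k` with `γ + k > 0` are enumerated by `ℕ`. -/
def posShiftEquiv (γ : ℝ) : ℕ ≃ {k : ℤ // 0 < γ + (k : ℝ)} where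
  toFun n := ⟨n + 1 + ⌊-γ⌋, by
    have := Int.lt_floor_add_one (-γ)
    push_cast
    have : (0 : ℝ) ≤ n := by positivity
    linarith⟩
  invFun k := (k.1 - 1 - ⌊-γ⌋).toNat
  left_inv n := by simp; omega
  right_inv k := by
    have h : ⌊-γ⌋ < k.1 := Int.floor_lt.2 (by linarith [k.2])
    apply Subtype.ext
    simp only
    rw [Int.toNat_of_nonneg (by omega)]
    ring

lemma posShiftEquiv_val (γ : ℝ) (n : ℕ) :
    γ + ((posShiftEquiv γ n).1 : ℝ) = n + fracP γ := by
  simp only [posShiftEquiv, Equiv.coe_fn_mk, fracP, Int.fract]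
  push_cast
  ring

lemma ee_add (s t : ℂ) : ee (s + t) = ee s * ee t := by
  simp only [ee, mul_add, Complex.exp_add]

lemma ee_zero : ee 0 = 1 := by simp [ee]

lemma ee_nat_mul (n : ℕ) (s : ℂ) : ee (n * s) = ee s ^ n := by
  simp only [ee, ← Complex.exp_nat_mul]
  ring_nf

lemma norm_ee (s : ℝ) : ‖ee s‖ = 1 := by
  rw [ee, show 2 * (π : ℂ) * I * s = ((2 * π * s : ℝ) : ℂ) * I by push_cast; ring,
    Complex.norm_exp_ofReal_mul_I]

lemma ee_int (n : ℤ) : ee n = 1 := by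
  rw [ee, show 2 * (π : ℂ) * I * n = n * (2 * π * I) by ring]
  exact Complex.exp_int_mul_two_pi_mul_I n

lemma norm_exp_two_pi (t : ℂ) (x : ℝ) :
    ‖Complex.exp (-2 * (π : ℂ) * t * x)‖ = Real.exp (-2 * π * t.re * x) := by
  rw [Complex.norm_exp]
  congr 1
  simp [mul_assoc]

lemma hasSum_tsum_mul_pow {ι : Type*} {a r : ι → ℂ} {ρ : ℝ} (hρ0 : 0 ≤ ρ) (hρ : ρ < 1)
    (hr : ∀ n, ‖r n‖ ≤ ρ) (ha : Summable fun n => ‖a n‖) :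
    HasSum (fun m : ℕ => ∑' n, a n * r n ^ m) (∑' n, a n / (1 - r n)) ∧
      Summable fun n => ‖a n / (1 - r n)‖ := by
  have hlt : ∀ n, ‖r n‖ < 1 := fun n => (hr n).trans_lt hρ
  have hs : Summable (fun p : ℕ × ι => a p.2 * r p.2 ^ p.1) := by
    have hprod : Summable (fun p : ℕ × ι => ρ ^ p.1 * ‖a p.2‖) := by
      have hg := summable_geometric_of_lt_one hρ0 hρ
      have hg0 : (0 : ℕ → ℝ) ≤ fun m : ℕ => ρ ^ m := fun n => pow_nonneg hρ0 n
      have ha0 : (0 : ι → ℝ) ≤ fun n => ‖a n‖ := fun n => norm_nonneg (a n)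
      exact hg.mul_of_nonneg ha hg0 ha0
    refine Summable.of_norm_bounded hprod ?_
    intro p
    rw [norm_mul, norm_pow, mul_comm]
    gcongr
    exact hr _
  constructor
  · have h1 : ∑' (m : ℕ) (n : ι), a n * r n ^ m = ∑' n, a n / (1 - r n) := by
      rw [← Summable.tsum_comm (f := fun m n => a n * r n ^ m) hs]
      refine tsum_congr fun n => ?_
      rw [tsum_mul_left, tsum_geometric_of_norm_lt_one (hlt n), div_eq_mul_inv]
    rw [← h1]
    exact hs.prod.hasSum
  · refine Summable.of_nonneg_of_le (fun _ => norm_nonneg _) (fun n => ?_)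
      (ha.mul_right (1 - ρ)⁻¹)
    have h := norm_sub_norm_le (1 : ℂ) (r n)
    rw [norm_one] at h
    have h' : 1 - ρ ≤ ‖1 - r n‖ := by linarith [hr n]
    rw [norm_div, div_eq_mul_inv]
    exact mul_le_mul_of_nonneg_left (inv_anti₀ (by linarith) h') (norm_nonneg _)

lemma summable_zpow_mul_exp {d s : ℝ} (hd : 0 < d) (hs : 0 < s) (k : ℤ) :
    Summable fun n : ℕ => ((n : ℝ) + d) ^ k * Real.exp (-s * (n + d)) := by
  have h1 : Summable fun n : ℕ => ((n : ℝ) + d) ^ k.toNat * Real.exp (-s * n) := by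
    have h2 := Real.summable_pow_mul_exp_neg_nat_mul k.toNat hs
    have h3 : (fun n : ℕ => ((n : ℝ) + d) ^ k.toNat * Real.exp (-s * n)) =O[Filter.atTop]
        fun n : ℕ => (n : ℝ) ^ k.toNat * Real.exp (-s * n) := by
      refine Asymptotics.IsBigO.mul (Asymptotics.IsBigO.pow ?_ _) (Asymptotics.isBigO_refl _ _)
      refine Asymptotics.IsBigO.of_bound (1 + d) ?_
      filter_upwards [Filter.eventually_ge_atTop 1] with n hn
      have : (1 : ℝ) ≤ n := by exact_mod_cast hn
      rw [Real.norm_of_nonneg (by positivity), Real.norm_of_nonneg (by positivity)]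
      nlinarith
    exact summable_of_isBigO_nat h2 h3
  refine Summable.of_nonneg_of_le (fun n => by positivity) (fun n => ?_)
    (h1.mul_left (max 1 (d ^ k) * Real.exp (-s * d)))
  have hx : 0 < (n : ℝ) + d := by positivity
  have h4 : ((n : ℝ) + d) ^ k ≤ max 1 (d ^ k) * ((n : ℝ) + d) ^ k.toNat := by
    rcases le_total 0 k with hk | hk
    · conv_lhs => rw [← Int.toNat_of_nonneg hk, zpow_natCast]
      exact le_mul_of_one_le_left (by positivity) (le_max_left _ _)
    · rw [Int.toNat_of_nonpos hk, pow_zero, mul_one]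
      refine le_trans ?_ (le_max_right _ _)
      have h5 := inv_anti₀ (by positivity : 0 < d ^ (-k))
        (zpow_le_zpow_left₀ (by omega : 0 ≤ -k) hd.le (by linarith [Nat.cast_nonneg (α := ℝ) n] : d ≤ n + d))
      simpa [zpow_neg] using h5
  calc _ ≤ (max 1 (d ^ k) * ((n : ℝ) + d) ^ k.toNat) * Real.exp (-s * (n + d)) := by gcongr
    _ = _ := by rw [mul_add, Real.exp_add]; ring

/-- Summing the geometric series in the first index. -/
lemma Scal_eq_tsum (k : ℤ) (γ δ κ lam : ℝ) {t : ℂ} (ht : 0 < t.re) :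
    Scal (k : ℂ) γ δ κ lam t =
      ∑' n : ℕ, (((n + fracP δ : ℝ) : ℂ) ^ (-k) * ee ((fracP γ * κ + (n + fracP δ) * lam : ℝ)) *
        Complex.exp (-2 * π * t * ((n + fracP δ : ℝ) * fracP γ : ℝ))) /
        (1 - ee κ * Complex.exp (-2 * π * t * (n + fracP δ : ℝ))) ∧
    Summable fun n : ℕ =>
      ‖(((n + fracP δ : ℝ) : ℂ) ^ (-k) * ee ((fracP γ * κ + (n + fracP δ) * lam : ℝ)) *
        Complex.exp (-2 * π * t * ((n + fracP δ : ℝ) * fracP γ : ℝ))) /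
        (1 - ee κ * Complex.exp (-2 * π * t * (n + fracP δ : ℝ)))‖ := by
  have hd := fracP_pos δ
  have hg := fracP_pos γ
  have key := hasSum_tsum_mul_pow
    (a := fun n : ℕ => ((n + fracP δ : ℝ) : ℂ) ^ (-k) *
      ee ((fracP γ * κ + (n + fracP δ) * lam : ℝ)) *
        Complex.exp (-2 * π * t * ((n + fracP δ : ℝ) * fracP γ : ℝ)))
    (r := fun n : ℕ => ee κ * Complex.exp (-2 * π * t * (n + fracP δ : ℝ)))
    (ρ := Real.exp (-2 * π * t.re * fracP δ)) (Real.exp_pos _).le ?_ ?_ ?_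
  · refine ⟨?_, key.2⟩
    rw [← key.1.tsum_eq, Scal, ← (posShiftEquiv γ).tsum_eq]
    refine tsum_congr fun m => ?_
    rw [← (posShiftEquiv δ).tsum_eq]
    refine tsum_congr fun n => ?_
    rw [posShiftEquiv_val, posShiftEquiv_val, ← Int.cast_neg, Complex.cpow_intCast, mul_pow,
      ← ee_nat_mul, ← Complex.exp_nat_mul,
      show (((m + fracP γ) * κ + (n + fracP δ) * lam : ℝ) : ℂ) =
        ((fracP γ * κ + (n + fracP δ) * lam : ℝ) : ℂ) + m * (κ : ℂ) by push_cast; ring, ee_add,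
      show -2 * (π : ℂ) * t * (m + fracP γ : ℝ) * (n + fracP δ : ℝ) =
        -2 * π * t * ((n + fracP δ : ℝ) * fracP γ : ℝ) + m * (-2 * π * t * (n + fracP δ : ℝ)) by
        push_cast; ring, Complex.exp_add]
    ring
  · rw [Real.exp_lt_one_iff]
    have : 0 < π * t.re * fracP δ := by positivity
    nlinarith
  · intro n
    rw [norm_mul, norm_ee, one_mul, norm_exp_two_pi]
    apply Real.exp_le_exp.2
    have : 0 ≤ π * t.re * n := by positivity
    nlinarith
  · have hs : 0 < 2 * π * t.re * fracP γ := by positivity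
    refine (summable_zpow_mul_exp hd hs (-k)).congr fun n => ?_
    have hx : 0 < (n : ℝ) + fracP δ := by positivity
    rw [norm_mul, norm_mul, norm_ee, mul_one, norm_exp_two_pi, norm_zpow, Complex.norm_real,
      Real.norm_of_nonneg hx.le]
    congr 2
    ring

/-- The nonzero elements of `-μ + ℤ`. -/
def shiftPts (μ : ℝ) : ℕ ⊕ ℕ → ℝ :=
  Sum.elim (fun n => n + fracP (-μ)) (fun n => -(n + fracP μ))

/-- A positive lower bound for the absolute values of the nonzero elements of `-μ + ℤ`. -/
def shiftMin (μ : ℝ) : ℝ := min (fracP (-μ)) (fracP μ)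

lemma shiftMin_pos (μ : ℝ) : 0 < shiftMin μ := lt_min (fracP_pos _) (fracP_pos _)

lemma shiftMin_le (μ : ℝ) (i : ℕ ⊕ ℕ) : shiftMin μ ≤ |shiftPts μ i| := by
  rcases i with n | n
  · have := fracP_pos (-μ)
    simp only [shiftPts, Sum.elim_inl]
    rw [abs_of_pos (by positivity)]
    exact (min_le_left _ _).trans (by simp)
  · have := fracP_pos μ
    simp only [shiftPts, Sum.elim_inr, abs_neg]
    rw [abs_of_pos (by positivity)]
    exact (min_le_right _ _).trans (by simp)

lemma shiftPts_ne_zero (μ : ℝ) (i : ℕ ⊕ ℕ) : shiftPts μ i ≠ 0 :=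
  abs_pos.1 ((shiftMin_pos μ).trans_le (shiftMin_le μ i))

lemma summable_add_rpow_neg {d : ℝ} (hd : 0 < d) {k : ℕ} (hk : 2 ≤ k) :
    Summable fun n : ℕ => 1 / ((n : ℝ) + d) ^ k := by
  have := (Real.summable_one_div_nat_add_rpow d k).2 (by exact_mod_cast hk)
  refine this.congr fun n => ?_
  rw [abs_of_pos (by positivity), Real.rpow_natCast]

lemma summable_shiftPts (μ : ℝ) {k : ℕ} (hk : 2 ≤ k) :
    Summable fun i => 1 / |shiftPts μ i| ^ k := by
  refine Summable.sum _ ?_ ?_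
  · refine (summable_add_rpow_neg (fracP_pos (-μ)) hk).congr fun n => ?_
    have := fracP_pos (-μ)
    simp only [Function.comp, shiftPts, Sum.elim_inl]
    rw [abs_of_pos (by positivity)]
  · refine (summable_add_rpow_neg (fracP_pos μ) hk).congr fun n => ?_
    have := fracP_pos μ
    simp only [Function.comp, shiftPts, Sum.elim_inr, abs_neg]
    rw [abs_of_pos (by positivity)]

lemma summable_norm_shiftPts (μ : ℝ) {k : ℕ} (hk : 2 ≤ k) :
    Summable fun i => ‖1 / (shiftPts μ i : ℂ) ^ k‖ := by
  refine (summable_shiftPts μ hk).congr fun i => ?_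
  rw [norm_div, norm_one, norm_pow, Complex.norm_real, Real.norm_eq_abs]

/-- The power sums over `-μ + ℤ`. -/
def shiftSum (μ : ℝ) (k : ℕ) : ℂ := ∑' i, 1 / (shiftPts μ i : ℂ) ^ k

/-- The Cauchy transforms of the nonzero elements of `-μ + ℤ`. -/
def shiftCauchy (μ : ℝ) (k : ℕ) (w : ℂ) : ℂ :=
  ∑' i, 1 / ((shiftPts μ i : ℂ) ^ k * (shiftPts μ i - w))

lemma hasSum_shiftCauchy_one (μ : ℝ) {w : ℂ} (hw : ‖w‖ < shiftMin μ) :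
    HasSum (fun m : ℕ => shiftSum μ (m + 2) * w ^ m) (shiftCauchy μ 1 w) := by
  have hm := shiftMin_pos μ
  have h := (hasSum_tsum_mul_pow (a := fun i => 1 / (shiftPts μ i : ℂ) ^ 2)
    (r := fun i => w / shiftPts μ i) (ρ := ‖w‖ / shiftMin μ) (by positivity)
    (by rwa [div_lt_one hm]) (fun i => by
      rw [norm_div, Complex.norm_real, Real.norm_eq_abs]
      gcongr
      exact shiftMin_le μ i) (summable_norm_shiftPts μ le_rfl)).1
  convert h using 2
  · rename_i m
    rw [shiftSum, ← tsum_mul_right]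
    refine tsum_congr fun i => ?_
    have : (shiftPts μ i : ℂ) ≠ 0 := by exact_mod_cast shiftPts_ne_zero μ i
    rw [div_pow, pow_add]
    field_simp
  · refine tsum_congr fun i => ?_
    have : (shiftPts μ i : ℂ) ≠ 0 := by exact_mod_cast shiftPts_ne_zero μ i
    have h2 : (shiftPts μ i : ℂ) - w ≠ 0 := by
      intro h
      rw [sub_eq_zero] at h
      rw [← h, Complex.norm_real, Real.norm_eq_abs] at hw
      exact absurd (shiftMin_le μ i) (by linarith)
    have h3 : 1 - w / (shiftPts μ i : ℂ) ≠ 0 := by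
      rw [show 1 - w / (shiftPts μ i : ℂ) = (shiftPts μ i - w) / shiftPts μ i by field_simp]
      exact div_ne_zero h2 this
    field_simp

lemma summable_shiftCauchy (μ : ℝ) {k : ℕ} (hk : 1 ≤ k) (w : ℂ) :
    Summable fun i => ‖1 / ((shiftPts μ i : ℂ) ^ k * (shiftPts μ i - w))‖ := by
  refine summable_of_isBigO (summable_shiftPts μ (Nat.succ_le_succ hk)) ?_
  have hcof : Filter.Tendsto (fun i => |shiftPts μ i|) Filter.cofinite Filter.atTop := by
    have h := (summable_shiftPts μ le_rfl).tendsto_cofinite_zero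
    have h2 : Filter.Tendsto (fun i => (1 / |shiftPts μ i| ^ 2)⁻¹) Filter.cofinite Filter.atTop :=
      Filter.Tendsto.comp tendsto_inv_nhdsGT_zero (tendsto_nhdsWithin_iff.2 ⟨h,
        Filter.Eventually.of_forall fun i => by
          have := abs_pos.2 (shiftPts_ne_zero μ i)
          simp only [Set.mem_Ioi]; positivity⟩)
    refine Filter.tendsto_atTop.2 fun b => ?_
    filter_upwards [Filter.tendsto_atTop.1 h2 (b ^ 2)] with i hi
    simp only [one_div, inv_inv] at hi
    exact le_of_sq_le_sq hi (abs_nonneg _)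
  refine Asymptotics.IsBigO.of_bound 2 ?_
  filter_upwards [Filter.tendsto_atTop.1 hcof (2 * ‖w‖)] with i hi
  have h0 := abs_pos.2 (shiftPts_ne_zero μ i)
  have h1 : |shiftPts μ i| / 2 ≤ ‖(shiftPts μ i : ℂ) - w‖ := by
    have := norm_sub_norm_le (shiftPts μ i : ℂ) w
    rw [Complex.norm_real, Real.norm_eq_abs] at this
    linarith
  rw [norm_norm, norm_div, norm_mul, norm_pow, Complex.norm_real, norm_one, Real.norm_eq_abs,
    Real.norm_of_nonneg (by positivity)]
  rw [show 2 * (1 / |shiftPts μ i| ^ (k + 1)) = 1 / (|shiftPts μ i| ^ k * (|shiftPts μ i| / 2)) by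
    field_simp
    ring]
  gcongr

lemma shiftCauchy_succ (μ : ℝ) {k : ℕ} (hk : 1 ≤ k) {w : ℂ}
    (hw : ∀ i, (shiftPts μ i : ℂ) ≠ w) :
    w * shiftCauchy μ (k + 1) w = shiftCauchy μ k w - shiftSum μ (k + 1) := by
  rw [shiftCauchy, shiftCauchy, shiftSum, ← tsum_mul_left,
    ← ((summable_shiftCauchy μ hk w).of_norm).tsum_sub
      (summable_norm_shiftPts μ (by omega)).of_norm]
  refine tsum_congr fun i => ?_
  have h1 : (shiftPts μ i : ℂ) ≠ 0 := by exact_mod_cast shiftPts_ne_zero μ i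
  have h2 := sub_ne_zero.2 (hw i)
  field_simp
  ring

lemma hasSum_cotTerm {z : ℂ} (hz : z ∈ integerComplement) :
    HasSum (fun n : ℕ => 1 / (z - (n + 1)) + 1 / (z + (n + 1))) (π * cot (π * z) - 1 / z) := by
  rw [cot_series_rep' hz]
  exact (summable_cotTerm hz).hasSum

lemma tendsto_sum_cot {z : ℂ} (hz : z ∈ integerComplement) :
    Filter.Tendsto (fun N : ℕ => ∑ n ∈ Finset.range N, (1 / (z + n) - 1 / (n + 1 - z)))
      Filter.atTop (nhds (π * cot (π * z))) := by
  have h := (hasSum_cotTerm hz).tendsto_sum_nat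
  have h0 : Filter.Tendsto (fun N : ℕ => 1 / (z + N)) Filter.atTop (nhds 0) := by
    simp_rw [one_div]
    refine Filter.tendsto_inv₀_cobounded.comp ?_
    exact (tendsto_const_add_cobounded z).comp tendsto_natCast_atTop_cobounded
  have h2 := (h.sub h0).add_const (1 / z)
  rw [sub_zero, sub_add_cancel] at h2
  refine h2.congr fun N => ?_
  have key : ∀ N : ℕ, ∑ n ∈ Finset.range N, (1 / (z + (n + 1)) - 1 / (z + n)) =
      1 / (z + N) - 1 / z := fun N => by
    have := Finset.sum_range_sub (fun n : ℕ => 1 / (z + n)) N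
    simpa using this
  have h3 : ∑ n ∈ Finset.range N, (1 / (z + n) - 1 / (n + 1 - z)) =
      ∑ n ∈ Finset.range N, (1 / (z - (n + 1)) + 1 / (z + (n + 1))) -
      ∑ n ∈ Finset.range N, (1 / (z + (n + 1)) - 1 / (z + n)) := by
    rw [← Finset.sum_sub_distrib]
    refine Finset.sum_congr rfl fun n _ => ?_
    rw [show z - ((n : ℂ) + 1) = -(n + 1 - z) by ring, div_neg]
    ring
  rw [h3, key]
  ring

lemma pi_mul_cot (z : ℂ) : π * cot (π * z) = π * I * ((ee z + 1) / (ee z - 1)) := by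
  rw [Complex.cot_pi_eq_exp_ratio, ee]
  rw [show (Complex.exp (2 * π * I * z) + 1) / (I * (1 - Complex.exp (2 * π * I * z))) =
    I * ((Complex.exp (2 * π * I * z) + 1) / (Complex.exp (2 * π * I * z) - 1)) by
    rw [div_mul_eq_div_div_swap, div_I, ← neg_sub (Complex.exp _) 1, div_neg]; ring]
  ring

lemma ee_ne_zero (z : ℂ) : ee z ≠ 0 := Complex.exp_ne_zero _

lemma ee_eq_one_iff (z : ℂ) : ee z = 1 ↔ ∃ n : ℤ, z = n := by
  have hpi : (π : ℂ) ≠ 0 := by exact_mod_cast Real.pi_ne_zero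
  constructor
  · intro h
    obtain ⟨n, hn⟩ := Complex.exp_eq_one_iff.1 h
    refine ⟨n, ?_⟩
    have : (2 * π * I : ℂ) ≠ 0 := by simp [hpi]
    rw [mul_comm] at hn
    exact mul_right_cancel₀ this hn
  · rintro ⟨n, rfl⟩
    exact ee_int n

lemma ee_sub_one_ne_zero {z : ℂ} (hz : z ∈ integerComplement) : ee z - 1 ≠ 0 := by
  rw [sub_ne_zero, Ne, ee_eq_one_iff]
  rintro ⟨n, rfl⟩
  exact hz ⟨n, rfl⟩

lemma fracP_neg (μ : ℝ) : fracP (-μ) = 1 - Int.fract μ := by simp [fracP]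

lemma fracP_of_fract_eq_zero {μ : ℝ} (h : Int.fract μ = 0) : fracP μ = 1 := by
  obtain ⟨n, hn⟩ := Int.fract_eq_zero_iff.1 h
  rw [fracP, ← hn, ← Int.cast_neg, Int.fract_intCast, sub_zero]

lemma fracP_of_fract_ne_zero {μ : ℝ} (h : Int.fract μ ≠ 0) : fracP μ = Int.fract μ := by
  rw [fracP, Int.fract_neg h]; ring

lemma ee_mul_ee_fracP (μ : ℝ) : ee μ * ee (fracP (-μ)) = 1 := by
  rw [← ee_add, fracP_neg, Int.fract, ee_eq_one_iff]
  exact ⟨1 + ⌊μ⌋, by push_cast; ring⟩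

lemma mul_shiftCauchy_one (μ : ℝ) {w S : ℂ} (hw : ∀ i, (shiftPts μ i : ℂ) ≠ w)
    (hS : Filter.Tendsto (fun N : ℕ => ∑ n ∈ Finset.range N,
      ((1 / ((n : ℂ) + fracP (-μ) - w) - 1 / (n + fracP μ + w)) -
        (1 / ((n : ℂ) + fracP (-μ)) - 1 / (n + fracP μ)))) Filter.atTop (nhds S)) :
    w * shiftCauchy μ 1 w = S := by
  have h1 := (summable_shiftCauchy μ le_rfl w).of_norm
  have h2 := (h1.comp_injective Sum.inl_injective).hasSum.add
    (h1.comp_injective Sum.inr_injective).hasSum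
  have h3 := HasSum.sum (h1.comp_injective Sum.inl_injective).hasSum
    (h1.comp_injective Sum.inr_injective).hasSum
  rw [← h3.tsum_eq] at h2
  have h4 := (h2.mul_left w).tendsto_sum_nat
  refine tendsto_nhds_unique h4 (hS.congr fun N => Finset.sum_congr rfl fun n _ => ?_)
  have e1 := sub_ne_zero.2 (hw (Sum.inl n))
  have e2 := sub_ne_zero.2 (hw (Sum.inr n))
  have e3 := shiftPts_ne_zero μ (Sum.inl n)
  have e4 := shiftPts_ne_zero μ (Sum.inr n)
  replace e3 : (shiftPts μ (Sum.inl n) : ℂ) ≠ 0 := by exact_mod_cast e3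
  replace e4 : (shiftPts μ (Sum.inr n) : ℂ) ≠ 0 := by exact_mod_cast e4
  simp only [Function.comp, shiftPts, Sum.elim_inl, Sum.elim_inr, ofReal_add, ofReal_neg,
    ofReal_natCast, pow_one] at *
  have e2' : (n : ℂ) + fracP μ + w ≠ 0 := by
    intro h; apply e2; linear_combination -h
  have e4' : (n : ℂ) + fracP μ ≠ 0 := by
    intro h; apply e4; linear_combination -h
  have e5 : -((n : ℂ) + fracP μ) - w = -(n + fracP μ + w) := by ring
  rw [e5]
  field_simp
  ring

lemma exists_shiftCauchy_one (μ : ℝ) : ∃ K : ℂ, ∀ w : ℂ, w ≠ 0 →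
    (∀ i, (shiftPts μ i : ℂ) ≠ w) → w ^ 2 * shiftCauchy μ 1 w =
      (if Int.fract μ = 0 then 1 else 0) + K * w - 2 * π * I * w / (ee μ * ee w - 1) := by
  have hmem : ∀ w : ℂ, w ≠ 0 → (∀ i, (shiftPts μ i : ℂ) ≠ w) →
      (fracP (-μ) - w : ℂ) ∈ integerComplement := by
    rintro w hw0 hw ⟨m, hm⟩
    rcases lt_or_ge 0 m with h | h
    · rcases eq_or_ne (Int.fract μ) 0 with hf | hf
      · have h1 : fracP (-μ) = 1 := by rw [fracP_neg, hf, sub_zero]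
        rcases eq_or_lt_of_le (Int.add_one_le_iff.2 h) with h2 | h2
        · rw [h1, ← h2] at hm
          push_cast at hm
          exact hw0 (by linear_combination hm)
        · apply hw (Sum.inr (m - 2).toNat)
          have h3 : (((m - 2).toNat : ℤ) : ℂ) = m - 2 := by
            rw [Int.toNat_of_nonneg (by omega)]; push_cast; ring
          rw [Int.cast_natCast] at h3
          simp only [shiftPts, Sum.elim_inr, fracP_of_fract_eq_zero hf]
          push_cast
          rw [h3]
          rw [h1] at hm
          push_cast at hm
          linear_combination -hm
      · apply hw (Sum.inr (m - 1).toNat)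
        have h3 : (((m - 1).toNat : ℤ) : ℂ) = m - 1 := by
          rw [Int.toNat_of_nonneg (by omega)]; push_cast; ring
        rw [Int.cast_natCast] at h3
        simp only [shiftPts, Sum.elim_inr, fracP_of_fract_ne_zero hf]
        rw [fracP_neg] at hm
        push_cast at hm ⊢
        rw [h3]
        linear_combination -hm
    · apply hw (Sum.inl (-m).toNat)
      have h3 : (((-m).toNat : ℤ) : ℂ) = -m := by
        rw [Int.toNat_of_nonneg (by omega)]; push_cast; ring
      rw [Int.cast_natCast] at h3
      simp only [shiftPts, Sum.elim_inl]
      push_cast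
      rw [h3]
      linear_combination -hm
  have hcot : ∀ w : ℂ, (fracP (-μ) - w : ℂ) ∈ integerComplement →
      π * cot (π * (fracP (-μ) - w)) = - π * I - 2 * π * I / (ee μ * ee w - 1) := by
    intro w hm
    have h1 := ee_sub_one_ne_zero hm
    have h2 : ee (fracP (-μ) - w) * (ee μ * ee w) = 1 := by
      rw [mul_left_comm, ← ee_add, sub_add_cancel, ee_mul_ee_fracP]
    rw [pi_mul_cot]
    have h3 := ee_ne_zero (fracP (-μ) - w)
    generalize ee (fracP (-μ) - w) = x at *
    have h4 : ee μ * ee w = 1 / x := by field_simp; linear_combination h2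
    rw [h4]
    have h5 : 1 / x - 1 = -(x - 1) / x := by field_simp; ring
    rw [h5]
    field_simp
    ring
  by_cases hf : Int.fract μ = 0
  · refine ⟨-π * I, fun w hw0 hw => ?_⟩
    have hm := hmem w hw0 hw
    have hc1 : fracP (-μ) = 1 := by rw [fracP_neg, hf, sub_zero]
    have hc2 := fracP_of_fract_eq_zero hf
    have hm' : -w ∈ integerComplement := by
      rintro ⟨m, h⟩
      exact hm ⟨1 + m, by rw [hc1]; push_cast; rw [h]; ring⟩
    have h := mul_shiftCauchy_one μ hw (S := π * cot (π * (-w)) - 1 / (-w)) (by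
      refine (hasSum_cotTerm hm').tendsto_sum_nat.congr fun N =>
        Finset.sum_congr rfl fun n _ => ?_
      rw [hc1, hc2, show -w - ((n : ℂ) + 1) = -(n + 1 + w) by ring, div_neg]
      push_cast
      ring)
    have h2 : π * cot (π * (-w)) = - π * I - 2 * π * I / (ee μ * ee w - 1) := by
      rw [← hcot w hm, pi_mul_cot, pi_mul_cot, hc1, sub_eq_add_neg ((1 : ℝ) : ℂ) w, ee_add]
      have : ee (1 : ℝ) = 1 := by simpa using ee_int 1
      rw [this, one_mul]
    rw [if_pos hf, sq, mul_assoc, h, h2]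
    field_simp
    ring
  · refine ⟨-π * I - π * cot (π * fracP (-μ)), fun w hw0 hw => ?_⟩
    have hm := hmem w hw0 hw
    have hc2 := fracP_of_fract_ne_zero hf
    have hc1 := fracP_neg μ
    have hm0 : (fracP (-μ) : ℂ) ∈ integerComplement := by
      rintro ⟨m, h⟩
      have h' : (m : ℝ) = fracP (-μ) := by exact_mod_cast h
      have l1 := fracP_pos (-μ)
      have l2 : fracP (-μ) < 1 := by
        rw [hc1]; have := (Int.fract_nonneg μ).lt_of_ne' hf; linarith
      rw [← h'] at l1 l2
      have l3 : 0 < m := by exact_mod_cast l1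
      have l4 : m < 1 := by exact_mod_cast l2
      omega
    have h := mul_shiftCauchy_one μ hw
      (S := π * cot (π * (fracP (-μ) - w)) - π * cot (π * fracP (-μ))) (by
      refine ((tendsto_sum_cot hm).sub (tendsto_sum_cot hm0)).congr fun N => ?_
      rw [← Finset.sum_sub_distrib]
      refine Finset.sum_congr rfl fun n _ => ?_
      rw [hc1, hc2]
      push_cast
      ring_nf)
    rw [if_neg hf, sq, mul_assoc, h, hcot w hm]
    ring

lemma coeff_eq_zero_of_hasSum_zero {c : ℕ → ℂ}
    (h : ∀ᶠ w in nhdsWithin (0 : ℂ) {(0 : ℂ)}ᶜ, HasSum (fun n => c n * w ^ n) 0) (n : ℕ) :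
    c n = 0 := by
  set p : FormalMultilinearSeries ℂ ℂ ℂ := FormalMultilinearSeries.ofScalars ℂ c with hp
  have hcoeff : ∀ n, p.coeff n = c n := fun n => by
    rw [hp, FormalMultilinearSeries.coeff_ofScalars]
  have key : HasFPowerSeriesAt (fun w : ℂ => if w = 0 then c 0 else 0) p 0 := by
    rw [hasFPowerSeriesAt_iff]
    rw [eventually_nhdsWithin_iff] at h
    filter_upwards [h] with w hw
    have e : ∀ f : ℕ → ℂ, f = (fun n => w ^ n * c n) → HasSum f
        (if w = 0 then c 0 else 0) := by
      rintro f rfl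
      by_cases hw0 : w = 0
      · rw [if_pos hw0, hw0]
        convert hasSum_single (f := fun n => (0 : ℂ) ^ n * c n) 0 (fun n hn => by simp [hn]) using 1
        simp
      · rw [if_neg hw0]
        simpa only [mul_comm] using hw hw0
    rw [zero_add]
    exact e _ (funext fun n => by rw [hcoeff, smul_eq_mul])
  have hc0 : c 0 = 0 := by
    have h1 := key.continuousAt.tendsto.mono_left
      (nhdsWithin_le_nhds (s := ({(0 : ℂ)}ᶜ : Set ℂ)))
    rw [if_pos rfl] at h1
    refine tendsto_nhds_unique h1 (tendsto_const_nhds.congr' ?_)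
    filter_upwards [self_mem_nhdsWithin] with w hw
    exact (if_neg hw).symm
  have hz : (fun w : ℂ => if w = 0 then c 0 else 0) = 0 := by
    funext w
    simp [hc0]
  rw [hz] at key
  rw [← hcoeff, key.eq_zero]
  simp [FormalMultilinearSeries.coeff]

lemma coeff_eq_shiftSum (μ : ℝ) {A : ℕ → ℂ}
    (hA : ∀ᶠ Z in nhdsWithin (0 : ℂ) {(0 : ℂ)}ᶜ,
      HasSum (fun j : ℕ => A j * Z ^ j / (Nat.factorial j : ℂ)) (Z / (ee μ * Complex.exp Z - 1))) :
    A 0 = (if Int.fract μ = 0 then 1 else 0) ∧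
    (∀ j, 2 ≤ j → A j * (2 * π * I) ^ j / (Nat.factorial j : ℂ) = -shiftSum μ j) ∧
    ∀ w : ℂ, w ≠ 0 → (∀ i, (shiftPts μ i : ℂ) ≠ w) → w ^ 2 * shiftCauchy μ 1 w =
      A 0 + A 1 * (2 * π * I) * w - 2 * π * I * w / (ee μ * ee w - 1) := by
  obtain ⟨K, hK⟩ := exists_shiftCauchy_one μ
  have hpi : (2 * π * I : ℂ) ≠ 0 := by simp [Real.pi_ne_zero]
  set δ : ℂ := if Int.fract μ = 0 then 1 else 0 with hδ
  set s : ℕ → ℂ := fun j => if j = 0 then -δ else if j = 1 then -K else shiftSum μ j with hs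
  have hzero : ∀ᶠ w in nhdsWithin (0 : ℂ) {(0 : ℂ)}ᶜ,
      HasSum (fun j => (A j * (2 * π * I) ^ j / (Nat.factorial j : ℂ) + s j) * w ^ j) 0 := by
    have ht : Filter.Tendsto (fun w : ℂ => 2 * π * I * w) (nhdsWithin 0 {(0 : ℂ)}ᶜ)
        (nhdsWithin 0 {(0 : ℂ)}ᶜ) := by
      refine tendsto_nhdsWithin_iff.2 ⟨?_, ?_⟩
      · have : Continuous fun w : ℂ => 2 * π * I * w := by fun_prop
        simpa using this.continuousAt.tendsto.mono_left
          (nhdsWithin_le_nhds (a := (0 : ℂ)) (s := ({(0 : ℂ)}ᶜ : Set ℂ)))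
      · filter_upwards [self_mem_nhdsWithin] with w hw
        exact mul_ne_zero hpi hw
    have hball : ∀ᶠ w in nhdsWithin (0 : ℂ) {(0 : ℂ)}ᶜ, ‖w‖ < shiftMin μ := by
      refine Filter.Eventually.filter_mono nhdsWithin_le_nhds ?_
      filter_upwards [Metric.ball_mem_nhds (0 : ℂ) (shiftMin_pos μ)] with w hw
      simpa using hw
    filter_upwards [ht.eventually hA, hball, self_mem_nhdsWithin] with w h1 h2 hw0
    have h3 := hasSum_shiftCauchy_one μ h2
    have h4 : HasSum (fun j => s j * w ^ j) (w ^ 2 * shiftCauchy μ 1 w - δ - K * w) := by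
      rw [← hasSum_nat_add_iff' 2]
      have e : w ^ 2 * shiftCauchy μ 1 w - δ - K * w - ∑ i ∈ Finset.range 2, s i * w ^ i =
          w ^ 2 * shiftCauchy μ 1 w := by
        simp [Finset.sum_range_succ, hs]
        ring
      rw [e]
      refine (h3.mul_left (w ^ 2)).congr_fun fun j => ?_
      simp [hs]
      ring
    have h5 : ∀ i, (shiftPts μ i : ℂ) ≠ w := fun i h => by
      rw [← h, Complex.norm_real, Real.norm_eq_abs] at h2
      exact absurd (shiftMin_le μ i) (by linarith)
    have h6 := h1.add h4
    rw [hK w hw0 h5] at h6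
    have h7 : 2 * π * I * w / (ee μ * Complex.exp (2 * π * I * w) - 1) + (δ + K * w -
        2 * π * I * w / (ee μ * ee w - 1) - δ - K * w) = 0 := by
      rw [ee, ee]; ring
    rw [h7] at h6
    refine h6.congr_fun fun j => ?_
    ring
  have hcoef := coeff_eq_zero_of_hasSum_zero hzero
  have h0 : A 0 = δ := by
    have := hcoef 0
    simp [hs] at this
    linear_combination this
  refine ⟨h0, fun j hj => ?_, fun w hw0 hw => ?_⟩
  · have := hcoef j
    simp only [hs] at this
    rw [if_neg (by omega), if_neg (by omega)] at this
    linear_combination this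
  · have := hcoef 1
    simp [hs] at this
    rw [hK w hw0 hw, h0]
    linear_combination -w * this

lemma pow_mul_shiftCauchy (μ : ℝ) {A : ℕ → ℂ}
    (hA : ∀ᶠ Z in nhdsWithin (0 : ℂ) {(0 : ℂ)}ᶜ,
      HasSum (fun j : ℕ => A j * Z ^ j / (Nat.factorial j : ℂ)) (Z / (ee μ * Complex.exp Z - 1)))
    {w : ℂ} (hw0 : w ≠ 0) (hw : ∀ i, (shiftPts μ i : ℂ) ≠ w) {k : ℕ} (hk : 1 ≤ k) :
    w ^ (k + 1) * shiftCauchy μ k w =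
      ∑ j ∈ Finset.range (k + 1), A j * (2 * π * I) ^ j / (Nat.factorial j : ℂ) * w ^ j -
        2 * π * I * w / (ee μ * ee w - 1) := by
  obtain ⟨-, h2, h3⟩ := coeff_eq_shiftSum μ hA
  induction k, hk using Nat.le_induction with
  | base =>
    rw [h3 w hw0 hw]
    simp [Finset.sum_range_succ]
  | succ k hk ih =>
    rw [Finset.sum_range_succ, h2 (k + 1) (by omega)]
    have := shiftCauchy_succ μ hk hw
    linear_combination ih + w ^ (k + 1) * this

lemma continuous_ee : Continuous ee := by unfold ee; fun_prop

/-- The Fourier integral over `[0,1]` with frequency `-n`. -/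
def fourInt (F : ℝ → ℂ) (n : ℤ) : ℂ := ∫ b in (0 : ℝ)..1, F b * ee (n * b)

lemma intervalIntegrable_mul_ee {F : ℝ → ℂ} (hF : ContinuousOn F (Set.Icc 0 1)) (n : ℤ) :
    IntervalIntegrable (fun b : ℝ => F b * ee (n * b)) volume 0 1 := by
  apply ContinuousOn.intervalIntegrable
  rw [Set.uIcc_of_le zero_le_one]
  exact hF.mul (continuous_ee.comp (by fun_prop)).continuousOn

lemma fourInt_add {F G : ℝ → ℂ} (hF : ContinuousOn F (Set.Icc 0 1))
    (hG : ContinuousOn G (Set.Icc 0 1)) (n : ℤ) :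
    fourInt (fun b => F b + G b) n = fourInt F n + fourInt G n := by
  simp only [fourInt, add_mul]
  exact intervalIntegral.integral_add (intervalIntegrable_mul_ee hF n)
    (intervalIntegrable_mul_ee hG n)

lemma fourInt_sub {F G : ℝ → ℂ} (hF : ContinuousOn F (Set.Icc 0 1))
    (hG : ContinuousOn G (Set.Icc 0 1)) (n : ℤ) :
    fourInt (fun b => F b - G b) n = fourInt F n - fourInt G n := by
  simp only [fourInt, sub_mul]
  exact intervalIntegral.integral_sub (intervalIntegrable_mul_ee hF n)
    (intervalIntegrable_mul_ee hG n)

lemma fourInt_const_mul (c : ℂ) (F : ℝ → ℂ) (n : ℤ) :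
    fourInt (fun b => c * F b) n = c * fourInt F n := by
  simp only [fourInt, mul_assoc]
  exact intervalIntegral.integral_const_mul _ _

lemma fourInt_finset_sum {ι : Type*} (s : Finset ι) {F : ι → ℝ → ℂ}
    (hF : ∀ i ∈ s, ContinuousOn (F i) (Set.Icc 0 1)) (n : ℤ) :
    fourInt (fun b => ∑ i ∈ s, F i b) n = ∑ i ∈ s, fourInt (F i) n := by
  simp only [fourInt, Finset.sum_mul]
  exact intervalIntegral.integral_finsetSum fun i hi => intervalIntegrable_mul_ee (hF i hi) n

lemma fourInt_ee_mul (F : ℝ → ℂ) (m n : ℤ) :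
    fourInt (fun b => ee (m * b) * F b) n = fourInt F (n + m) := by
  simp only [fourInt]
  congr 1
  funext b
  rw [show (((n + m : ℤ) : ℂ)) * b = n * b + m * b by push_cast; ring, ee_add]
  ring

lemma fourInt_ee (m n : ℤ) :
    fourInt (fun b => ee (m * b)) n = if m + n = 0 then 1 else 0 := by
  have h : ∀ b : ℝ, ee (m * b) * ee (n * b) = Complex.exp (2 * π * I * (m + n : ℤ) * b) := by
    intro b
    rw [← ee_add, ee]
    congr 1
    push_cast
    ring
  simp only [fourInt, h]
  split_ifs with h0
  · simp [h0]
  · have hc : (2 * π * I * (m + n : ℤ) : ℂ) ≠ 0 := by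
      have : ((m + n : ℤ) : ℂ) ≠ 0 := by exact_mod_cast h0
      simp only [ne_eq, mul_eq_zero, not_or]
      exact ⟨⟨⟨two_ne_zero, by exact_mod_cast Real.pi_ne_zero⟩, I_ne_zero⟩, this⟩
    rw [integral_exp_mul_complex hc]
    have := ee_int (m + n)
    rw [ee] at this
    rw [ofReal_one, mul_one, this]
    simp

lemma eq_zero_of_fourInt_eq_zero {D : ℝ → ℂ} (hD : ContinuousOn D (Set.Icc 0 1))
    (h : ∀ n, fourInt D n = 0) {b : ℝ} (hb : b ∈ Set.Icc (0 : ℝ) 1) : D b = 0 := by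
  have hmem : MemLp D 2 (volume.restrict (Set.Ioc 0 1)) := by
    have h1 : MemLp D 2 (volume.restrict (Set.Icc 0 1)) := by
      obtain ⟨C, hC⟩ := isCompact_Icc.exists_bound_of_continuousOn hD
      exact MemLp.of_bound (hD.aestronglyMeasurable measurableSet_Icc) C
        ((ae_restrict_iff' measurableSet_Icc).2 (Filter.Eventually.of_forall hC))
    exact h1.mono_measure (Measure.restrict_mono Set.Ioc_subset_Icc_self le_rfl)
  have hp := tsum_sq_fourierCoeffOn (zero_lt_one (α := ℝ)) hmem
  have hz : ∀ n : ℤ, fourierCoeffOn (zero_lt_one (α := ℝ)) D n = 0 := by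
    intro n
    rw [fourierCoeffOn_eq_integral, ← h (-n), fourInt]
    simp only [sub_zero, div_one, one_smul]
    refine intervalIntegral.integral_congr fun b _ => ?_
    simp only [fourier_coe_apply, ee, smul_eq_mul]
    rw [mul_comm]
    congr 2
    push_cast
    ring
  simp only [hz, norm_zero, ne_eq, OfNat.ofNat_ne_zero, not_false_eq_true, zero_pow, tsum_zero,
    sub_zero, inv_one, one_smul] at hp
  have hD2 : ContinuousOn (fun x => ‖D x‖ ^ 2) (Set.Icc 0 1) := (hD.norm).pow 2
  rw [eq_comm, intervalIntegral.integral_eq_zero_iff_of_le_of_nonneg_ae zero_le_one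
    (Filter.Eventually.of_forall fun x => by positivity)
    (by apply ContinuousOn.intervalIntegrable; rwa [Set.uIcc_of_le zero_le_one]),
    Measure.restrict_congr_set Ioc_ae_eq_Icc] at hp
  have := Measure.eqOn_Icc_of_ae_eq volume zero_ne_one hp hD2 continuousOn_const hb
  simpa using this

lemma continuousOn_hasSum_fourInt {ι : Type*} [Countable ι] {F : ι → ℝ → ℂ} {u : ι → ℝ}
    (hF : ∀ i, Continuous (F i)) (hu : Summable u)
    (hFu : ∀ i, ∀ b ∈ Set.Icc (0 : ℝ) 1, ‖F i b‖ ≤ u i) :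
    ContinuousOn (fun b => ∑' i, F i b) (Set.Icc 0 1) ∧
    ∀ n, HasSum (fun i => fourInt (F i) n) (fourInt (fun b => ∑' i, F i b) n) := by
  constructor
  · exact continuousOn_tsum (fun i => (hF i).continuousOn) hu hFu
  · intro n
    have hΙ : Set.uIoc (0 : ℝ) 1 ⊆ Set.Icc 0 1 := by
      rw [Set.uIoc_of_le zero_le_one]; exact Set.Ioc_subset_Icc_self
    refine intervalIntegral.hasSum_integral_of_dominated_convergence (fun i _ => u i) ?_ ?_ ?_ ?_ ?_
    · intro i
      exact ((hF i).mul (continuous_ee.comp (by fun_prop))).aestronglyMeasurable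
    · intro i
      refine Filter.Eventually.of_forall fun b hb => ?_
      have : ‖ee (n * b)‖ = 1 := by
        have := norm_ee (n * b)
        push_cast at this
        exact this
      rw [norm_mul, this, mul_one]
      exact hFu i b (hΙ hb)
    · exact Filter.Eventually.of_forall fun b _ => hu
    · exact intervalIntegrable_const
    · refine Filter.Eventually.of_forall fun b hb => ?_
      exact (Summable.of_norm_bounded hu fun i => hFu i b (hΙ hb)).hasSum.mul_right _

/-- The Lipschitz kernel `e^{-2πyb} / (1 - e^{-2πy})`. -/
def lipKer (b : ℝ) (y : ℂ) : ℂ :=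
  Complex.exp (-2 * π * y * b) / (1 - Complex.exp (-2 * π * y))

lemma one_sub_exp_ne_zero {y : ℂ} (hy : y.re ≠ 0) : 1 - Complex.exp (-2 * π * y) ≠ 0 := by
  intro h
  have h1 : ‖Complex.exp (-2 * π * y)‖ = 1 := by
    rw [← sub_eq_zero.1 h, norm_one]
  rw [Complex.norm_exp, Real.exp_eq_one_iff] at h1
  simp [Real.pi_ne_zero] at h1
  exact hy h1

lemma continuous_lipKer (y : ℂ) : Continuous fun b => lipKer b y := by
  unfold lipKer; fun_prop

lemma fourInt_lipKer {y : ℂ} (hy : y.re ≠ 0) (n : ℤ) :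
    fourInt (fun b => lipKer b y) n = 1 / (2 * π * (y - I * n)) := by
  have h0 := one_sub_exp_ne_zero hy
  have hc0 : y - I * n ≠ 0 := by
    intro h
    apply hy
    have := congrArg Complex.re h
    simpa using this
  have hpi : (π : ℂ) ≠ 0 := by exact_mod_cast Real.pi_ne_zero
  have hc : -2 * π * (y - I * n) ≠ 0 := by
    simp [hpi, hc0]
  have h : ∀ b : ℝ, lipKer b y * ee (n * b) =
      (1 - Complex.exp (-2 * π * y))⁻¹ * Complex.exp (-2 * π * (y - I * n) * b) := by
    intro b
    rw [lipKer, ee, div_mul_eq_mul_div, ← Complex.exp_add, div_eq_inv_mul]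
    congr 2
    ring
  simp only [fourInt, h]
  rw [intervalIntegral.integral_const_mul, integral_exp_mul_complex hc]
  have h2 : Complex.exp (-2 * π * (y - I * n) * (1 : ℝ)) = Complex.exp (-2 * π * y) := by
    rw [show -2 * π * (y - I * n) * (1 : ℝ) = -2 * π * y + 2 * π * I * n by push_cast; ring,
      Complex.exp_add]
    have := ee_int n
    rw [ee] at this
    rw [this, mul_one]
  rw [h2]
  simp only [ofReal_zero, mul_zero, Complex.exp_zero]
  generalize Complex.exp (-2 * π * y) = E at h0
  field_simp
  ring

lemma BpolyC_eq (m : ℕ) (b : ℝ) : BpolyC m b = (bernoulliFun m b : ℂ) := by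
  rw [BpolyC, bernoulliFun, Polynomial.eval_map_algebraMap, ← Complex.coe_algebraMap,
    Polynomial.aeval_algebraMap_apply]

lemma continuous_BpolyC (m : ℕ) : Continuous fun b : ℝ => BpolyC m b := by
  simp only [BpolyC_eq]
  exact continuous_ofReal.comp (continuous_bernoulliFun m)

lemma fourInt_BpolyC {m : ℕ} (hm : m ≠ 0) (n : ℤ) :
    fourInt (fun b => BpolyC m b) n = -(Nat.factorial m : ℂ) / (-2 * π * I * n) ^ m := by
  have h := bernoulliFourierCoeff_eq hm (-n)
  rw [bernoulliFourierCoeff, fourierCoeffOn_eq_integral] at h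
  rw [show (-2 * π * I * n : ℂ) = 2 * π * I * (-n : ℤ) by push_cast; ring, ← h, fourInt]
  simp only [sub_zero, div_one, one_smul, neg_neg]
  refine intervalIntegral.integral_congr fun b _ => ?_
  simp only [fourier_coe_apply, ee, smul_eq_mul, BpolyC_eq]
  rw [mul_comm]
  congr 2
  push_cast
  ring

lemma fourInt_BpolyC_zero {n : ℤ} : fourInt (fun b => BpolyC 0 b) n = if n = 0 then 1 else 0 := by
  rw [show (fun b : ℝ => BpolyC 0 b) = fun b : ℝ => ee ((0 : ℤ) * b) by
    funext b; simp [BpolyC, ee], fourInt_ee, zero_add]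

lemma lipKer_neg (b : ℝ) {y : ℂ} (hy : y.re ≠ 0) : lipKer b (-y) = -lipKer (1 - b) y := by
  have h1 := one_sub_exp_ne_zero hy
  have h2 : 1 - Complex.exp (-2 * π * -y) ≠ 0 := one_sub_exp_ne_zero (by simpa using hy)
  rw [lipKer, lipKer, ← neg_div, div_eq_div_iff h2 h1]
  have e1 : Complex.exp (-2 * π * -y * b) =
      Complex.exp (-2 * π * y * (1 - b : ℝ)) * Complex.exp (-2 * π * -y) := by
    rw [← Complex.exp_add]; congr 1; push_cast; ring
  have e2 : Complex.exp (-2 * π * -y) * Complex.exp (-2 * π * y) = 1 := by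
    rw [← Complex.exp_add, ← Complex.exp_zero]; congr 1; ring
  rw [e1]
  linear_combination (-Complex.exp (-2 * π * y * (1 - b : ℝ))) * e2

lemma lipKer_one {y : ℂ} (hy : y.re ≠ 0) : lipKer 1 y = lipKer 0 y - 1 := by
  have h1 := one_sub_exp_ne_zero hy
  simp only [lipKer, ofReal_one, mul_one, ofReal_zero, mul_zero, Complex.exp_zero]
  generalize Complex.exp (-2 * π * y) = E at h1
  field_simp
  ring

lemma Scal_left (k : ℤ) (γ δ : ℝ) {t : ℂ} (ht : 0 < t.re) :
    Scal (k : ℂ) γ δ 0 0 t =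
      ∑' n : ℕ, ((n + fracP δ : ℝ) : ℂ) ^ (-k) * lipKer (fracP γ) (t * (n + fracP δ : ℝ)) ∧
    Summable fun n : ℕ =>
      ‖((n + fracP δ : ℝ) : ℂ) ^ (-k) * lipKer (fracP γ) (t * (n + fracP δ : ℝ))‖ := by
  have h := Scal_eq_tsum k γ δ 0 0 ht
  have e : ∀ n : ℕ, (((n + fracP δ : ℝ) : ℂ) ^ (-k) *
        ee ((fracP γ * 0 + (n + fracP δ) * 0 : ℝ)) *
        Complex.exp (-2 * π * t * ((n + fracP δ : ℝ) * fracP γ : ℝ))) /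
        (1 - ee (0 : ℝ) * Complex.exp (-2 * π * t * (n + fracP δ : ℝ))) =
      ((n + fracP δ : ℝ) : ℂ) ^ (-k) * lipKer (fracP γ) (t * (n + fracP δ : ℝ)) := by
    intro n
    simp only [mul_zero, add_zero, ofReal_zero, ee_zero, mul_one, one_mul, lipKer]
    rw [mul_div_assoc, ofReal_mul]
    ring_nf
  simpa only [e] using h

lemma Scal_right (k : ℤ) (μ lam : ℝ) {t : ℂ} (ht : 0 < t.re) :
    Scal (k : ℂ) 0 0 μ lam t =
      ∑' n : ℕ, ((n + 1 : ℂ) ^ (-k)) * ee ((n + 1) * lam) *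
        (ee μ * Complex.exp (-2 * π * t * (n + 1)) /
          (1 - ee μ * Complex.exp (-2 * π * t * (n + 1)))) ∧
    Summable fun n : ℕ => ‖((n + 1 : ℂ) ^ (-k)) * ee ((n + 1) * lam) *
        (ee μ * Complex.exp (-2 * π * t * (n + 1)) /
          (1 - ee μ * Complex.exp (-2 * π * t * (n + 1))))‖ := by
  have h := Scal_eq_tsum k 0 0 μ lam ht
  have h0 : fracP 0 = 1 := by simp [fracP]
  have e : ∀ n : ℕ, (((n + 1 : ℝ) : ℂ) ^ (-k) *
        ee ((1 * μ + (n + 1) * lam : ℝ)) *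
        Complex.exp (-2 * π * t * ((n + 1 : ℝ) * 1 : ℝ))) /
        (1 - ee μ * Complex.exp (-2 * π * t * (n + 1 : ℝ))) =
      ((n + 1 : ℂ) ^ (-k)) * ee ((n + 1) * lam) *
        (ee μ * Complex.exp (-2 * π * t * (n + 1)) /
          (1 - ee μ * Complex.exp (-2 * π * t * (n + 1)))) := by
    intro n
    have e1 : ee ((1 * μ + (n + 1) * lam : ℝ)) = ee μ * ee ((n + 1) * lam) := by
      rw [← ee_add]; congr 1; push_cast; ring
    rw [e1, mul_one]
    push_cast
    ring
  simpa only [h0, e] using h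

/-- The nonzero integers. -/
def intPts : ℕ ⊕ ℕ → ℤ := Sum.elim (fun n => n + 1) (fun n => -(n + 1))

lemma intPts_ne_zero (i : ℕ ⊕ ℕ) : intPts i ≠ 0 := by
  rcases i with n | n <;> simp [intPts] <;> omega

lemma exists_intPts_eq {m : ℤ} (hm : m ≠ 0) : ∃ i, intPts i = m := by
  rcases lt_or_gt_of_ne hm with h | h
  · exact ⟨.inr (-m - 1).toNat, by simp only [intPts, Sum.elim_inr]; omega⟩
  · exact ⟨.inl (m - 1).toNat, by simp only [intPts, Sum.elim_inl]; omega⟩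

lemma intPts_injective : Function.Injective intPts := by
  rintro (m | m) (n | n) h <;> simp only [intPts, Sum.elim_inl, Sum.elim_inr] at h
  · congr; omega
  · omega
  · omega
  · congr; omega

/-- The terms of the Lipschitz series. -/
def lipTerm (μ : ℝ) (τ : ℂ) (k : ℤ) (i : ℕ ⊕ ℕ) (b : ℝ) : ℂ :=
  (shiftPts μ i : ℂ) ^ (-k) * lipKer b (τ * shiftPts μ i)

lemma mul_shiftPts_re_ne_zero (μ : ℝ) {τ : ℂ} (hτ : 0 < τ.re) (i : ℕ ⊕ ℕ) :
    (τ * shiftPts μ i).re ≠ 0 := by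
  simp [hτ.ne', shiftPts_ne_zero]

lemma lipTerm_inr (μ : ℝ) {τ : ℂ} (hτ : 0 < τ.re) (k : ℤ) (n : ℕ) (b : ℝ) :
    lipTerm μ τ k (.inr n) b = (-1 : ℂ) ^ (k - 1) *
      (((n + fracP μ : ℝ) : ℂ) ^ (-k) * lipKer (1 - b) (τ * (n + fracP μ : ℝ))) := by
  have hre : (τ * (n + fracP μ : ℝ)).re ≠ 0 := by
    have := fracP_pos μ
    have : (0 : ℝ) < n + fracP μ := by positivity
    simp only [mul_re, ofReal_re, ofReal_im, mul_zero, sub_zero]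
    positivity
  have e : (shiftPts μ (.inr n) : ℂ) = -1 * ((n + fracP μ : ℝ) : ℂ) := by
    simp [shiftPts]
  rw [lipTerm, e, show τ * (-1 * ((n + fracP μ : ℝ) : ℂ)) = -(τ * (n + fracP μ : ℝ)) by ring,
    lipKer_neg _ hre, mul_zpow, zpow_neg, zpow_sub_one₀ (by norm_num : (-1 : ℂ) ≠ 0), ← inv_zpow]
  norm_num
  ring

lemma lipTerm_inl (μ : ℝ) (τ : ℂ) (k : ℤ) (n : ℕ) (b : ℝ) :
    lipTerm μ τ k (.inl n) b =
      ((n + fracP (-μ) : ℝ) : ℂ) ^ (-k) * lipKer b (τ * (n + fracP (-μ) : ℝ)) := rfl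

lemma hasSum_lipTerm {β : ℝ} (hβ : Int.fract β ≠ 0) (μ : ℝ) {τ : ℂ} (hτ : 0 < τ.re) (k : ℤ) :
    HasSum (fun i => lipTerm μ τ k i (Int.fract β))
      (Scal k β (-μ) 0 0 τ + (-1 : ℂ) ^ (k - 1) * Scal k (-β) μ 0 0 τ) := by
  obtain ⟨h1, s1⟩ := Scal_left k β (-μ) hτ
  obtain ⟨h2, s2⟩ := Scal_left k (-β) μ hτ
  rw [fracP_of_fract_ne_zero hβ] at h1 s1
  rw [fracP_neg β] at h2 s2
  rw [h1, h2]
  refine HasSum.sum s1.of_norm.hasSum ?_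
  simp only [Function.comp_def, lipTerm_inr μ hτ]
  exact s2.of_norm.hasSum.mul_left _

lemma hasSum_lipTerm_zero {β : ℝ} (hβ : Int.fract β = 0) (μ : ℝ) {τ : ℂ} (hτ : 0 < τ.re)
    {k : ℤ} {Z : ℂ} (hZ : HasSum (fun n : ℕ => ((n + fracP (-μ) : ℝ) : ℂ) ^ (-k)) Z) :
    HasSum (fun i => lipTerm μ τ k i 0)
      (Z + Scal k β (-μ) 0 0 τ + (-1 : ℂ) ^ (k - 1) * Scal k (-β) μ 0 0 τ) := by
  obtain ⟨h1, s1⟩ := Scal_left k β (-μ) hτ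
  obtain ⟨h2, s2⟩ := Scal_left k (-β) μ hτ
  rw [fracP_of_fract_eq_zero hβ] at h1 s1
  rw [fracP_neg β, hβ] at h2 s2
  rw [h1, h2]
  refine HasSum.sum ?_ ?_
  · refine (hZ.add s1.of_norm.hasSum).congr_fun fun n => ?_
    have hre := mul_shiftPts_re_ne_zero μ hτ (.inl n)
    simp only [shiftPts, Sum.elim_inl] at hre
    simp only [Function.comp_def, lipTerm_inl]
    rw [lipKer_one hre]
    ring
  · simp only [Function.comp_def, lipTerm_inr μ hτ]
    exact s2.of_norm.hasSum.mul_left _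

/-- The coefficients of the dual Lambert series. -/
def dualCoef (μ : ℝ) (τ : ℂ) (m : ℤ) : ℂ := 1 / (1 - ee μ * Complex.exp (-2 * π * m / τ))

/-- The terms of the dual Lambert series. -/
def dualTerm (μ : ℝ) (τ : ℂ) (k : ℤ) (i : ℕ ⊕ ℕ) (b : ℝ) : ℂ :=
  (intPts i : ℂ) ^ (-k) * ee (-(intPts i * b)) * (dualCoef μ τ (intPts i) - if i.isLeft then 1 else 0)

lemma inv_re_pos {τ : ℂ} (hτ : 0 < τ.re) : 0 < (1 / τ).re := by
  rw [one_div, Complex.inv_re]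
  exact div_pos hτ (Complex.normSq_pos.2 fun h => by simp [h] at hτ)

lemma one_sub_ee_mul_exp_ne_zero (μ : ℝ) {τ : ℂ} (hτ : 0 < τ.re) {m : ℤ} (hm : m ≠ 0) :
    1 - ee μ * Complex.exp (-2 * π * m / τ) ≠ 0 := by
  intro h
  have h1 : ‖ee μ * Complex.exp (-2 * π * m / τ)‖ = 1 := by rw [← sub_eq_zero.1 h, norm_one]
  have h2 : Complex.exp (-2 * π * m / τ) = Complex.exp (-2 * π * (1 / τ) * (m : ℝ)) := by
    congr 1; push_cast; ring
  rw [norm_mul, norm_ee, one_mul, h2, norm_exp_two_pi, Real.exp_eq_one_iff] at h1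
  have hm' : (m : ℝ) ≠ 0 := by exact_mod_cast hm
  exact mul_ne_zero (mul_ne_zero (mul_ne_zero (by norm_num) Real.pi_ne_zero)
    (inv_re_pos hτ).ne') hm' h1

lemma hasSum_dualTerm (β μ : ℝ) {τ : ℂ} (hτ : 0 < τ.re) (k : ℤ) :
    HasSum (fun i => dualTerm μ τ k i (Int.fract β))
      (Scal k 0 0 μ (-β) (1 / τ) + (-1 : ℂ) ^ (k - 1) * Scal k 0 0 (-μ) β (1 / τ)) := by
  obtain ⟨h1, s1⟩ := Scal_right k μ (-β) (inv_re_pos hτ)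
  obtain ⟨h2, s2⟩ := Scal_right k (-μ) β (inv_re_pos hτ)
  have hper : ∀ m : ℤ, ee (-(m * (Int.fract β : ℝ))) = ee (m * (-β : ℝ)) := by
    intro m
    have : (-(m * (Int.fract β : ℝ)) : ℂ) = m * (-β : ℝ) + (m * ⌊β⌋ : ℤ) := by
      rw [Int.fract]; push_cast; ring
    rw [this, ee_add, ee_int, mul_one]
  rw [h1, h2]
  refine HasSum.sum ?_ ?_
  · refine s1.of_norm.hasSum.congr_fun fun n => ?_
    have hne := one_sub_ee_mul_exp_ne_zero μ hτ (m := n + 1) (by omega)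
    simp only [Function.comp_def, dualTerm, intPts, Sum.elim_inl, Sum.isLeft_inl, if_true, hper,
      dualCoef]
    have e : (-2 * π * ((n + 1 : ℤ) : ℂ) / τ) = -2 * π * (1 / τ) * (n + 1) := by push_cast; ring
    rw [e] at hne ⊢
    push_cast
    congr 1
    generalize ee μ * Complex.exp (-2 * π * (1 / τ) * (n + 1)) = X at hne
    field_simp
    ring
  · refine (s2.of_norm.hasSum.mul_left _).congr_fun fun n => ?_
    have hne := one_sub_ee_mul_exp_ne_zero μ hτ (m := -(n + 1)) (by omega)
    have hne2 := one_sub_ee_mul_exp_ne_zero (-μ) hτ (m := n + 1) (by omega)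
    simp only [Function.comp_def, dualTerm, intPts, Sum.elim_inr, Sum.isLeft_inr, hper, dualCoef]
    have e : (-2 * π * ((n + 1 : ℤ) : ℂ) / τ) = -2 * π * (1 / τ) * (n + 1) := by push_cast; ring
    have e' : (-2 * π * ((-(n + 1) : ℤ) : ℂ) / τ) = -(-2 * π * (1 / τ) * (n + 1)) := by
      push_cast; ring
    rw [e] at hne2
    rw [e'] at hne ⊢
    have q : ee μ * Complex.exp (-(-2 * π * (1 / τ) * (n + 1))) *
        (ee (-μ : ℝ) * Complex.exp (-2 * π * (1 / τ) * (n + 1))) = 1 := by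
      rw [mul_mul_mul_comm, ← ee_add, ← Complex.exp_add, ofReal_neg, add_neg_cancel, ee_zero,
        neg_add_cancel, Complex.exp_zero, one_mul]
    have e2 : ((-(n + 1) : ℤ) : ℂ) ^ (-k) = (-1) ^ (-k) * ((n : ℂ) + 1) ^ (-k) := by
      rw [← mul_zpow]; push_cast; congr 1; ring
    have e3 : ((-(n + 1) : ℤ) : ℂ) * (-β : ℝ) = (n + 1) * β := by push_cast; ring
    have e4 : (-1 : ℂ) ^ (k - 1) = -(-1) ^ (-k) := by
      rw [zpow_sub_one₀ (by norm_num : (-1 : ℂ) ≠ 0), zpow_neg, ← inv_zpow]; norm_num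
    rw [e2, e3, e4]
    simp only [Bool.false_eq_true, if_false, sub_zero]
    generalize ee μ * Complex.exp (-(-2 * π * (1 / τ) * (n + 1))) = X at *
    generalize ee (-μ : ℝ) * Complex.exp (-2 * π * (1 / τ) * (n + 1)) = Y at *
    have : 1 / (1 - X) = -(Y / (1 - Y)) := by
      rw [← neg_div, div_eq_div_iff hne hne2]; linear_combination (-1 : ℂ) * q
    rw [this]
    ring

/-- The Bernoulli polynomial part of the transformation formula. -/
def bernPart (A : ℕ → ℂ) (τ : ℂ) (k : ℤ) (b : ℝ) : ℂ :=
  (-2 * (Real.pi : ℂ)) ^ k *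
    ∑ j ∈ Finset.range (k + 2).toNat,
      (-Complex.I) ^ j * A j * BpolyC ((k + 1).toNat - j) (b : ℂ) /
          ((Nat.factorial j : ℂ) * (Nat.factorial ((k + 1).toNat - j) : ℂ)) *
        τ ^ (k - (j : ℤ))

lemma continuous_bernPart (A : ℕ → ℂ) (τ : ℂ) (k : ℤ) : Continuous (bernPart A τ k) := by
  unfold bernPart
  refine continuous_const.mul (continuous_finsetSum _ fun j _ => ?_)
  exact ((continuous_const.mul (continuous_BpolyC _)).div_const _).mul continuous_const

lemma norm_lipKer_le_of_re_pos {b : ℝ} (hb : b ∈ Set.Icc (0 : ℝ) 1) {y : ℂ} {c : ℝ} (hc : 0 < c)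
    (hy : c ≤ y.re) : ‖lipKer b y‖ ≤ 1 / (1 - Real.exp (-2 * π * c)) := by
  have hE : Real.exp (-2 * π * c) < 1 := by
    rw [Real.exp_lt_one_iff]
    have := mul_pos Real.pi_pos hc
    linarith
  have h1 : 1 - Real.exp (-2 * π * c) ≤ ‖1 - Complex.exp (-2 * π * y)‖ := by
    have h2 := norm_sub_norm_le (1 : ℂ) (Complex.exp (-2 * π * y))
    have h3 : ‖Complex.exp (-2 * π * y)‖ = Real.exp (-2 * π * y.re) := by
      have := norm_exp_two_pi y 1
      simpa using this
    have h4 : Real.exp (-2 * π * y.re) ≤ Real.exp (-2 * π * c) := by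
      apply Real.exp_le_exp.2
      have := mul_le_mul_of_nonneg_left hy Real.pi_pos.le
      linarith
    rw [h3, norm_one] at h2
    linarith
  rw [lipKer, norm_div, norm_exp_two_pi]
  refine div_le_div₀ zero_le_one ?_ (by linarith) h1
  rw [Real.exp_le_one_iff]
  have := mul_nonneg (mul_nonneg Real.pi_pos.le (hc.le.trans hy)) hb.1
  linarith

lemma norm_lipKer_le {b : ℝ} (hb : b ∈ Set.Icc (0 : ℝ) 1) {y : ℂ} {c : ℝ} (hc : 0 < c)
    (hy : c ≤ |y.re|) : ‖lipKer b y‖ ≤ 1 / (1 - Real.exp (-2 * π * c)) := by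
  rcases le_abs.1 hy with h | h
  · exact norm_lipKer_le_of_re_pos hb hc h
  · have : lipKer b y = -lipKer (1 - b) (-y) := by
      rw [← lipKer_neg b (by simp; intro h0; rw [h0] at h; linarith), neg_neg]
    rw [this, norm_neg]
    exact norm_lipKer_le_of_re_pos ⟨by linarith [hb.2], by linarith [hb.1]⟩ hc (by simpa using h)

lemma exists_norm_lipTerm_le (μ : ℝ) {τ : ℂ} (hτ : 0 < τ.re) : ∃ C : ℝ, 0 ≤ C ∧
    ∀ i, ∀ b ∈ Set.Icc (0 : ℝ) 1, ‖lipKer b (τ * shiftPts μ i)‖ ≤ C := by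
  have hc : 0 < τ.re * shiftMin μ := mul_pos hτ (shiftMin_pos μ)
  have hE : Real.exp (-2 * π * (τ.re * shiftMin μ)) < 1 := by
    rw [Real.exp_lt_one_iff]
    have := mul_pos Real.pi_pos hc
    linarith
  refine ⟨1 / (1 - Real.exp (-2 * π * (τ.re * shiftMin μ))),
    div_nonneg zero_le_one (by linarith), fun i b hb => norm_lipKer_le hb hc ?_⟩
  simp only [mul_re, ofReal_re, ofReal_im, mul_zero, sub_zero, abs_mul, abs_of_pos hτ]
  exact mul_le_mul_of_nonneg_left (shiftMin_le μ i) hτ.le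

lemma shiftPts_ne_mul_inv (μ : ℝ) {τ : ℂ} (hτ : 0 < τ.re) (n : ℤ) (i : ℕ ⊕ ℕ) :
    (shiftPts μ i : ℂ) - I * n / τ ≠ 0 := by
  have hτ0 : τ ≠ 0 := fun h => by simp [h] at hτ
  intro h
  have h1 : τ * shiftPts μ i = I * n := by field_simp at h; linear_combination h
  have := congrArg Complex.re h1
  exact mul_shiftPts_re_ne_zero μ hτ i (by rw [h1]; simp)

lemma fourInt_lipTerm (μ : ℝ) {τ : ℂ} (hτ : 0 < τ.re) (k : ℕ) (i : ℕ ⊕ ℕ) (n : ℤ) :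
    fourInt (lipTerm μ τ k i) n =
      1 / (2 * π * τ) * (1 / ((shiftPts μ i : ℂ) ^ k * (shiftPts μ i - I * n / τ))) := by
  have hτ0 : τ ≠ 0 := fun h => by simp [h] at hτ
  have hpi : (π : ℂ) ≠ 0 := by exact_mod_cast Real.pi_ne_zero
  have h1 : (shiftPts μ i : ℂ) ≠ 0 := by exact_mod_cast shiftPts_ne_zero μ i
  have h2 := shiftPts_ne_mul_inv μ hτ n i
  have e : τ * shiftPts μ i - I * n = τ * (shiftPts μ i - I * n / τ) := by field_simp
  unfold lipTerm
  rw [fourInt_const_mul, fourInt_lipKer (mul_shiftPts_re_ne_zero μ hτ i), e, zpow_neg, zpow_natCast]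
  field_simp

lemma lipSum_fourier (μ : ℝ) {τ : ℂ} (hτ : 0 < τ.re) {k : ℕ} (hk : 2 ≤ k) :
    ContinuousOn (fun b => ∑' i, lipTerm μ τ k i b) (Set.Icc 0 1) ∧
    ∀ n : ℤ, fourInt (fun b => ∑' i, lipTerm μ τ k i b) n =
      1 / (2 * π * τ) * shiftCauchy μ k (I * n / τ) := by
  obtain ⟨C, hC0, hC⟩ := exists_norm_lipTerm_le μ hτ
  obtain ⟨h1, h2⟩ := continuousOn_hasSum_fourInt (F := lipTerm μ τ k)
    (u := fun i => ‖1 / (shiftPts μ i : ℂ) ^ k‖ * C)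
    (fun i => continuous_const.mul (continuous_lipKer _))
    ((summable_norm_shiftPts μ hk).mul_right _)
    (fun i b hb => by
      rw [lipTerm, norm_mul, zpow_neg, zpow_natCast, one_div]
      exact mul_le_mul_of_nonneg_left (hC i b hb) (norm_nonneg _))
  refine ⟨h1, fun n => ?_⟩
  rw [← (h2 n).tsum_eq, shiftCauchy, ← tsum_mul_left]
  exact tsum_congr fun i => fourInt_lipTerm μ hτ k i n

lemma expSum_fourier {c : ℕ ⊕ ℕ → ℂ} (hc : Summable fun i => ‖c i‖) :
    ContinuousOn (fun b : ℝ => ∑' i, c i * ee (-(intPts i * b))) (Set.Icc 0 1) ∧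
    (∀ i, fourInt (fun b : ℝ => ∑' i, c i * ee (-(intPts i * b))) (intPts i) = c i) ∧
    fourInt (fun b : ℝ => ∑' i, c i * ee (-(intPts i * b))) 0 = 0 := by
  have hn : ∀ (m : ℤ) (b : ℝ), ‖ee (-(m * b))‖ = 1 := by
    intro m b
    have := norm_ee (-(m * b))
    push_cast at this
    exact this
  obtain ⟨h1, h2⟩ := continuousOn_hasSum_fourInt
    (F := fun i (b : ℝ) => c i * ee (-(intPts i * b))) (u := fun i => ‖c i‖)
    (fun i => continuous_const.mul (continuous_ee.comp (by fun_prop))) hc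
    (fun i b _ => by rw [norm_mul, hn, mul_one])
  have h3 : ∀ i n, fourInt (fun b : ℝ => c i * ee (-(intPts i * b))) n =
      c i * if n = intPts i then 1 else 0 := by
    intro i n
    have : (fun b : ℝ => ee (-(intPts i * b))) = fun b : ℝ => ee ((-intPts i : ℤ) * b) := by
      funext b; congr 1; push_cast; ring
    rw [fourInt_const_mul, this, fourInt_ee]
    congr 1
    exact if_congr (by omega) rfl rfl
  refine ⟨h1, fun i => ?_, ?_⟩
  · refine (h2 _).unique ?_
    simp only [h3]
    convert hasSum_single i fun j hj => ?_
    · simp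
    · rw [if_neg fun h => hj (intPts_injective h).symm, mul_zero]
  · refine (h2 _).unique ?_
    simp only [h3]
    convert hasSum_zero with i
    rw [if_neg (intPts_ne_zero i).symm, mul_zero]

lemma fourInt_bernPart (A : ℕ → ℂ) {τ : ℂ} (hτ : 0 < τ.re) (k : ℕ) (n : ℤ) :
    fourInt (bernPart A τ k) n = if n = 0 then
        -(1 / (2 * π * τ)) * (A (k + 1) * (2 * π * I) ^ (k + 1) / (Nat.factorial (k + 1) : ℂ)) else
      1 / (2 * π * τ) * ((∑ j ∈ Finset.range (k + 1), A j * (2 * π * I) ^ j /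
        (Nat.factorial j : ℂ) * (I * n / τ) ^ j) / (I * n / τ) ^ (k + 1)) := by
  have hτ0 : τ ≠ 0 := fun h => by simp [h] at hτ
  have hpi : (π : ℂ) ≠ 0 := by exact_mod_cast Real.pi_ne_zero
  have ek : ((k : ℤ) + 2).toNat = k + 1 + 1 := by omega
  have ek' : ((k : ℤ) + 1).toNat = k + 1 := by omega
  have hcont : ∀ j : ℕ, Continuous fun b : ℝ => (-I) ^ j * A j * BpolyC (k + 1 - j) b /
      ((Nat.factorial j : ℂ) * (Nat.factorial (k + 1 - j) : ℂ)) * τ ^ ((k : ℤ) - j) := fun j =>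
    ((continuous_const.mul (continuous_BpolyC _)).div_const _).mul continuous_const
  unfold bernPart
  rw [fourInt_const_mul, ek, ek', fourInt_finset_sum _ fun j _ => (hcont j).continuousOn]
  have hterm : ∀ j, fourInt (fun b : ℝ => (-I) ^ j * A j * BpolyC (k + 1 - j) b /
      ((Nat.factorial j : ℂ) * (Nat.factorial (k + 1 - j) : ℂ)) * τ ^ ((k : ℤ) - j)) n =
      (-I) ^ j * A j / ((Nat.factorial j : ℂ) * (Nat.factorial (k + 1 - j) : ℂ)) *
        τ ^ ((k : ℤ) - j) * fourInt (fun b : ℝ => BpolyC (k + 1 - j) b) n := by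
    intro j
    rw [← fourInt_const_mul]
    congr 1
    funext b
    ring
  simp only [hterm]
  rw [Finset.sum_range_succ]
  have hlast : fourInt (fun b : ℝ => BpolyC (k + 1 - (k + 1)) b) n = if n = 0 then 1 else 0 := by
    rw [Nat.sub_self]; exact fourInt_BpolyC_zero
  have hI2 : ∀ j : ℕ, (-2 * π : ℂ) ^ j * (-I) ^ j = (2 * π * I) ^ j := by
    intro j; rw [← mul_pow]; congr 1; ring
  rw [hlast]
  split_ifs with h0
  · rw [Finset.sum_eq_zero, zero_add, Nat.sub_self, Nat.factorial_zero, ← hI2, pow_succ (-2 * π : ℂ)]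
    · rw [show (k : ℤ) - (k + 1 : ℕ) = -1 by push_cast; ring, zpow_natCast, zpow_neg_one]
      have : (Nat.factorial (k + 1) : ℂ) ≠ 0 := by exact_mod_cast Nat.factorial_ne_zero _
      field_simp
      push_cast
      ring
    · intro j hj
      have hj' : k + 1 - j ≠ 0 := by have := Finset.mem_range.1 hj; omega
      rw [fourInt_BpolyC hj', h0, Int.cast_zero, mul_zero, zero_pow hj', div_zero, mul_zero]
  · have hn : (n : ℂ) ≠ 0 := by exact_mod_cast h0
    rw [mul_zero, add_zero, Finset.mul_sum, Finset.sum_div, Finset.mul_sum]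
    refine Finset.sum_congr rfl fun j hj => ?_
    have hj1 := Finset.mem_range.1 hj
    obtain ⟨m, hm⟩ : ∃ m, k = j + m := ⟨k - j, by omega⟩
    have hj' : k + 1 - j = m + 1 := by omega
    rw [hj', fourInt_BpolyC (by omega), hm, ← hI2]
    have f1 : (Nat.factorial j : ℂ) ≠ 0 := by exact_mod_cast Nat.factorial_ne_zero _
    have f2 : (Nat.factorial (m + 1) : ℂ) ≠ 0 := by exact_mod_cast Nat.factorial_ne_zero _
    rw [show ((j + m : ℕ) : ℤ) - j = m by push_cast; ring, zpow_natCast, zpow_natCast]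
    have e1 : (-2 * π * I * n : ℂ) = (-2 * π) * τ * (I * n / τ) := by field_simp
    have hw : I * n / τ ≠ 0 := div_ne_zero (mul_ne_zero I_ne_zero hn) hτ0
    rw [e1]
    generalize I * n / τ = w at hw
    have h2 : (-2 * π : ℂ) ≠ 0 := mul_ne_zero (by norm_num) hpi
    have e2 : (2 * π * τ : ℂ) = -((-2 * π) * τ) := by ring
    rw [e2]
    generalize (-2 * π : ℂ) = p at h2
    rw [mul_pow, mul_pow]
    field_simp
    ring

lemma shiftCauchy_zero (μ : ℝ) (k : ℕ) : shiftCauchy μ k 0 = shiftSum μ (k + 1) := by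
  simp only [shiftCauchy, shiftSum, sub_zero, pow_succ]

lemma ee_I_mul_div (n : ℤ) (τ : ℂ) : ee (I * n / τ) = Complex.exp (-2 * π * n / τ) := by
  rw [ee]
  congr 1
  rw [show 2 * π * I * (I * n / τ) = 2 * π * (I * I) * n / τ by ring, I_mul_I]
  ring

lemma I_mul_inv_mul_pow {τ : ℂ} (hτ0 : τ ≠ 0) {n : ℤ} (hn : (n : ℂ) ≠ 0) (k : ℕ) :
    I / τ / (I * n / τ) ^ k = (-I * τ) ^ ((k : ℤ) - 1) * (n : ℂ) ^ (-(k : ℤ)) := by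
  have h1 : -I * τ ≠ 0 := mul_ne_zero (neg_ne_zero.2 I_ne_zero) hτ0
  rw [zpow_sub_one₀ h1, zpow_neg, zpow_natCast, zpow_natCast, mul_pow, mul_inv]
  have e : I / τ / (I * n / τ) ^ k = (I / τ) * ((I⁻¹ * τ) ^ k * ((n : ℂ) ^ k)⁻¹) := by
    rw [← inv_pow (n : ℂ), ← mul_pow, div_eq_mul_inv _ ((I * n / τ) ^ k), ← inv_pow]
    congr 2
    field_simp
  rw [e, Complex.inv_I, mul_pow]
  have : (-I)⁻¹ = I := by rw [inv_neg, Complex.inv_I, neg_neg]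
  rw [this]
  ring

lemma summable_dualCoef (μ : ℝ) {τ : ℂ} (hτ : 0 < τ.re) (k : ℤ) :
    Summable fun i => ‖(intPts i : ℂ) ^ (-k) *
      (dualCoef μ τ (intPts i) - if i.isLeft then 1 else 0)‖ := by
  have := (hasSum_dualTerm 0 μ hτ k).summable.norm
  simpa [dualTerm, ee_zero] using this

lemma summable_intPts {k : ℕ} (hk : 2 ≤ k) : Summable fun i => ‖(intPts i : ℂ) ^ (-(k : ℤ)) *
    (if i.isLeft then 1 else 0)‖ := by
  have h : Summable fun n : ℕ => ‖((n + 1 : ℕ) : ℂ) ^ (-(k : ℤ))‖ := by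
    have := (summable_nat_add_iff 1).2 (Real.summable_one_div_nat_pow.2 (show 1 < k by omega))
    refine this.congr fun n => ?_
    rw [zpow_neg, zpow_natCast, norm_inv, norm_pow, Complex.norm_natCast, one_div]
  refine (HasSum.sum (a := ∑' n : ℕ, ‖((n + 1 : ℕ) : ℂ) ^ (-(k : ℤ))‖) (b := 0) ?_ ?_).summable
  · refine h.hasSum.congr_fun fun n => ?_
    simp [intPts]
  · refine hasSum_zero.congr_fun fun n => ?_
    simp [intPts]

lemma lipSum_eq_of_two_le (μ : ℝ) {τ : ℂ} (hτ : 0 < τ.re) {A : ℕ → ℂ}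
    (hA : ∀ᶠ Z in nhdsWithin (0 : ℂ) {(0 : ℂ)}ᶜ,
      HasSum (fun j : ℕ => A j * Z ^ j / (Nat.factorial j : ℂ)) (Z / (ee μ * Complex.exp Z - 1)))
    {k : ℕ} (hk : 2 ≤ k) {b : ℝ} (hb : b ∈ Set.Icc (0 : ℝ) 1) :
    ∑' i, lipTerm μ τ k i b - bernPart A τ k b = (-I * τ) ^ ((k : ℤ) - 1) *
      ∑' i, (intPts i : ℂ) ^ (-(k : ℤ)) * dualCoef μ τ (intPts i) * ee (-(intPts i * b)) := by
  have hτ0 : τ ≠ 0 := fun h => by simp [h] at hτ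
  have hpi : (π : ℂ) ≠ 0 := by exact_mod_cast Real.pi_ne_zero
  have hs : Summable fun i => ‖(intPts i : ℂ) ^ (-(k : ℤ)) * dualCoef μ τ (intPts i)‖ := by
    refine (summable_norm_iff.2 ((summable_norm_iff.1 (summable_dualCoef μ hτ k)).add
      (summable_norm_iff.1 (summable_intPts hk)))).congr fun i => ?_
    congr 1
    ring
  obtain ⟨c1, f1⟩ := lipSum_fourier μ hτ hk
  obtain ⟨c2, f2, f3⟩ := expSum_fourier hs
  have c3 := (continuous_bernPart A τ k).continuousOn (s := Set.Icc 0 1)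
  have c4 : ContinuousOn (fun b : ℝ => ∑' i, lipTerm μ τ k i b - bernPart A τ k b)
      (Set.Icc 0 1) := c1.sub c3
  have c5 : ContinuousOn (fun b : ℝ => (-I * τ) ^ ((k : ℤ) - 1) *
      ∑' i, (intPts i : ℂ) ^ (-(k : ℤ)) * dualCoef μ τ (intPts i) * ee (-(intPts i * b)))
      (Set.Icc 0 1) := continuousOn_const.mul c2
  rw [← sub_eq_zero]
  refine eq_zero_of_fourInt_eq_zero (D := fun b : ℝ => (∑' i, lipTerm μ τ k i b - bernPart A τ k b) -
    (-I * τ) ^ ((k : ℤ) - 1) *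
      ∑' i, (intPts i : ℂ) ^ (-(k : ℤ)) * dualCoef μ τ (intPts i) * ee (-(intPts i * b)))
    (c4.sub c5) (fun n => ?_) hb
  rw [fourInt_sub c4 c5, fourInt_sub c1 c3, fourInt_const_mul, f1, fourInt_bernPart A hτ]
  by_cases h0 : n = 0
  · subst h0
    rw [if_pos rfl, f3, Int.cast_zero, mul_zero, zero_div, shiftCauchy_zero,
      (coeff_eq_shiftSum μ hA).2.1 (k + 1) (by omega)]
    ring
  · rw [if_neg h0]
    obtain ⟨i, hi⟩ := exists_intPts_eq h0
    have hn : (n : ℂ) ≠ 0 := by exact_mod_cast h0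
    have hw0 : I * n / τ ≠ 0 := div_ne_zero (mul_ne_zero I_ne_zero hn) hτ0
    have hP := pow_mul_shiftCauchy μ hA hw0
      (fun i => sub_ne_zero.1 (shiftPts_ne_mul_inv μ hτ n i)) (show 1 ≤ k by omega)
    rw [← hi, f2 i, hi, ← mul_assoc, ← I_mul_inv_mul_pow hτ0 hn, dualCoef]
    have hne := one_sub_ee_mul_exp_ne_zero μ hτ h0
    rw [ee_I_mul_div] at hP
    generalize ee μ * Complex.exp (-2 * π * n / τ) = X at hP hne
    have hne' : X - 1 ≠ 0 := by rw [← neg_ne_zero, neg_sub]; exact hne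
    have hP' : shiftCauchy μ k (I * n / τ) = (∑ j ∈ Finset.range (k + 1),
        A j * (2 * π * I) ^ j / (Nat.factorial j : ℂ) * (I * n / τ) ^ j) / (I * n / τ) ^ (k + 1) -
        2 * π * I * (I * n / τ) / (X - 1) / (I * n / τ) ^ (k + 1) := by
      rw [← sub_div, ← hP]
      field_simp
    rw [hP']
    have e : 2 * π * I * (I * n / τ) / (X - 1) / (I * n / τ) ^ (k + 1) =
      -(2 * π * I * (1 / (1 - X)) / (I * n / τ) ^ k) := by
      rw [pow_succ]
      generalize I * n / τ = w at hw0
      rw [show X - 1 = -(1 - X) by ring]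
      field_simp
    rw [e]
    field_simp
    ring

lemma expZeta_fract (β : ℝ) (s : ℂ) :
    HurwitzZeta.expZeta ((-β : ℝ) : UnitAddCircle) s =
      HurwitzZeta.expZeta ((-Int.fract β : ℝ) : UnitAddCircle) s := by
  congr 1
  rw [← sub_eq_zero, ← AddCircle.coe_sub, AddCircle.coe_eq_zero_iff]
  exact ⟨-⌊β⌋, by simp only [zsmul_eq_mul, mul_one, Int.cast_neg]; linarith [Int.floor_add_fract β]⟩

lemma hurwitzZeta_fracP (x : ℝ) (s : ℂ) :
    HurwitzZeta.hurwitzZeta ((x : ℝ) : UnitAddCircle) s =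
      HurwitzZeta.hurwitzZeta ((fracP x : ℝ) : UnitAddCircle) s := by
  congr 1
  rw [← sub_eq_zero, ← AddCircle.coe_sub, AddCircle.coe_eq_zero_iff]
  refine ⟨-⌊-x⌋ - 1, ?_⟩
  rw [fracP]
  simp only [zsmul_eq_mul, mul_one, Int.cast_sub, Int.cast_neg, Int.cast_one]
  linarith [Int.floor_add_fract (-x)]

lemma hasSum_expZeta_neg {k : ℕ} (hk : 2 ≤ k) (b : ℝ) :
    HasSum (fun n : ℕ => ((n + 1 : ℤ) : ℂ) ^ (-(k : ℤ)) * ee (-(((n + 1 : ℤ) : ℂ) * b)))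
      (HurwitzZeta.expZeta ((-b : ℝ) : UnitAddCircle) (k : ℂ)) := by
  have h := HurwitzZeta.hasSum_expZeta_of_one_lt_re (-b) (s := (k : ℂ))
    (by simp only [natCast_re]; exact_mod_cast hk)
  rw [← hasSum_nat_add_iff' 1] at h
  simp only [Finset.sum_range_one, Nat.cast_zero, Complex.cpow_natCast,
    zero_pow (show k ≠ 0 by omega), div_zero, sub_zero] at h
  refine h.congr_fun fun n => ?_
  rw [zpow_neg, zpow_natCast, ee, inv_mul_eq_div]
  push_cast
  congr 2
  ring

lemma hasSum_hurwitzZeta_fracP {k : ℕ} (hk : 2 ≤ k) (μ : ℝ) :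
    HasSum (fun n : ℕ => ((n + fracP (-μ) : ℝ) : ℂ) ^ (-(k : ℤ)))
      (HurwitzZeta.hurwitzZeta ((-μ : ℝ) : UnitAddCircle) (k : ℂ)) := by
  rw [hurwitzZeta_fracP]
  have h := HurwitzZeta.hasSum_hurwitzZeta_of_one_lt_re (a := fracP (-μ))
    ⟨(fracP_pos _).le, fracP_le_one _⟩ (s := (k : ℂ))
    (by simp only [natCast_re]; exact_mod_cast hk)
  refine h.congr_fun fun n => ?_
  rw [zpow_neg, zpow_natCast, Complex.cpow_natCast, one_div]
  push_cast
  rfl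

lemma dInt_eq (β : ℝ) : dInt β = if Int.fract β = 0 then 1 else 0 := by
  unfold dInt
  refine if_congr ?_ rfl rfl
  rw [Int.fract_eq_zero_iff]
  rfl

/-- The transformation formula at exponents at least two. -/
lemma transformation_of_two_le (β μ : ℝ) {τ : ℂ} (hτ : 0 < τ.re) {A : ℕ → ℂ}
    (hA : ∀ᶠ Z in nhdsWithin (0 : ℂ) {(0 : ℂ)}ᶜ,
      HasSum (fun j : ℕ => A j * Z ^ j / (Nat.factorial j : ℂ)) (Z / (ee μ * Complex.exp Z - 1)))
    {k : ℕ} (hk : 2 ≤ k) :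
    dInt β * HurwitzZeta.hurwitzZeta ((-μ : ℝ) : UnitAddCircle) (k : ℂ) +
        Scal (k : ℤ) β (-μ) 0 0 τ + (-1 : ℂ) ^ ((k : ℤ) - 1) * Scal (k : ℤ) (-β) μ 0 0 τ -
        bernPart A τ k (Int.fract β) =
      (-I * τ) ^ ((k : ℤ) - 1) *
        (HurwitzZeta.expZeta ((-β : ℝ) : UnitAddCircle) (k : ℂ) + Scal (k : ℤ) 0 0 μ (-β) (1 / τ) +
          (-1 : ℂ) ^ ((k : ℤ) - 1) * Scal (k : ℤ) 0 0 (-μ) β (1 / τ)) := by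
  have hb : Int.fract β ∈ Set.Icc (0 : ℝ) 1 := ⟨Int.fract_nonneg _, (Int.fract_lt_one _).le⟩
  have h := lipSum_eq_of_two_le μ hτ hA hk hb
  have hL : ∑' i, lipTerm μ τ k i (Int.fract β) =
      dInt β * HurwitzZeta.hurwitzZeta ((-μ : ℝ) : UnitAddCircle) (k : ℂ) +
        Scal (k : ℤ) β (-μ) 0 0 τ + (-1 : ℂ) ^ ((k : ℤ) - 1) * Scal (k : ℤ) (-β) μ 0 0 τ := by
    rw [dInt_eq]
    split_ifs with h0
    · rw [h0, one_mul]
      exact (hasSum_lipTerm_zero h0 μ hτ (hasSum_hurwitzZeta_fracP hk μ)).tsum_eq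
    · rw [zero_mul, zero_add]
      exact (hasSum_lipTerm h0 μ hτ k).tsum_eq
  have hE : HasSum (fun i => (intPts i : ℂ) ^ (-(k : ℤ)) * dualCoef μ τ (intPts i) *
      ee (-(intPts i * (Int.fract β : ℝ))))
      (HurwitzZeta.expZeta ((-β : ℝ) : UnitAddCircle) (k : ℂ) + (Scal (k : ℤ) 0 0 μ (-β) (1 / τ) +
          (-1 : ℂ) ^ ((k : ℤ) - 1) * Scal (k : ℤ) 0 0 (-μ) β (1 / τ))) := by
    have h1 : HasSum (fun i : ℕ ⊕ ℕ => (intPts i : ℂ) ^ (-(k : ℤ)) *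
        ee (-(intPts i * (Int.fract β : ℝ))) * if i.isLeft then 1 else 0)
        (HurwitzZeta.expZeta ((-β : ℝ) : UnitAddCircle) (k : ℂ) + 0) := by
      rw [expZeta_fract]
      refine HasSum.sum ?_ ?_
      · refine (hasSum_expZeta_neg hk (Int.fract β)).congr_fun fun n => ?_
        simp [intPts]
      · refine hasSum_zero.congr_fun fun n => ?_
        simp
    rw [add_zero] at h1
    refine (h1.add (hasSum_dualTerm β μ hτ k)).congr_fun fun i => ?_
    rw [dualTerm]
    ring
  rw [hL, hE.tsum_eq] at h
  rw [h]
  ring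

lemma norm_ee_sub_one_le (b : ℝ) : ‖ee b - 1‖ ≤ 2 * π * |b| := by
  have h := Real.norm_exp_I_mul_ofReal_sub_one_le (x := 2 * π * b)
  rw [ee, show 2 * π * I * b = I * (2 * π * b : ℝ) by push_cast; ring]
  refine h.trans ?_
  rw [Real.norm_eq_abs, abs_mul, abs_of_pos (by positivity)]

lemma norm_ee_one_sub (b : ℝ) : ‖ee (1 - b : ℝ) - 1‖ = ‖ee b - 1‖ := by
  have h1 : ee (1 - b : ℝ) - 1 = ee (-b : ℝ) * (1 - ee b) := by
    have : ee (1 - b : ℝ) = ee (-b : ℝ) := by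
      rw [show ((1 - b : ℝ) : ℂ) = (1 : ℤ) + (-b : ℝ) by push_cast; ring, ee_add, ee_int, one_mul]
    rw [this, mul_sub, ← ee_add, ofReal_neg, neg_add_cancel, ee_zero, mul_one]
  rw [h1, norm_mul, norm_ee, one_mul, norm_sub_rev]

lemma norm_sq_mul_lipKer_le_of_re_pos {b : ℝ} (hb : 0 ≤ b) {y : ℂ} {c : ℝ}
    (hc : 0 < c) (hy : c ≤ y.re) :
    ‖(ee b - 1) ^ 2 * lipKer b y‖ ≤ 2 / (1 - Real.exp (-2 * π * c)) * (1 / |y.re| ^ 2) := by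
  have hy0 := hc.trans_le hy
  have h0 := norm_lipKer_le_of_re_pos (b := 0) ⟨le_rfl, zero_le_one⟩ hc hy
  have h1 : lipKer b y = Complex.exp (-2 * π * y * b) * lipKer 0 y := by
    simp [lipKer, div_eq_mul_inv]
  have hE : 0 ≤ 1 / (1 - Real.exp (-2 * π * c)) := (norm_nonneg _).trans h0
  have h2 : ‖ee b - 1‖ ^ 2 * Real.exp (-2 * π * y.re * b) ≤ 2 * (1 / |y.re| ^ 2) := by
    have hx : 0 ≤ 2 * π * b * y.re := by positivity
    have h3 := Real.quadratic_le_exp_of_nonneg hx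
    have h4 : ‖ee b - 1‖ ^ 2 ≤ (2 * π * b) ^ 2 := by
      have := norm_ee_sub_one_le b
      rw [abs_of_nonneg hb] at this
      gcongr
    rw [abs_of_pos hy0, show -2 * π * y.re * b = -(2 * π * b * y.re) by ring, Real.exp_neg,
      ← div_eq_mul_inv, mul_one_div, div_le_div_iff₀ (Real.exp_pos _) (by positivity)]
    calc ‖ee b - 1‖ ^ 2 * y.re ^ 2 ≤ (2 * π * b) ^ 2 * y.re ^ 2 := by gcongr
      _ ≤ 2 * Real.exp (2 * π * b * y.re) := by nlinarith
  rw [norm_mul, norm_pow, h1, norm_mul, norm_exp_two_pi, ← mul_assoc]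
  calc _ ≤ 2 * (1 / |y.re| ^ 2) * (1 / (1 - Real.exp (-2 * π * c))) := by gcongr
    _ = _ := by ring

lemma norm_sq_mul_lipKer_le {b : ℝ} (hb : b ∈ Set.Icc (0 : ℝ) 1) {y : ℂ} {c : ℝ} (hc : 0 < c)
    (hy : c ≤ |y.re|) :
    ‖(ee b - 1) ^ 2 * lipKer b y‖ ≤ 2 / (1 - Real.exp (-2 * π * c)) * (1 / |y.re| ^ 2) := by
  rcases le_abs.1 hy with h | h
  · exact norm_sq_mul_lipKer_le_of_re_pos hb.1 hc h
  · have : lipKer b y = -lipKer (1 - b) (-y) := by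
      rw [← lipKer_neg b (by simp; intro h0; rw [h0] at h; linarith), neg_neg]
    have h2 := norm_sq_mul_lipKer_le_of_re_pos (b := 1 - b) (by linarith [hb.2]) (y := -y) hc
      (by simpa using h)
    rw [norm_mul, norm_pow, norm_ee_one_sub, neg_re, abs_neg] at h2
    rwa [this, norm_mul, norm_pow, norm_neg]

lemma fourInt_ee_sub_one_sq_mul {F : ℝ → ℂ} (hF : ContinuousOn F (Set.Icc 0 1)) (n : ℤ) :
    fourInt (fun b => (ee b - 1) ^ 2 * F b) n =
      fourInt F (n + 2) - 2 * fourInt F (n + 1) + fourInt F n := by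
  have hc : ∀ m : ℤ, ContinuousOn (fun b : ℝ => ee (m * b) * F b) (Set.Icc 0 1) := fun m =>
    (continuous_ee.comp (by fun_prop)).continuousOn.mul hF
  have e : (fun b : ℝ => (ee b - 1) ^ 2 * F b) = fun b : ℝ =>
      (ee ((2 : ℤ) * b) * F b - 2 * (ee ((1 : ℤ) * b) * F b)) + F b := by
    funext b
    have : ee ((2 : ℤ) * b) = ee b ^ 2 := by
      rw [show ((2 : ℤ) * b : ℂ) = b + b by push_cast; ring, ee_add, sq]
    rw [this, Int.cast_one, one_mul]
    ring
  have h2 : ContinuousOn (fun b : ℝ => 2 * (ee ((1 : ℤ) * b) * F b)) (Set.Icc 0 1) :=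
    continuousOn_const.mul (hc 1)
  have h3 : ContinuousOn (fun b : ℝ => ee ((2 : ℤ) * b) * F b - 2 * (ee ((1 : ℤ) * b) * F b))
      (Set.Icc 0 1) := (hc 2).sub h2
  rw [e, fourInt_add h3 hF, fourInt_sub (hc 2) h2, fourInt_const_mul, fourInt_ee_mul,
    fourInt_ee_mul]

lemma hasSum_inv_sub_diff (μ : ℝ) {a b c : ℂ} (ha : ∀ i, (shiftPts μ i : ℂ) - a ≠ 0)
    (hb : ∀ i, (shiftPts μ i : ℂ) - b ≠ 0) (hc : ∀ i, (shiftPts μ i : ℂ) - c ≠ 0) :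
    HasSum (fun i => 1 / (shiftPts μ i - a) - 2 * (1 / (shiftPts μ i - b)) +
        1 / (shiftPts μ i - c))
      (a * shiftCauchy μ 1 a - 2 * (b * shiftCauchy μ 1 b) + c * shiftCauchy μ 1 c) := by
  have h : ∀ w, HasSum (fun i => w * (1 / ((shiftPts μ i : ℂ) ^ 1 * (shiftPts μ i - w))))
      (w * shiftCauchy μ 1 w) := fun w =>
    (summable_norm_iff.1 (summable_shiftCauchy μ le_rfl w)).hasSum.mul_left w
  refine (((h a).sub ((h b).mul_left 2)).add (h c)).congr_fun fun i => ?_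
  have h0 : (shiftPts μ i : ℂ) ≠ 0 := by exact_mod_cast shiftPts_ne_zero μ i
  have h1 := ha i
  have h2 := hb i
  have h3 := hc i
  field_simp
  ring

lemma lipSum_zero_fourier (μ : ℝ) {τ : ℂ} (hτ : 0 < τ.re) :
    ContinuousOn (fun b : ℝ => ∑' i, (ee b - 1) ^ 2 * lipTerm μ τ 0 i b) (Set.Icc 0 1) ∧
    ∀ n : ℤ, fourInt (fun b : ℝ => ∑' i, (ee b - 1) ^ 2 * lipTerm μ τ 0 i b) n =
      1 / (2 * π * τ) * (I * (n + 2 : ℤ) / τ * shiftCauchy μ 1 (I * (n + 2 : ℤ) / τ) -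
        2 * (I * (n + 1 : ℤ) / τ * shiftCauchy μ 1 (I * (n + 1 : ℤ) / τ)) +
        I * n / τ * shiftCauchy μ 1 (I * n / τ)) := by
  have hc : 0 < τ.re * shiftMin μ := mul_pos hτ (shiftMin_pos μ)
  have hcont : ∀ i, Continuous (lipTerm μ τ 0 i) := fun i =>
    continuous_const.mul (continuous_lipKer _)
  obtain ⟨h1, h2⟩ := continuousOn_hasSum_fourInt
    (F := fun i (b : ℝ) => (ee b - 1) ^ 2 * lipTerm μ τ 0 i b)
    (u := fun i => 2 / (1 - Real.exp (-2 * π * (τ.re * shiftMin μ))) *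
      ((1 / τ.re ^ 2) * (1 / |shiftPts μ i| ^ 2)))
    (fun i => (((continuous_ee.comp continuous_ofReal).sub continuous_const).pow 2).mul (hcont i))
    (((summable_shiftPts μ le_rfl).mul_left _).mul_left _)
    (fun i b hb => by
      have hre : (τ * shiftPts μ i).re = τ.re * shiftPts μ i := by simp
      have h := norm_sq_mul_lipKer_le hb (y := τ * shiftPts μ i) hc (by
        rw [hre, abs_mul, abs_of_pos hτ]
        exact mul_le_mul_of_nonneg_left (shiftMin_le μ i) hτ.le)
      rw [hre, abs_mul, abs_of_pos hτ, mul_pow, ← one_div_mul_one_div] at h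
      simpa [lipTerm] using h)
  refine ⟨h1, fun n => (h2 n).unique ?_⟩
  have hne := fun n => shiftPts_ne_mul_inv μ hτ n
  refine ((hasSum_inv_sub_diff μ (hne (n + 2)) (hne (n + 1)) (hne n)).mul_left _).congr_fun
    fun i => ?_
  have hf := fourInt_lipTerm μ hτ 0 i
  simp only [pow_zero, one_mul, Nat.cast_zero] at hf
  rw [fourInt_ee_sub_one_sq_mul (hcont i).continuousOn, hf, hf, hf]
  ring

lemma lipSum_zero_eq (μ : ℝ) {τ : ℂ} (hτ : 0 < τ.re) {A : ℕ → ℂ}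
    (hA : ∀ᶠ Z in nhdsWithin (0 : ℂ) {(0 : ℂ)}ᶜ,
      HasSum (fun j : ℕ => A j * Z ^ j / (Nat.factorial j : ℂ)) (Z / (ee μ * Complex.exp Z - 1)))
    {b : ℝ} (hb : b ∈ Set.Icc (0 : ℝ) 1) :
    ∑' i, (ee b - 1) ^ 2 * lipTerm μ τ 0 i b - (ee b - 1) ^ 2 * bernPart A τ 0 b =
      (-I * τ) ^ (-1 : ℤ) * ((ee b - 1) + (ee b - 1) ^ 2 * ∑' i, dualTerm μ τ 0 i b) := by
  have hτ0 : τ ≠ 0 := fun h => by simp [h] at hτ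
  have hpi : (π : ℂ) ≠ 0 := by exact_mod_cast Real.pi_ne_zero
  obtain ⟨c1, f1⟩ := lipSum_zero_fourier μ hτ
  obtain ⟨c2, f2, f3⟩ := expSum_fourier (summable_dualCoef μ hτ 0)
  have hV : ∀ b : ℝ, ∑' i, dualTerm μ τ 0 i b = ∑' i, (intPts i : ℂ) ^ (-(0 : ℤ)) *
      (dualCoef μ τ (intPts i) - if i.isLeft then 1 else 0) * ee (-(intPts i * b)) := fun b =>
    tsum_congr fun i => by rw [dualTerm]; ring
  simp only [← hV] at c2 f2 f3
  have cP := (continuous_bernPart A τ 0).continuousOn (s := Set.Icc 0 1)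
  have cs : ContinuousOn (fun b : ℝ => (ee b - 1)) (Set.Icc 0 1) :=
    ((continuous_ee.comp continuous_ofReal).sub continuous_const).continuousOn
  have cP2 : ContinuousOn (fun b : ℝ => (ee b - 1) ^ 2 * bernPart A τ 0 b) (Set.Icc 0 1) :=
    (cs.pow 2).mul cP
  have cV2 : ContinuousOn (fun b : ℝ => (ee b - 1) ^ 2 * ∑' i, dualTerm μ τ 0 i b) (Set.Icc 0 1) :=
    (cs.pow 2).mul c2
  have cR : ContinuousOn (fun b : ℝ => (-I * τ) ^ (-1 : ℤ) *
      ((ee b - 1) + (ee b - 1) ^ 2 * ∑' i, dualTerm μ τ 0 i b)) (Set.Icc 0 1) :=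
    continuousOn_const.mul (cs.add cV2)
  have cL : ContinuousOn (fun b : ℝ => ∑' i, (ee b - 1) ^ 2 * lipTerm μ τ 0 i b -
      (ee b - 1) ^ 2 * bernPart A τ 0 b) (Set.Icc 0 1) := c1.sub cP2
  rw [← sub_eq_zero]
  refine eq_zero_of_fourInt_eq_zero (D := fun b : ℝ =>
    (∑' i, (ee b - 1) ^ 2 * lipTerm μ τ 0 i b - (ee b - 1) ^ 2 * bernPart A τ 0 b) -
      (-I * τ) ^ (-1 : ℤ) * ((ee b - 1) + (ee b - 1) ^ 2 * ∑' i, dualTerm μ τ 0 i b))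
    (cL.sub cR) (fun n => ?_) hb
  rw [fourInt_sub cL cR, fourInt_sub c1 cP2, fourInt_const_mul, fourInt_add cs cV2, f1,
    fourInt_ee_sub_one_sq_mul cP, fourInt_ee_sub_one_sq_mul c2]
  have hs : fourInt (fun b : ℝ => ee b - 1) n = (if n = -1 then 1 else 0) - if n = 0 then 1 else 0 := by
    have e1 : (fun b : ℝ => ee b - 1) = fun b : ℝ => ee ((1 : ℤ) * b) - ee ((0 : ℤ) * b) := by
      funext b; simp [ee_zero]
    have hc : ∀ m : ℤ, ContinuousOn (fun b : ℝ => ee (m * b)) (Set.Icc 0 1) := fun m =>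
      (continuous_ee.comp (by fun_prop)).continuousOn
    rw [e1, fourInt_sub (hc 1) (hc 0), fourInt_ee, fourInt_ee]
    congr 1
    · exact if_congr (by omega) rfl rfl
    · exact if_congr (by omega) rfl rfl
  have hI : (-I * τ) ^ (-1 : ℤ) = I / τ := by
    rw [zpow_neg_one, mul_inv, inv_neg, Complex.inv_I, neg_neg]; rfl
  have key : ∀ m : ℤ, 1 / (2 * π * τ) * (I * m / τ * shiftCauchy μ 1 (I * m / τ)) -
      fourInt (bernPart A τ 0) m = I / τ * (A 1 + fourInt (fun b => ∑' i, dualTerm μ τ 0 i b) m +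
        if 0 < m then 1 else 0) := by
    intro m
    have hP := fourInt_bernPart A hτ 0 m
    rw [Nat.cast_zero] at hP
    rw [hP]
    by_cases h0 : m = 0
    · subst h0
      rw [if_pos rfl, f3, if_neg (lt_irrefl _)]
      simp only [Int.cast_zero, mul_zero, zero_div, zero_mul, zero_add, pow_one, add_zero,
        Nat.factorial_one, Nat.cast_one]
      field_simp
      ring
    · obtain ⟨i, hi⟩ := exists_intPts_eq h0
      have hn : (m : ℂ) ≠ 0 := by exact_mod_cast h0
      have hw0 : I * m / τ ≠ 0 := div_ne_zero (mul_ne_zero I_ne_zero hn) hτ0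
      have hC := (coeff_eq_shiftSum μ hA).2.2 _ hw0
        (fun i => sub_ne_zero.1 (shiftPts_ne_mul_inv μ hτ m i))
      have hne := one_sub_ee_mul_exp_ne_zero μ hτ h0
      have hl : (if i.isLeft then 1 else 0 : ℂ) = if 0 < m then 1 else 0 := by
        rw [← hi]
        rcases i with n | n
        · rw [if_pos (by simp), if_pos (by simp [intPts])]
        · rw [if_neg (by simp), if_neg (by simp [intPts])]
      rw [if_neg h0, ← hi, f2 i, hi, hl, dualCoef]
      rw [ee_I_mul_div] at hC
      generalize ee μ * Complex.exp (-2 * π * m / τ) = X at hC hne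
      have hne' : X - 1 ≠ 0 := by rw [← neg_ne_zero, neg_sub]; exact hne
      have hC' : I * m / τ * shiftCauchy μ 1 (I * m / τ) =
          A 0 / (I * m / τ) + A 1 * (2 * π * I) + 2 * π * I * (1 / (1 - X)) := by
        rw [show 1 / (1 - X) = -(1 / (X - 1)) by rw [← neg_sub X 1, one_div_neg_eq_neg_one_div]]
        apply mul_left_cancel₀ hw0
        rw [← mul_assoc, ← sq, hC]
        generalize I * m / τ = w at hw0
        field_simp
        ring
      rw [hC']
      generalize I * m / τ = w at hw0
      simp only [zero_add, Finset.sum_range_one, pow_zero, pow_one, Nat.factorial_zero,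
        Nat.cast_one, neg_zero, zpow_zero, one_mul, mul_one, div_one]
      field_simp
      ring
  have k0 := key n
  have k1 := key (n + 1)
  have k2 := key (n + 2)
  rw [hs, hI]
  have hind : ((if 0 < n + 2 then 1 else 0) - 2 * (if 0 < n + 1 then 1 else 0) +
      (if 0 < n then 1 else 0) : ℂ) = (if n = -1 then 1 else 0) - if n = 0 then 1 else 0 := by
    rcases lt_trichotomy n (-1) with h | h | h
    · rw [if_neg (by omega), if_neg (by omega), if_neg (by omega), if_neg (by omega),
        if_neg (by omega)]
      ring
    · subst h; norm_num
    · rcases eq_or_lt_of_le (show 0 ≤ n by omega) with h2 | h2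
      · subst h2; norm_num
      · rw [if_pos (by omega), if_pos (by omega), if_pos (by omega), if_neg (by omega),
          if_neg (by omega)]
        ring
  linear_combination k2 - 2 * k1 + k0 + I / τ * hind

lemma hasDerivAt_ofReal_cpow_neg (s : ℂ) {y : ℝ} (hy : 0 < y) :
    HasDerivAt (fun y : ℝ => (y : ℂ) ^ (-s)) (-s * (y : ℂ) ^ (-s - 1)) y := by
  have h := ((hasDerivAt_id (y : ℂ)).cpow_const (c := -s) (Or.inl (by simpa using hy))).comp_ofReal
  simpa using h

lemma norm_cpow_convexity_le {a : ℝ} (ha : a ∈ Set.Icc (0 : ℝ) 1) {s : ℂ} (hs : -(1 / 2) < s.re)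
    (hs3 : ‖s‖ < 3) (n : ℕ) :
    ‖2 * (a : ℂ) * (((n + 1 + a : ℝ) : ℂ) ^ (-s)) + (1 - 2 * a) * (((n + 1 + 1 + a : ℝ) : ℂ) ^ (-s))
      - (((n + 1 + 1 - a : ℝ) : ℂ) ^ (-s))‖ ≤ 48 * ((n : ℝ) + 1) ^ (-(3 / 2) : ℝ) := by
  set M : ℝ := 12 * ((n : ℝ) + 1) ^ (-(3 / 2) : ℝ) with hM
  have hM0 : 0 ≤ M := by positivity
  set S : Set ℝ := Set.Icc ((n : ℝ) + 1) (n + 3)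
  have hn : (0 : ℝ) ≤ n := n.cast_nonneg
  have hSpos : ∀ y ∈ S, 0 < y := fun y hy => by linarith [hy.1]
  obtain ⟨ha0, ha1⟩ := ha
  set x : ℝ := n + 1 + a
  have hx : x ∈ S := ⟨by simp only [x]; linarith, by simp only [x]; linarith⟩
  have hconv : Convex ℝ S := convex_Icc _ _
  have hf2 : ∀ y ∈ S, ‖-s * ((-s - 1) * (y : ℂ) ^ (-s - 1 - 1))‖ ≤ M := by
    intro y hy
    rw [norm_mul, norm_mul, norm_cpow_eq_rpow_re_of_pos (hSpos y hy)]
    have hy0 := hSpos y hy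
    have h1 : ‖-s‖ ≤ 3 := by rw [norm_neg]; exact hs3.le
    have h2 : ‖-s - 1‖ ≤ 4 := by
      calc ‖-s - 1‖ ≤ ‖-s‖ + ‖(1 : ℂ)‖ := norm_sub_le _ _
        _ ≤ 4 := by simp; linarith
    have h3 : y ^ ((-s - 1 - 1 : ℂ).re) ≤ ((n : ℝ) + 1) ^ (-(3 / 2) : ℝ) := by
      calc y ^ ((-s - 1 - 1 : ℂ).re) ≤ ((n : ℝ) + 1) ^ ((-s - 1 - 1 : ℂ).re) := by
            apply Real.rpow_le_rpow_of_nonpos (by positivity) hy.1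
            simp; linarith
        _ ≤ _ := by
            apply Real.rpow_le_rpow_of_exponent_le (by linarith)
            simp; linarith
    calc ‖-s‖ * (‖-s - 1‖ * y ^ ((-s - 1 - 1 : ℂ).re))
        ≤ 3 * (4 * ((n : ℝ) + 1) ^ (-(3 / 2) : ℝ)) := by gcongr
      _ = M := by rw [hM]; ring
  have hd1 : ∀ y ∈ S, ‖-s * (y : ℂ) ^ (-s - 1) - -s * (x : ℂ) ^ (-s - 1)‖ ≤ 2 * M := by
    intro y hy
    have := hconv.norm_image_sub_le_of_norm_hasDerivWithin_le
      (f := fun y : ℝ => -s * (y : ℂ) ^ (-s - 1))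
      (f' := fun y : ℝ => -s * ((-s - 1) * (y : ℂ) ^ (-s - 1 - 1))) (C := M)
      (fun y hy => by
        have h := (hasDerivAt_ofReal_cpow_neg (s + 1) (hSpos y hy)).const_mul (-s)
        have e1 : -(s + 1) = -s - 1 := by ring
        rw [e1] at h
        exact h.hasDerivWithinAt) hf2 hx hy
    refine this.trans ?_
    have : ‖y - x‖ ≤ 2 := by
      rw [Real.norm_eq_abs, abs_le]
      constructor <;> linarith [hx.1, hx.2, hy.1, hy.2]
    nlinarith
  have hD : ∀ y ∈ S, ‖((y : ℂ) ^ (-s) - (y - x : ℝ) * (-s * (x : ℂ) ^ (-s - 1))) - (x : ℂ) ^ (-s)‖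
      ≤ 2 * M * ‖y - x‖ := by
    intro y hy
    have := hconv.norm_image_sub_le_of_norm_hasDerivWithin_le
      (f := fun y : ℝ => (y : ℂ) ^ (-s) - ((y - x : ℝ) : ℂ) * (-s * (x : ℂ) ^ (-s - 1)))
      (f' := fun y : ℝ => -s * (y : ℂ) ^ (-s - 1) - -s * (x : ℂ) ^ (-s - 1)) (C := 2 * M)
      (fun y hy => by
        have h := (hasDerivAt_ofReal_cpow_neg s (hSpos y hy)).fun_sub
          ((((hasDerivAt_id y).sub_const x).ofReal_comp).mul_const (-s * (x : ℂ) ^ (-s - 1)))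
        simp only [ofReal_one, one_mul] at h
        exact h.hasDerivWithinAt) hd1 hx hy
    simpa using this
  have hy1 : (n + 1 + 1 + a : ℝ) ∈ S := ⟨by linarith, by linarith⟩
  have hy2 : (n + 1 + 1 - a : ℝ) ∈ S := ⟨by linarith, by linarith⟩
  have H1 := hD _ hy1
  have H2 := hD _ hy2
  have e1 : (n + 1 + 1 + a : ℝ) - x = 1 := by simp only [x]; ring
  have e2 : (n + 1 + 1 - a : ℝ) - x = 1 - 2 * a := by simp only [x]; ring
  rw [e1] at H1
  rw [e2] at H2
  have h12 : ‖(1 - 2 * a : ℝ)‖ ≤ 1 := by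
    rw [Real.norm_eq_abs, abs_le]; constructor <;> linarith
  generalize ((n + 1 + 1 + a : ℝ) : ℂ) ^ (-s) = u at *
  generalize ((n + 1 + 1 - a : ℝ) : ℂ) ^ (-s) = v at *
  generalize -s * (x : ℂ) ^ (-s - 1) = d at *
  generalize (x : ℂ) ^ (-s) = w at *
  have : 2 * (a : ℂ) * w + (1 - 2 * a) * u - v =
      ((1 - 2 * a : ℝ) : ℂ) * ((u - ((1 : ℝ) : ℂ) * d) - w) - ((v - ((1 - 2 * a : ℝ) : ℂ) * d) - w) := by
    push_cast; ring
  rw [this]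
  refine (norm_sub_le _ _).trans ?_
  rw [norm_mul, norm_real]
  have : 48 * ((n : ℝ) + 1) ^ (-(3 / 2) : ℝ) = 4 * M := by rw [hM]; ring
  rw [this]
  simp only [norm_one, mul_one] at H1
  have := mul_le_mul h12 H1 (norm_nonneg _) zero_le_one
  nlinarith

/-- Averaged form of the defining series of the odd Hurwitz zeta function. -/
lemma tendsto_sum_hurwitzZetaOdd {a : ℝ} (ha : a ∈ Set.Ioo (0 : ℝ) 1) {s : ℂ}
    (hs : -(1 / 2) < s.re) (hs3 : ‖s‖ < 3) :
    Filter.Tendsto (fun N : ℕ => (1 - 2 * (a : ℂ)) * ((N + a : ℝ) : ℂ) ^ (-s) +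
      ∑ n ∈ Finset.range N, (((n + a : ℝ) : ℂ) ^ (-s) - ((n + 1 - a : ℝ) : ℂ) ^ (-s))) Filter.atTop
      (nhds (2 * HurwitzZeta.hurwitzZetaOdd (a : UnitAddCircle) s)) := by
  have haI : a ∈ Set.Icc (0 : ℝ) 1 := ⟨ha.1.le, ha.2.le⟩
  set T : ℕ → ℂ → ℂ := fun n s => 2 * (a : ℂ) * (((n + 1 + a : ℝ) : ℂ) ^ (-s)) +
    (1 - 2 * a) * (((n + 1 + 1 + a : ℝ) : ℂ) ^ (-s)) - (((n + 1 + 1 - a : ℝ) : ℂ) ^ (-s)) with hT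
  set P : ℕ → ℂ → ℂ := fun N s => (1 - 2 * (a : ℂ)) * ((N + a : ℝ) : ℂ) ^ (-s) +
      ∑ n ∈ Finset.range N, (((n + a : ℝ) : ℂ) ^ (-s) - ((n + 1 - a : ℝ) : ℂ) ^ (-s)) with hP
  have hPT : ∀ N s, P (N + 1) s = P 1 s + ∑ n ∈ Finset.range N, T n s := by
    intro N s
    induction N with
    | zero => simp
    | succ N ih =>
      have : P (N + 1 + 1) s = P (N + 1) s + T N s := by
        simp only [hP, hT]
        rw [Finset.sum_range_succ _ (N + 1)]
        push_cast
        ring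
      rw [this, ih, Finset.sum_range_succ]; ring
  set U : Set ℂ := {s : ℂ | -(1 / 2) < s.re} ∩ Metric.ball 0 3 with hU
  have hUo : IsOpen U := (isOpen_lt continuous_const continuous_re).inter Metric.isOpen_ball
  have hUc : Convex ℝ U := (convex_halfSpace_re_gt _).inter (convex_ball _ _)
  have hsum : Summable fun n : ℕ => 48 * ((n : ℝ) + 1) ^ (-(3 / 2) : ℝ) := by
    have := (Real.summable_nat_rpow (p := -(3 / 2))).2 (by norm_num)
    exact (((summable_nat_add_iff 1).2 this).mul_left 48).congr (fun n => by push_cast; rfl)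
  have hbd : ∀ n, ∀ s ∈ U, ‖T n s‖ ≤ 48 * ((n : ℝ) + 1) ^ (-(3 / 2) : ℝ) := fun n s hs =>
    norm_cpow_convexity_le haI hs.1 (by simpa using hs.2) n
  have hcp : ∀ y : ℝ, 0 < y → Differentiable ℂ fun s : ℂ => (y : ℂ) ^ (-s) := fun y hy =>
    differentiable_id.neg.const_cpow (Or.inl (by exact_mod_cast hy.ne'))
  have hTd : ∀ n, DifferentiableOn ℂ (T n) U := fun n => by
    apply Differentiable.differentiableOn
    have hn : (0 : ℝ) ≤ n := n.cast_nonneg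
    exact (((hcp _ (by linarith [ha.1])).const_mul _).add
      ((hcp _ (by linarith [ha.1])).const_mul _)).sub (hcp _ (by linarith [ha.2]))
  have hP1d : Differentiable ℂ (P 1) := by
    have : P 1 = fun s => (1 - 2 * (a : ℂ)) * ((1 + a : ℝ) : ℂ) ^ (-s) +
       (((a : ℝ) : ℂ) ^ (-s) - ((1 - a : ℝ) : ℂ) ^ (-s)) := by
      funext s
      simp only [hP, Finset.sum_range_one, Nat.cast_one, Nat.cast_zero, zero_add]
    rw [this]
    exact ((hcp _ (by linarith [ha.1])).const_mul _).add
      ((hcp _ (by linarith [ha.1])).sub (hcp _ (by linarith [ha.2])))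
  have hFd : DifferentiableOn ℂ (fun s => P 1 s + ∑' n, T n s) U :=
    hP1d.differentiableOn.add (differentiableOn_tsum_of_summable_norm hsum hTd hUo hbd)
  have hlim : ∀ s ∈ U, Filter.Tendsto (fun N => P N s) Filter.atTop
      (nhds (P 1 s + ∑' n, T n s)) := by
    intro s hs
    rw [← Filter.tendsto_add_atTop_iff_nat 1]
    exact (((hsum.of_norm_bounded (fun n => hbd n s hs)).hasSum.tendsto_sum_nat).const_add
      _).congr (fun N => (hPT N s).symm)
  have hlarge : ∀ s ∈ U, 1 < s.re →
      P 1 s + ∑' n, T n s = 2 * HurwitzZeta.hurwitzZetaOdd (a : UnitAddCircle) s := by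
    intro s hs hs1
    refine tendsto_nhds_unique (hlim s hs) ?_
    have h1 := ((HurwitzZeta.hasSum_nat_hurwitzZetaOdd_of_mem_Icc haI hs1).mul_left
      2).tendsto_sum_nat
    have h2 : Filter.Tendsto (fun N : ℕ => (1 - 2 * (a : ℂ)) * ((N + a : ℝ) : ℂ) ^ (-s))
        Filter.atTop (nhds 0) := by
      rw [← mul_zero (1 - 2 * (a : ℂ))]
      apply Filter.Tendsto.const_mul
      rw [tendsto_zero_iff_norm_tendsto_zero]
      have : ∀ N : ℕ, ‖((N + a : ℝ) : ℂ) ^ (-s)‖ = (N + a : ℝ) ^ (-s.re) := fun N => by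
        rw [norm_cpow_eq_rpow_re_of_pos (by have := ha.1; positivity)]; simp
      simp_rw [this]
      exact (tendsto_rpow_neg_atTop (by linarith)).comp
        (Filter.tendsto_atTop_add_const_right _ a tendsto_natCast_atTop_atTop)
    have h3 := h2.add h1
    rw [zero_add] at h3
    refine h3.congr (fun N => ?_)
    simp only [hP]
    congr 1
    refine Finset.sum_congr rfl fun n _ => ?_
    rw [cpow_neg, cpow_neg]
    push_cast
    ring
  have key : Set.EqOn (fun s => P 1 s + ∑' n, T n s)
      (fun s => 2 * HurwitzZeta.hurwitzZetaOdd (a : UnitAddCircle) s) U := by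
    refine AnalyticOnNhd.eqOn_of_preconnected_of_eventuallyEq (z₀ := 2)
      (hFd.analyticOnNhd hUo)
      (((HurwitzZeta.differentiable_hurwitzZetaOdd _).const_mul 2).differentiableOn.analyticOnNhd
        hUo) hUc.isPreconnected ⟨by norm_num, by simp; norm_num⟩ ?_
    filter_upwards [hUo.mem_nhds (show (2 : ℂ) ∈ U from ⟨by norm_num, by simp; norm_num⟩),
      (isOpen_lt continuous_const continuous_re).mem_nhds
        (show (2 : ℂ) ∈ {s : ℂ | 1 < s.re} by norm_num)] with s h1 h2
    exact hlarge s h1 h2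
  have hsU : s ∈ U := ⟨hs, by simpa using hs3⟩
  have := hlim s hsU
  rw [show P 1 s + ∑' n, T n s = _ from key hsU] at this
  exact this

lemma hurwitzZetaOdd_apply_zero {a : ℝ} (ha : a ∈ Set.Ioo (0 : ℝ) 1) :
    HurwitzZeta.hurwitzZetaOdd (a : UnitAddCircle) 0 = 1 / 2 - a := by
  have h := tendsto_sum_hurwitzZetaOdd ha (s := 0) (by norm_num) (by simp)
  simp only [neg_zero, cpow_zero, sub_self, Finset.sum_const_zero, mul_one, add_zero] at h
  have := tendsto_nhds_unique h tendsto_const_nhds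
  linear_combination this / 2

lemma hurwitzZetaOdd_apply_one {a : ℝ} (ha : a ∈ Set.Ioo (0 : ℝ) 1) :
    2 * HurwitzZeta.hurwitzZetaOdd (a : UnitAddCircle) 1 = π * Complex.cot (π * a) := by
  have h := tendsto_sum_hurwitzZetaOdd ha (s := 1) (by norm_num) (by simp)
  have hz : (a : ℂ) ∈ integerComplement := by
    rintro ⟨n, hn⟩
    have hn' : (n : ℝ) = a := by exact_mod_cast hn
    have h1 : (0 : ℤ) < n := by have := ha.1; rw [← hn'] at this; exact_mod_cast this
    have h2 : n < (1 : ℤ) := by have := ha.2; rw [← hn'] at this; exact_mod_cast this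
    omega
  have h1 : Filter.Tendsto (fun N : ℕ => (1 - 2 * (a : ℂ)) * ((N + a : ℝ) : ℂ) ^ (-(1 : ℂ)))
      Filter.atTop (nhds 0) := by
    rw [← mul_zero (1 - 2 * (a : ℂ))]
    apply Filter.Tendsto.const_mul
    rw [tendsto_zero_iff_norm_tendsto_zero]
    have : ∀ N : ℕ, ‖((N + a : ℝ) : ℂ) ^ (-(1 : ℂ))‖ = (N + a : ℝ) ^ (-(1 : ℝ)) := fun N => by
      rw [norm_cpow_eq_rpow_re_of_pos (by have := ha.1; positivity)]; simp
    simp_rw [this]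
    exact (tendsto_rpow_neg_atTop (by norm_num)).comp
      (Filter.tendsto_atTop_add_const_right _ a tendsto_natCast_atTop_atTop)
  have h2 := h1.add (tendsto_sum_cot hz)
  rw [zero_add] at h2
  refine tendsto_nhds_unique h (h2.congr fun N => ?_)
  congr 1
  refine Finset.sum_congr rfl fun n _ => ?_
  rw [cpow_neg_one, cpow_neg_one]
  push_cast
  rw [one_div, one_div, add_comm (n : ℂ) (a : ℂ)]

lemma hurwitzZeta_apply_zero {c : ℝ} (hc : c ∈ Set.Ioc (0 : ℝ) 1) :
    HurwitzZeta.hurwitzZeta (c : UnitAddCircle) 0 = 1 / 2 - c := by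
  rcases hc.2.eq_or_lt with rfl | h1
  · have : ((1 : ℝ) : UnitAddCircle) = 0 := AddCircle.coe_period 1
    rw [this, HurwitzZeta.hurwitzZeta_zero, riemannZeta_zero]
    push_cast; ring
  · have hne : (c : UnitAddCircle) ≠ 0 := by
      intro h
      obtain ⟨n, hn⟩ := (AddCircle.coe_eq_zero_iff 1).1 h
      simp only [zsmul_eq_mul, mul_one] at hn
      have h0 : (0 : ℤ) < n := by have := hc.1; rw [← hn] at this; exact_mod_cast this
      have h2 : n < (1 : ℤ) := by rw [← hn] at h1; exact_mod_cast h1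
      omega
    rw [HurwitzZeta.hurwitzZeta, HurwitzZeta.hurwitzZetaEven_apply_zero, if_neg hne,
      hurwitzZetaOdd_apply_zero ⟨hc.1, h1⟩, zero_add]

lemma expZeta_neg_apply_zero {b : ℝ} (hb : b ∈ Set.Ioo (0 : ℝ) 1) :
    HurwitzZeta.expZeta ((-b : ℝ) : UnitAddCircle) 0 = π * Complex.cot (π * b) / (2 * π * I) - 1 / 2
    := by
  have hpi : (π : ℂ) ≠ 0 := by exact_mod_cast Real.pi_ne_zero
  have hs : HurwitzZeta.sinZeta (b : UnitAddCircle) 0 =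
      1 / π * HurwitzZeta.hurwitzZetaOdd (b : UnitAddCircle) 1 := by
    have h := HurwitzZeta.sinZeta_one_sub (b : UnitAddCircle) (s := 1) (fun n h => by
      have : ((n + 1 : ℕ) : ℂ) = 0 := by push_cast; linear_combination h
      exact absurd (Nat.cast_eq_zero.1 this) (by omega))
    rw [sub_self, Complex.Gamma_one, mul_one, mul_one, Complex.sin_pi_div_two, cpow_neg_one] at h
    rw [h]; field_simp
  rw [AddCircle.coe_neg, HurwitzZeta.expZeta, HurwitzZeta.cosZeta_apply_zero, HurwitzZeta.sinZeta_neg,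
    hs, ← hurwitzZetaOdd_apply_one hb]
  field_simp
  linear_combination (-2 * HurwitzZeta.hurwitzZetaOdd (b : UnitAddCircle) 1) * I_sq

/-- The regular part at `b = 0` of `∑ 1 / (m + b) ^ (n + 1)`, the sum being over all integers. -/
def cotSum (n : ℕ) (b : ℝ) : ℂ :=
  ∑' m : ℕ, (1 / (m + 1 + b : ℂ) ^ (n + 1) + (-1) ^ (n + 1) / (m + 1 - b : ℂ) ^ (n + 1))

lemma summable_cotSum_of_pos {n : ℕ} (hn : n ≠ 0) {b : ℝ} (hb : |b| < 1) :
    Summable (fun m : ℕ => 1 / (m + 1 + b : ℂ) ^ (n + 1)) ∧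
    Summable (fun m : ℕ => 1 / (m + 1 - b : ℂ) ^ (n + 1)) := by
  obtain ⟨h1, h2⟩ := abs_lt.1 hb
  constructor
  · refine Summable.of_norm (((summable_add_rpow_neg (d := 1 + b) (by linarith)
      (show 2 ≤ n + 1 by omega))).congr fun m => ?_)
    have : (m + 1 + b : ℂ) = ((m + (1 + b) : ℝ) : ℂ) := by push_cast; ring
    rw [this, norm_div, norm_one, norm_pow, Complex.norm_real, Real.norm_eq_abs,
      abs_of_nonneg (by have : (0 : ℝ) ≤ m := m.cast_nonneg
                        linarith)]
  · refine Summable.of_norm (((summable_add_rpow_neg (d := 1 - b) (by linarith)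
      (show 2 ≤ n + 1 by omega))).congr fun m => ?_)
    have : (m + 1 - b : ℂ) = ((m + (1 - b) : ℝ) : ℂ) := by push_cast; ring
    rw [this, norm_div, norm_one, norm_pow, Complex.norm_real, Real.norm_eq_abs,
      abs_of_nonneg (by have : (0 : ℝ) ≤ m := m.cast_nonneg
                        linarith)]

lemma hasDerivAt_cotSum (n : ℕ) {b : ℝ} (hb : |b| < 1) :
    HasDerivAt (cotSum n) (-(n + 1) * cotSum (n + 1) b) b := by
  set r : ℝ := (1 + |b|) / 2 with hr
  have hbr : |b| < r := by rw [hr]; linarith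
  have hr1 : r < 1 := by rw [hr]; linarith
  have hr0 : 0 < r := (abs_nonneg b).trans_lt hbr
  have hu : Summable fun m : ℕ => 2 * (n + 1 : ℝ) * (1 / ((m : ℝ) + (1 - r)) ^ (n + 2)) :=
    (summable_add_rpow_neg (by linarith) (by omega)).mul_left _
  have hpos : ∀ (m : ℕ) (y : ℝ), |y| < r → (m : ℝ) + (1 - r) ≤ m + 1 + y ∧
      (m : ℝ) + (1 - r) ≤ m + 1 - y ∧ 0 < (m : ℝ) + (1 - r) := by
    intro m y hy
    obtain ⟨h1, h2⟩ := abs_lt.1 hy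
    have : (0 : ℝ) ≤ m := m.cast_nonneg
    exact ⟨by linarith, by linarith, by linarith⟩
  have h := hasDerivAt_tsum_of_isPreconnected hu (isOpen_Ioo (a := -r) (b := r)) isPreconnected_Ioo
    (g := fun (m : ℕ) (b : ℝ) =>
      (1 / (m + 1 + b : ℂ) ^ (n + 1) + (-1) ^ (n + 1) / (m + 1 - b : ℂ) ^ (n + 1)))
    (g' := fun (m : ℕ) (b : ℝ) => -(n + 1 : ℂ) *
      (1 / (m + 1 + b : ℂ) ^ (n + 1 + 1) + (-1) ^ (n + 1 + 1) / (m + 1 - b : ℂ) ^ (n + 1 + 1)))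
    (y₀ := 0) (y := b) ?_ ?_ ⟨by linarith, hr0⟩ ?_ (abs_lt.1 hbr)
  · rw [tsum_mul_left] at h
    exact h
  · intro m y hy
    obtain ⟨h1, h2, h3⟩ := hpos m y (abs_lt.2 hy)
    have n1 : (m + 1 + y : ℂ) ≠ 0 := by exact_mod_cast (h3.trans_le h1).ne'
    have n2 : (m + 1 - y : ℂ) ≠ 0 := by exact_mod_cast (h3.trans_le h2).ne'
    have d0 : HasDerivAt (fun y : ℝ => (y : ℂ)) 1 y := by
      simpa using (hasDerivAt_id y).ofReal_comp
    have d1 := ((hasDerivAt_const y (1 : ℂ)).fun_div ((d0.const_add (m + 1 : ℂ)).fun_pow (n + 1))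
      (pow_ne_zero _ n1)).fun_add
      ((hasDerivAt_const y ((-1 : ℂ) ^ (n + 1))).fun_div ((d0.const_sub (m + 1 : ℂ)).fun_pow (n + 1))
      (pow_ne_zero _ n2))
    convert! d1 using 1
    simp only [Nat.add_sub_cancel]
    push_cast
    field_simp
    ring
  · intro m y hy
    obtain ⟨h1, h2, h3⟩ := hpos m y (abs_lt.2 hy)
    have e1 : (m + 1 + y : ℂ) = ((m + 1 + y : ℝ) : ℂ) := by push_cast; ring
    have e2 : (m + 1 - y : ℂ) = ((m + 1 - y : ℝ) : ℂ) := by push_cast; ring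
    have e3 : ‖-(n + 1 : ℂ)‖ = n + 1 := by
      rw [norm_neg]; exact_mod_cast Complex.norm_natCast (n + 1)
    rw [norm_mul, e3, e1, e2]
    have b1 : ‖(1 : ℂ) / ((m + 1 + y : ℝ) : ℂ) ^ (n + 1 + 1)‖ ≤ 1 / ((m : ℝ) + (1 - r)) ^ (n + 2) := by
      rw [norm_div, norm_one, norm_pow, Complex.norm_real, Real.norm_eq_abs,
        abs_of_pos (h3.trans_le h1)]
      gcongr
    have b2 : ‖(-1 : ℂ) ^ (n + 1 + 1) / ((m + 1 - y : ℝ) : ℂ) ^ (n + 1 + 1)‖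
        ≤ 1 / ((m : ℝ) + (1 - r)) ^ (n + 2) := by
      rw [norm_div, norm_pow, norm_neg, norm_one, one_pow, norm_pow, Complex.norm_real,
        Real.norm_eq_abs, abs_of_pos (h3.trans_le h2)]
      gcongr
    calc _ ≤ (n + 1 : ℝ) * (1 / ((m : ℝ) + (1 - r)) ^ (n + 2) + 1 / ((m : ℝ) + (1 - r)) ^ (n + 2)) := by
          gcongr
          exact (norm_add_le _ _).trans (add_le_add b1 b2)
      _ = _ := by ring
  · rcases eq_or_ne n 0 with rfl | hn
    · simp [neg_div]
    · obtain ⟨h1, h2⟩ := summable_cotSum_of_pos hn (b := 0) (by simp)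
      refine h1.add ((h2.mul_left ((-1) ^ (n + 1))).congr fun m => ?_)
      rw [mul_one_div]

/-- The exponential zeta function at nonpositive integers; at `b = 0` the term `1 / b ^ (n + 1)`
vanishes by convention. -/
lemma expZeta_neg_nat (n : ℕ) {b : ℝ} (hb : b ∈ Set.Ico (0 : ℝ) 1) :
    HurwitzZeta.expZeta ((-b : ℝ) : UnitAddCircle) (-n) =
      n.factorial / (2 * π * I) ^ (n + 1) * (1 / (b : ℂ) ^ (n + 1) + cotSum n b) -
        if n = 0 then 1 / 2 else 0 := by
  have hpi : (π : ℂ) ≠ 0 := by exact_mod_cast Real.pi_ne_zero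
  rcases eq_or_ne n 0 with rfl | hn
  · rcases hb.1.eq_or_lt with rfl | h0
    · have : cotSum 0 0 = 0 := by simp [cotSum, neg_div]
      rw [this]
      have : ((-0 : ℝ) : UnitAddCircle) = 0 := by simp
      rw [this, HurwitzZeta.expZeta_zero]
      simp [riemannZeta_zero]
      ring
    · have h := expZeta_neg_apply_zero ⟨h0, hb.2⟩
      have hz : (b : ℂ) ∈ integerComplement := by
        rintro ⟨n, hn⟩
        have hn' : (n : ℝ) = b := by exact_mod_cast hn
        have h1 : (0 : ℤ) < n := by rw [← hn'] at h0; exact_mod_cast h0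
        have h2 : n < (1 : ℤ) := by have := hb.2; rw [← hn'] at this; exact_mod_cast this
        omega
      have hc : cotSum 0 b = π * Complex.cot (π * b) - 1 / b := by
        rw [← (hasSum_cotTerm hz).tsum_eq, cotSum]
        refine tsum_congr fun m => ?_
        have : (b - (m + 1) : ℂ) = -(m + 1 - b) := by ring
        rw [this, div_neg]
        simp only [zero_add, pow_one, neg_div]
        rw [add_comm (b : ℂ)]
        ring
      rw [Nat.cast_zero, neg_zero, h, hc]
      simp only [Nat.factorial_zero, zero_add, pow_one, if_true]
      push_cast
      ring
  · rw [if_neg hn, sub_zero]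
    have h := HurwitzZeta.expZeta_one_sub ((-b : ℝ) : UnitAddCircle) (s := n + 1) (fun m h => by
      have : ((n + m : ℕ) : ℂ) = 0 := by push_cast; linear_combination h
      exact absurd (Nat.cast_eq_zero.1 this) (by omega))
    rw [show (1 - (n + 1) : ℂ) = -n by ring] at h
    rw [h, Complex.Gamma_nat_eq_factorial]
    have hb1 : |b| < 1 := by rw [abs_of_nonneg hb.1]; exact hb.2
    obtain ⟨s1, s2⟩ := summable_cotSum_of_pos hn hb1
    have hre : 1 < ((n : ℂ) + 1).re := by
      simp only [add_re, natCast_re, one_re]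
      have : (0 : ℝ) < n := by positivity
      linarith
    have z1 : HurwitzZeta.hurwitzZeta (b : UnitAddCircle) (n + 1) =
        1 / (b : ℂ) ^ (n + 1) + ∑' m : ℕ, 1 / (m + 1 + b : ℂ) ^ (n + 1) := by
      rw [← (HurwitzZeta.hasSum_hurwitzZeta_of_one_lt_re ⟨hb.1, hb.2.le⟩ hre).tsum_eq]
      have hterm : ∀ m : ℕ, 1 / ((m : ℂ) + b) ^ ((n : ℂ) + 1) = 1 / (m + b : ℂ) ^ (n + 1) :=
        fun m => by rw [← Complex.cpow_natCast]; push_cast; rfl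
      simp_rw [hterm]
      have hs : Summable fun m : ℕ => 1 / (m + b : ℂ) ^ (n + 1) := by
        rw [← summable_nat_add_iff 1]
        exact s1.congr fun m => by push_cast; rfl
      rw [hs.tsum_eq_zero_add]
      push_cast
      rw [zero_add]
    have z2 : HurwitzZeta.hurwitzZeta ((-b : ℝ) : UnitAddCircle) (n + 1) =
        ∑' m : ℕ, 1 / (m + 1 - b : ℂ) ^ (n + 1) := by
      have : ((-b : ℝ) : UnitAddCircle) = ((1 - b : ℝ) : UnitAddCircle) := by
        have h1 : ((1 : ℝ) : UnitAddCircle) = 0 := AddCircle.coe_period 1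
        rw [AddCircle.coe_sub, h1, zero_sub, AddCircle.coe_neg]
      rw [this, ← (HurwitzZeta.hasSum_hurwitzZeta_of_one_lt_re
        ⟨by linarith [hb.2], by linarith [hb.1]⟩ hre).tsum_eq]
      refine tsum_congr fun m => ?_
      rw [← Complex.cpow_natCast]
      push_cast
      congr 2
      ring
    have hnn : -((-b : ℝ) : UnitAddCircle) = (b : UnitAddCircle) := by
      rw [AddCircle.coe_neg, neg_neg]
    rw [hnn, z1, z2]
    have hcot : cotSum n b = (∑' m : ℕ, 1 / (m + 1 + b : ℂ) ^ (n + 1)) +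
        (-1) ^ (n + 1) * ∑' m : ℕ, 1 / (m + 1 - b : ℂ) ^ (n + 1) := by
      rw [cotSum, ← tsum_mul_left, ← s1.tsum_add (s2.mul_left _)]
      exact tsum_congr fun m => by rw [mul_one_div]
    rw [hcot]
    have x1 : Complex.exp (π * I * (n + 1) / 2) = I ^ (n + 1) := by
      rw [show (π * I * (n + 1) / 2 : ℂ) = (n + 1 : ℕ) * (π / 2 * I) by push_cast; ring,
        Complex.exp_nat_mul, Complex.exp_pi_div_two_mul_I]
    have x2 : Complex.exp (-π * I * (n + 1) / 2) = (-I) ^ (n + 1) := by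
      rw [show (-π * I * (n + 1) / 2 : ℂ) = (n + 1 : ℕ) * (-π / 2 * I) by push_cast; ring,
        Complex.exp_nat_mul, Complex.exp_neg_pi_div_two_mul_I]
    have x3 : (2 * π : ℂ) ^ (-((n : ℂ) + 1)) = 1 / (2 * π) ^ (n + 1) := by
      rw [cpow_neg, ← Complex.cpow_natCast, one_div]; push_cast; rfl
    rw [x1, x2, x3]
    generalize (∑' m : ℕ, 1 / (m + 1 + b : ℂ) ^ (n + 1)) = u
    generalize (∑' m : ℕ, 1 / (m + 1 - b : ℂ) ^ (n + 1)) = v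
    generalize 1 / (b : ℂ) ^ (n + 1) = w
    have i1 : (-I) ^ (n + 1) = 1 / I ^ (n + 1) := by
      rw [← Complex.inv_I, inv_pow, one_div]
    have i2 : I ^ (n + 1) = (-1) ^ (n + 1) * (1 / I ^ (n + 1)) := by
      rw [← i1, ← mul_pow]; simp
    rw [i1, mul_pow (2 * π : ℂ) I]
    have : I ^ (n + 1) * v = ((-1) ^ (n + 1) * (1 / I ^ (n + 1))) * v := by rw [← i2]
    rw [this]
    have hI : I ^ (n + 1) ≠ 0 := pow_ne_zero _ I_ne_zero
    have hp : (2 * π : ℂ) ^ (n + 1) ≠ 0 := pow_ne_zero _ (by simp)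
    generalize I ^ (n + 1) = X at *
    generalize (2 * π : ℂ) ^ (n + 1) = Y at *
    field_simp
    ring

lemma hasDerivAt_expZeta_neg (n : ℕ) {b : ℝ} (hb : b ∈ Set.Ioo (0 : ℝ) 1) :
    HasDerivAt (fun b : ℝ => HurwitzZeta.expZeta ((-b : ℝ) : UnitAddCircle) (-n))
      (-2 * π * I * HurwitzZeta.expZeta ((-b : ℝ) : UnitAddCircle) (-(n + 1 : ℕ))) b := by
  have hpi : (π : ℂ) ≠ 0 := by exact_mod_cast Real.pi_ne_zero
  have hb0 : (b : ℂ) ≠ 0 := by exact_mod_cast hb.1.ne'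
  have d0 : HasDerivAt (fun y : ℝ => (y : ℂ)) 1 b := by
    simpa using (hasDerivAt_id b).ofReal_comp
  have h := (((((hasDerivAt_const b (1 : ℂ)).fun_div (d0.fun_pow (n + 1))
      (pow_ne_zero _ hb0)).fun_add (hasDerivAt_cotSum n (by rw [abs_of_pos hb.1]; exact hb.2))).const_mul
      ((n.factorial : ℂ) / (2 * π * I) ^ (n + 1)))).sub_const (if n = 0 then (1 / 2 : ℂ) else 0)
  have hE := h.congr_of_eventuallyEq (f₁ := fun b : ℝ =>
      HurwitzZeta.expZeta ((-b : ℝ) : UnitAddCircle) (-n)) (by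
    filter_upwards [isOpen_Ioo.mem_nhds hb] with y hy
    exact expZeta_neg_nat n ⟨hy.1.le, hy.2⟩)
  convert! hE using 1
  rw [expZeta_neg_nat (n + 1) ⟨hb.1.le, hb.2⟩, if_neg (by omega), Nat.factorial_succ]
  generalize cotSum (n + 1) b = u
  simp only [Nat.add_sub_cancel]
  push_cast
  field_simp
  ring

lemma tendsto_expZeta_neg (n : ℕ) :
    Filter.Tendsto (fun b : ℝ => HurwitzZeta.expZeta ((-b : ℝ) : UnitAddCircle) (-n) -
      n.factorial / (2 * π * I * b) ^ (n + 1)) (nhdsWithin 0 (Set.Ioi 0))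
      (nhds (HurwitzZeta.expZeta ((-0 : ℝ) : UnitAddCircle) (-n))) := by
  have hc := ((((hasDerivAt_cotSum n (b := 0) (by simp)).continuousAt.tendsto.const_mul
    ((n.factorial : ℂ) / (2 * π * I) ^ (n + 1)))).sub_const
    (if n = 0 then (1 / 2 : ℂ) else 0)).mono_left (nhdsWithin_le_nhds (s := Set.Ioi 0))
  rw [expZeta_neg_nat n ⟨le_rfl, one_pos⟩]
  simp only [ofReal_zero, ne_eq, Nat.add_eq_zero_iff, one_ne_zero, and_false, not_false_eq_true,
    zero_pow, div_zero, zero_add] 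
  refine hc.congr' ?_
  filter_upwards [Ioo_mem_nhdsGT (zero_lt_one' ℝ)] with b hb
  rw [expZeta_neg_nat n ⟨hb.1.le, hb.2⟩, mul_pow (2 * π * I : ℂ)]
  generalize (if n = 0 then (1 / 2 : ℂ) else 0) = z
  rw [mul_add, div_mul_div_comm, mul_one]
  ring

lemma norm_lipKer_le_exp {ε b : ℝ} (hεb : ε ≤ b) {y : ℂ} {c : ℝ}
    (hc : 0 < c) (hy : c ≤ y.re) :
    ‖lipKer b y‖ ≤ 1 / (1 - Real.exp (-2 * π * c)) * Real.exp (-2 * π * ε * y.re) := by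
  have hpi := Real.pi_pos
  have h1 : Real.exp (-2 * π * c) < 1 := by
    rw [Real.exp_lt_one_iff]; nlinarith [mul_pos hpi hc]
  have h2 : Real.exp (-2 * π * y.re) ≤ Real.exp (-2 * π * c) := by
    rw [Real.exp_le_exp]; nlinarith
  have h3 : ‖Complex.exp (-2 * π * y)‖ = Real.exp (-2 * π * y.re) := by
    simpa using norm_exp_two_pi y 1
  have h4 : 1 - Real.exp (-2 * π * c) ≤ ‖1 - Complex.exp (-2 * π * y)‖ := by
    have := norm_sub_norm_le (1 : ℂ) (Complex.exp (-2 * π * y))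
    rw [norm_one, h3] at this
    linarith
  rw [lipKer, norm_div, norm_exp_two_pi, one_div_mul_eq_div]
  have h5 : Real.exp (-2 * π * y.re * b) ≤ Real.exp (-2 * π * ε * y.re) := by
    rw [Real.exp_le_exp]
    nlinarith [mul_nonneg (mul_pos hpi (hc.trans_le hy)).le (sub_nonneg.2 hεb)]
  have : 0 < 1 - Real.exp (-2 * π * c) := by linarith
  gcongr

lemma summable_shift_exp {d σ ε : ℝ} (hd : 0 < d) (hσ : 0 < σ) (hε : 0 < ε) (k : ℤ) (C : ℝ) :
    Summable fun n : ℕ => ((n : ℝ) + d) ^ k * (C * Real.exp (-2 * π * ε * (σ * (n + d)))) := by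
  have h := (summable_zpow_mul_exp hd (s := 2 * π * ε * σ) (by positivity) k).mul_left C
  refine h.congr fun n => ?_
  rw [show -(2 * π * ε * σ) * (n + d) = -2 * π * ε * (σ * (n + d)) by ring]
  ring

lemma norm_shift_lipKer_le {d ε b : ℝ} (hd : 0 < d) {τ : ℂ} (hτ : 0 < τ.re) (hεb : ε ≤ b) (k : ℤ)
    (n : ℕ) : ‖((n + d : ℝ) : ℂ) ^ (-k) * lipKer b (τ * (n + d : ℝ))‖ ≤
      ((n : ℝ) + d) ^ (-k) * (1 / (1 - Real.exp (-2 * π * (τ.re * d))) *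
        Real.exp (-2 * π * ε * (τ.re * (n + d)))) := by
  have hn : (0 : ℝ) < n + d := by positivity
  have hre : (τ * ((n + d : ℝ) : ℂ)).re = τ.re * (n + d) := by rw [Complex.re_mul_ofReal]
  rw [norm_mul, norm_zpow, Complex.norm_real, Real.norm_eq_abs, abs_of_pos hn]
  refine mul_le_mul_of_nonneg_left ?_ (zpow_nonneg hn.le _)
  rw [← hre]
  refine norm_lipKer_le_exp hεb (mul_pos hτ hd) ?_
  rw [hre]
  have : (0 : ℝ) ≤ n := n.cast_nonneg
  nlinarith

lemma exists_summable_norm_lipTerm_le (μ : ℝ) {τ : ℂ} (hτ : 0 < τ.re) {ε : ℝ} (hε : 0 < ε) (k : ℤ) :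
    ∃ u : ℕ ⊕ ℕ → ℝ, Summable u ∧ ∀ i, ∀ b ∈ Set.Icc ε (1 - ε), ‖lipTerm μ τ k i b‖ ≤ u i := by
  have s1 := summable_shift_exp (fracP_pos (-μ)) hτ hε (-k)
    (1 / (1 - Real.exp (-2 * π * (τ.re * fracP (-μ)))))
  have s2 := summable_shift_exp (fracP_pos μ) hτ hε (-k)
    (1 / (1 - Real.exp (-2 * π * (τ.re * fracP μ))))
  refine ⟨Sum.elim (fun n : ℕ => ((n : ℝ) + fracP (-μ)) ^ (-k) *
      (1 / (1 - Real.exp (-2 * π * (τ.re * fracP (-μ)))) *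
        Real.exp (-2 * π * ε * (τ.re * (n + fracP (-μ))))))
    (fun n : ℕ => ((n : ℝ) + fracP μ) ^ (-k) *
      (1 / (1 - Real.exp (-2 * π * (τ.re * fracP μ))) *
        Real.exp (-2 * π * ε * (τ.re * (n + fracP μ))))), Summable.sum _ s1 s2, ?_⟩
  rintro (n | n) b hb
  · exact norm_shift_lipKer_le (fracP_pos (-μ)) hτ hb.1 k n
  · rw [lipTerm_inr μ hτ, norm_mul, norm_zpow, norm_neg, norm_one, one_zpow, one_mul]
    exact norm_shift_lipKer_le (fracP_pos μ) hτ (by linarith [hb.2]) k n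

lemma hasDerivAt_lipTerm (μ : ℝ) (τ : ℂ) (k : ℤ) (i : ℕ ⊕ ℕ) (b : ℝ) :
    HasDerivAt (lipTerm μ τ k i) (-2 * π * τ * lipTerm μ τ (k - 1) i b) b := by
  have d0 : HasDerivAt (fun y : ℝ => (y : ℂ)) 1 b := by
    simpa using (hasDerivAt_id b).ofReal_comp
  have hp : (shiftPts μ i : ℂ) ≠ 0 := by exact_mod_cast shiftPts_ne_zero μ i
  have h := (((d0.const_mul (-2 * π * (τ * shiftPts μ i))).cexp.div_const
    (1 - Complex.exp (-2 * π * (τ * shiftPts μ i)))).const_mul ((shiftPts μ i : ℂ) ^ (-k)))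
  convert! h using 1
  rw [lipTerm, lipKer, show -(k - 1) = -k + 1 by ring, zpow_add_one₀ hp]
  ring

lemma hasDerivAt_tsum_lipTerm (μ : ℝ) {τ : ℂ} (hτ : 0 < τ.re) (k : ℤ) {b : ℝ}
    (hb : b ∈ Set.Ioo (0 : ℝ) 1) :
    HasDerivAt (fun b => ∑' i, lipTerm μ τ k i b)
      (-2 * π * τ * ∑' i, lipTerm μ τ (k - 1) i b) b := by
  obtain ⟨ε, hε, hb1, hb2⟩ : ∃ ε : ℝ, 0 < ε ∧ ε < b ∧ b < 1 - ε :=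
    ⟨min b (1 - b) / 2, by have := lt_min hb.1 (sub_pos.2 hb.2); linarith,
      by have := min_le_left b (1 - b); linarith [hb.1],
      by have := min_le_right b (1 - b); linarith [hb.2]⟩
  obtain ⟨u, hu, hu'⟩ := exists_summable_norm_lipTerm_le μ hτ hε (k - 1)
  obtain ⟨v, hv, hv'⟩ := exists_summable_norm_lipTerm_le μ hτ hε k
  have h := hasDerivAt_tsum_of_isPreconnected (hu.mul_left ‖-2 * π * τ‖)
    (isOpen_Ioo (a := ε) (b := 1 - ε)) isPreconnected_Ioo
    (g := lipTerm μ τ k) (g' := fun i b => -2 * π * τ * lipTerm μ τ (k - 1) i b)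
    (y₀ := b) (y := b) (fun i y _ => hasDerivAt_lipTerm μ τ k i y)
    (fun i y hy => by
      rw [norm_mul]
      exact mul_le_mul_of_nonneg_left (hu' i y ⟨hy.1.le, hy.2.le⟩) (norm_nonneg _))
    ⟨hb1, hb2⟩ (hv.of_norm_bounded fun i => hv' i b ⟨hb1.le, hb2.le⟩) ⟨hb1, hb2⟩
  rw [tsum_mul_left] at h
  exact h

lemma norm_dualTerm (μ : ℝ) (τ : ℂ) (k : ℤ) (i : ℕ ⊕ ℕ) (b : ℝ) :
    ‖dualTerm μ τ k i b‖ = ‖(intPts i : ℂ) ^ (-k) *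
      (dualCoef μ τ (intPts i) - if i.isLeft then 1 else 0)‖ := by
  rw [dualTerm, norm_mul, norm_mul, norm_mul]
  have : (-((intPts i : ℂ) * b)) = ((-(intPts i * b) : ℝ) : ℂ) := by push_cast; ring
  rw [this, norm_ee, mul_one]

lemma hasDerivAt_dualTerm (μ : ℝ) (τ : ℂ) (k : ℤ) (i : ℕ ⊕ ℕ) (b : ℝ) :
    HasDerivAt (dualTerm μ τ k i) (-2 * π * I * dualTerm μ τ (k - 1) i b) b := by
  have d0 : HasDerivAt (fun y : ℝ => (y : ℂ)) 1 b := by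
    simpa using (hasDerivAt_id b).ofReal_comp
  have hp : (intPts i : ℂ) ≠ 0 := by exact_mod_cast intPts_ne_zero i
  have h := (((((d0.const_mul (intPts i : ℂ)).fun_neg.const_mul (2 * π * I)).cexp).const_mul
    ((intPts i : ℂ) ^ (-k)))).mul_const (dualCoef μ τ (intPts i) - if i.isLeft then 1 else 0)
  convert! h using 1
  rw [dualTerm, ee, show -(k - 1) = -k + 1 by ring, zpow_add_one₀ hp]
  ring

lemma hasDerivAt_tsum_dualTerm (μ : ℝ) {τ : ℂ} (hτ : 0 < τ.re) (k : ℤ) (b : ℝ) :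
    HasDerivAt (fun b => ∑' i, dualTerm μ τ k i b)
      (-2 * π * I * ∑' i, dualTerm μ τ (k - 1) i b) b := by
  have h := hasDerivAt_tsum (((summable_dualCoef μ hτ (k - 1))).mul_left ‖-2 * π * I‖)
    (g := dualTerm μ τ k) (g' := fun i b => -2 * π * I * dualTerm μ τ (k - 1) i b)
    (y₀ := b) (fun i y => hasDerivAt_dualTerm μ τ k i y)
    (fun i y => by rw [norm_mul, norm_dualTerm])
    (Summable.of_norm ((summable_dualCoef μ hτ k).congr fun i => (norm_dualTerm μ τ k i b).symm)) b
  rw [tsum_mul_left] at h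
  exact h

lemma hasDerivAt_bernPart (A : ℕ → ℂ) {τ : ℂ} (hτ : τ ≠ 0) (n : ℕ) (b : ℝ) :
    HasDerivAt (bernPart A τ (-n)) (-2 * π * τ * bernPart A τ (-n - 1) b) b := by
  have hpi : (π : ℂ) ≠ 0 := by exact_mod_cast Real.pi_ne_zero
  have d0 : HasDerivAt (fun y : ℝ => (y : ℂ)) 1 b := by
    simpa using (hasDerivAt_id b).ofReal_comp
  rcases n with _ | _ | n
  · have e0 : bernPart A τ (-(0 : ℕ)) = fun b : ℝ => A 0 * (b : ℂ) + (- A 0 / 2 - I * A 1 / τ) := by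
      funext b
      simp [bernPart, Finset.sum_range_succ, BpolyC]
      ring
    have e1 : bernPart A τ (-(0 : ℕ) - 1) b = A 0 / (-2 * π * τ) := by
      simp [bernPart, BpolyC]
      field_simp
    rw [e0, e1]
    convert! (d0.const_mul (A 0)).add_const (- A 0 / 2 - I * A 1 / τ) using 1
    field_simp
  · have e0 : bernPart A τ (-(0 + 1 : ℕ)) = fun b : ℝ => A 0 / (-2 * π * τ) := by
      funext b
      simp [bernPart, BpolyC]
      field_simp
    have e1 : bernPart A τ (-(0 + 1 : ℕ) - 1) b = 0 := by
      simp [bernPart]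
    rw [e0, e1, mul_zero]
    exact hasDerivAt_const _ _
  · have e : ∀ m : ℤ, m ≤ -2 → ∀ b, bernPart A τ m b = 0 := fun m hm b => by
      rw [bernPart, show (m + 2).toNat = 0 by omega]; simp
    rw [e _ (by push_cast; omega), mul_zero]
    rw [show bernPart A τ (-(n + 1 + 1 : ℕ)) = fun _ => 0 from funext (e _ (by push_cast; omega))]
    exact hasDerivAt_const _ _

lemma lipSum_neg_eq (μ : ℝ) {τ : ℂ} (hτ : 0 < τ.re) {A : ℕ → ℂ}
    (hA : ∀ᶠ Z in nhdsWithin (0 : ℂ) {(0 : ℂ)}ᶜ,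
      HasSum (fun j : ℕ => A j * Z ^ j / (Nat.factorial j : ℂ)) (Z / (ee μ * Complex.exp Z - 1)))
    (n : ℕ) : ∀ b ∈ Set.Ioo (0 : ℝ) 1,
    ∑' i, lipTerm μ τ (-n) i b - bernPart A τ (-n) b = (-I * τ) ^ (-(n : ℤ) - 1) *
      (HurwitzZeta.expZeta ((-b : ℝ) : UnitAddCircle) (-n) + ∑' i, dualTerm μ τ (-n) i b) := by
  have hτ0 : τ ≠ 0 := by rintro rfl; simp at hτ
  have hpi : (π : ℂ) ≠ 0 := by exact_mod_cast Real.pi_ne_zero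
  induction n with
  | zero =>
    intro b hb
    have h := lipSum_zero_eq μ hτ hA (b := b) ⟨hb.1.le, hb.2.le⟩
    have hz : (b : ℂ) ∈ integerComplement := by
      rintro ⟨n, hn⟩
      have hn' : (n : ℝ) = b := by exact_mod_cast hn
      have h1 : (0 : ℤ) < n := by have := hb.1; rw [← hn'] at this; exact_mod_cast this
      have h2 : n < (1 : ℤ) := by have := hb.2; rw [← hn'] at this; exact_mod_cast this
      omega
    have hne := ee_sub_one_ne_zero hz
    have hE : HurwitzZeta.expZeta ((-b : ℝ) : UnitAddCircle) 0 = 1 / (ee b - 1) := by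
      rw [expZeta_neg_apply_zero hb, pi_mul_cot]
      field_simp
      ring
    simp only [Nat.cast_zero, neg_zero, zero_sub, hE]
    rw [tsum_mul_left] at h
    generalize (-I * τ) ^ (-1 : ℤ) = x at *
    generalize ∑' i, lipTerm μ τ 0 i b = L at *
    generalize ∑' i, dualTerm μ τ 0 i b = G at *
    generalize ee (b : ℂ) - 1 = w at *
    field_simp
    have : w * (w * (L - bernPart A τ 0 b)) = w * (x * (1 + w * G)) := by linear_combination h
    linear_combination mul_left_cancel₀ hne this
  | succ n ih =>
    intro b hb
    have hL := (hasDerivAt_tsum_lipTerm μ hτ (-n) hb).fun_sub (hasDerivAt_bernPart A hτ0 n b)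
    have hR := ((hasDerivAt_expZeta_neg n hb).fun_add
      (hasDerivAt_tsum_dualTerm μ hτ (-n) b)).const_mul ((-I * τ) ^ (-(n : ℤ) - 1))
    have hLR := hR.congr_of_eventuallyEq (f₁ := fun b =>
      ∑' i, lipTerm μ τ (-n) i b - bernPart A τ (-n) b) (by
      filter_upwards [isOpen_Ioo.mem_nhds hb] with y hy using ih y hy)
    have h := hL.unique hLR
    have hc : (-(n + 1 : ℕ) : ℤ) = -n - 1 := by push_cast; ring
    rw [hc]
    have hx : (-I * τ) ^ (-(n : ℤ) - 1) = (-I * τ) ^ (-(n : ℤ) - 1 - 1) * (-I * τ) := by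
      rw [← zpow_add_one₀ (mul_ne_zero (neg_ne_zero.2 I_ne_zero) hτ0)]
      congr 1; ring
    rw [hx] at h
    generalize (-I * τ) ^ (-(n : ℤ) - 1 - 1) = x at *
    have h2 : (-2 * π * τ : ℂ) ≠ 0 := by
      simp [hpi, hτ0]
    apply mul_left_cancel₀ h2
    linear_combination h + 2 * π * τ * x * (HurwitzZeta.expZeta ((-b : ℝ) : UnitAddCircle) (-(n + 1 : ℕ)) + ∑' i, dualTerm μ τ (-n - 1) i b) * I_sq

lemma analyticAt_dslope {f : ℂ → ℂ} {z : ℂ} (hf : AnalyticAt ℂ f z) : AnalyticAt ℂ (dslope f z) z :=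
  let ⟨_, hp⟩ := hf
  ⟨_, hp.has_fpower_series_dslope_fslope⟩

lemma analyticAt_iteratedDeriv {f : ℂ → ℂ} {z : ℂ} (hf : AnalyticAt ℂ f z) (n : ℕ) :
    AnalyticAt ℂ (iteratedDeriv n f) z := by
  rw [iteratedDeriv_eq_iterate]
  exact hf.iterated_deriv n

lemma iteratedDeriv_dslope {f : ℂ → ℂ} {z : ℂ} (hf : AnalyticAt ℂ f z) (n : ℕ) :
    iteratedDeriv n (dslope f z) z = iteratedDeriv (n + 1) f z / (n + 1) := by
  have h1 := hf.hasFPowerSeriesAt.has_fpower_series_dslope_fslope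
  have h2 := (analyticAt_dslope hf).hasFPowerSeriesAt
  have h := congrArg (fun p => FormalMultilinearSeries.coeff p n)
    (h2.eq_formalMultilinearSeries h1)
  simp only [FormalMultilinearSeries.coeff_fslope, FormalMultilinearSeries.coeff_ofScalars] at h
  have hn : (n.factorial : ℂ) ≠ 0 := by exact_mod_cast n.factorial_ne_zero
  have hn' : (n + 1 : ℂ) ≠ 0 := by exact_mod_cast n.succ_ne_zero
  rw [Nat.factorial_succ] at h
  push_cast at h
  field_simp at h ⊢
  exact h

/-- The Bernoulli generating function `t ↦ t * exp (a * t) / (exp t - 1)`, continued to `t = 0`. -/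
def bernGen (a : ℝ) (t : ℂ) : ℂ := Complex.exp (a * t) / dslope Complex.exp 0 t

lemma dslope_exp_zero : dslope Complex.exp 0 0 = 1 := by
  rw [dslope_same, Complex.deriv_exp, Complex.exp_zero]

lemma analyticAt_bernGen (a : ℝ) : AnalyticAt ℂ (bernGen a) 0 := by
  have h1 : AnalyticAt ℂ (fun t : ℂ => Complex.exp (a * t)) 0 := by fun_prop
  exact h1.fun_div (analyticAt_dslope (by fun_prop)) (by rw [dslope_exp_zero]; exact one_ne_zero)

lemma bernGen_zero (a : ℝ) : bernGen a 0 = 1 := by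
  simp [bernGen]

lemma iteratedDeriv_bernGen (a : ℝ) (n : ℕ) :
    iteratedDeriv n (bernGen a) 0 = (bernoulliFun n a : ℂ) := by
  have hD : AnalyticAt ℂ (dslope Complex.exp 0) 0 := analyticAt_dslope (by fun_prop)
  have hF := analyticAt_bernGen a
  have key : ∀ n : ℕ, ∑ i ∈ Finset.range (n + 1), ((n + 1).choose i : ℂ) *
      iteratedDeriv i (bernGen a) 0 = (n + 1) * (a : ℂ) ^ n := fun n => by
    have hev : bernGen a * dslope Complex.exp 0 =ᶠ[nhds 0] fun t : ℂ => Complex.exp (a * t) := by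
      filter_upwards [hD.continuousAt.eventually_ne (dslope_exp_zero.trans_ne one_ne_zero)]
        with t ht
      rw [Pi.mul_apply, bernGen, div_mul_cancel₀ _ ht]
    have h := hev.iteratedDeriv_eq n
    rw [iteratedDeriv_mul hF.contDiffAt hD.contDiffAt, iteratedDeriv_cexp_const_mul] at h
    simp only [mul_zero, Complex.exp_zero, mul_one] at h
    rw [← h, Finset.mul_sum]
    refine Finset.sum_congr rfl fun i hi => ?_
    have hi : i ≤ n := Nat.lt_succ_iff.1 (Finset.mem_range.1 hi)
    rw [iteratedDeriv_dslope (by fun_prop), iteratedDeriv_eq_iterate (f := Complex.exp),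
      Complex.iter_deriv_exp, Complex.exp_zero]
    have e3 : ((n + 1 - i : ℕ) : ℂ) = (n - i : ℕ) + 1 := by
      rw [Nat.sub_add_comm hi]; push_cast; ring
    have e4 : ((n - i : ℕ) + 1 : ℂ) ≠ 0 := by exact_mod_cast (n - i).succ_ne_zero
    have e5 : ((n + 1).choose i : ℂ) * ((n - i : ℕ) + 1) = (n + 1) * n.choose i := by
      rw [← e3]
      have := Nat.choose_mul_succ_eq n i
      exact_mod_cast (by linarith : (n + 1).choose i * (n + 1 - i) = (n + 1) * n.choose i)
    field_simp
    linear_combination iteratedDeriv i (bernGen a) 0 * e5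
  have key2 : ∀ n : ℕ, ∑ i ∈ Finset.range (n + 1), ((n + 1).choose i : ℂ) *
      (bernoulliFun i a : ℂ) = (n + 1) * (a : ℂ) ^ n := fun n => by
    have h := congrArg (Polynomial.aeval a) (Polynomial.sum_bernoulli n)
    rw [map_sum, Polynomial.aeval_monomial] at h
    have h2 : ∑ i ∈ Finset.range (n + 1), ((n + 1).choose i : ℝ) * bernoulliFun i a =
        (n + 1) * a ^ n := by
      simpa [bernoulliFun, Polynomial.eval_map_algebraMap, Rat.smul_def] using h
    exact_mod_cast congrArg (fun x : ℝ => (x : ℂ)) h2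
  induction n using Nat.strong_induction_on with
  | _ n ih =>
    have h := (key n).trans (key2 n).symm
    rw [Finset.sum_range_succ, Finset.sum_range_succ,
      Finset.sum_congr rfl fun i hi => by rw [ih i (Finset.mem_range.1 hi)]] at h
    have hc : ((n + 1).choose n : ℂ) ≠ 0 := by
      exact_mod_cast (Nat.choose_pos n.le_succ).ne'
    exact mul_left_cancel₀ hc (add_left_cancel h)

/-- The power sums over the shifted naturals, damped by an exponential. -/
def expSum (c : ℝ) (N : ℕ) (t : ℂ) : ℂ :=
  ∑' n : ℕ, ((n + c : ℝ) : ℂ) ^ N * Complex.exp (-t * (n + c : ℝ))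

lemma norm_expSum_term_le {c : ℝ} (hc : 0 < c) (N n : ℕ) {s : ℝ} {t : ℂ} (ht : s ≤ t.re) :
    ‖((n + c : ℝ) : ℂ) ^ N * Complex.exp (-t * (n + c : ℝ))‖ ≤
      ((n : ℝ) + c) ^ (N : ℤ) * Real.exp (-s * (n + c)) := by
  have hn : (0 : ℝ) < n + c := by positivity
  rw [norm_mul, norm_pow, Complex.norm_real, Real.norm_eq_abs, abs_of_pos hn, Complex.norm_exp,
    Complex.re_mul_ofReal, neg_re, zpow_natCast]
  gcongr

lemma summable_expSum {c : ℝ} (hc : 0 < c) (N : ℕ) {t : ℂ} (ht : 0 < t.re) :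
    Summable fun n : ℕ => ((n + c : ℝ) : ℂ) ^ N * Complex.exp (-t * (n + c : ℝ)) :=
  (summable_zpow_mul_exp hc ht N).of_norm_bounded fun n => norm_expSum_term_le hc N n le_rfl

lemma hasDerivAt_expSum {c : ℝ} (hc : 0 < c) (N : ℕ) {t : ℂ} (ht : 0 < t.re) :
    HasDerivAt (expSum c N) (-expSum c (N + 1) t) t := by
  have ho : IsOpen {z : ℂ | t.re / 2 < z.re} := isOpen_lt continuous_const Complex.continuous_re
  have hp : IsPreconnected {z : ℂ | t.re / 2 < z.re} := (convex_halfSpace_re_gt _).isPreconnected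
  have hm : t ∈ {z : ℂ | t.re / 2 < z.re} := by simp only [Set.mem_ofPred_eq]; linarith
  have h := hasDerivAt_tsum_of_isPreconnected
    (summable_zpow_mul_exp hc (half_pos ht) (N + 1 : ℕ)) ho hp
    (g := fun (n : ℕ) (t : ℂ) => ((n + c : ℝ) : ℂ) ^ N * Complex.exp (-t * (n + c : ℝ)))
    (g' := fun (n : ℕ) (t : ℂ) => -(((n + c : ℝ) : ℂ) ^ (N + 1) * Complex.exp (-t * (n + c : ℝ))))
    (y₀ := t) (y := t)
    (fun n y _ => by
      have := (((hasDerivAt_id y).fun_neg.mul_const ((n + c : ℝ) : ℂ)).cexp).const_mul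
        (((n + c : ℝ) : ℂ) ^ N)
      convert! this using 1
      simp only [id]
      ring)
    (fun n y hy => by
      rw [norm_neg]
      exact norm_expSum_term_le hc (N + 1) n (le_of_lt hy))
    hm (summable_expSum hc N ht) hm
  rw [tsum_neg] at h
  exact h

lemma expSum_zero {c : ℝ} {t : ℂ} (ht : 0 < t.re) :
    expSum c 0 t = 1 / t + dslope (bernGen (1 - c)) 0 t := by
  have ht0 : t ≠ 0 := by rintro rfl; simp at ht
  have hlt : ‖Complex.exp (-t)‖ < 1 := by
    rw [Complex.norm_exp, Real.exp_lt_one_iff, neg_re]; linarith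
  have hne : Complex.exp (-t) ≠ 1 := by
    intro h; rw [h, norm_one] at hlt; exact lt_irrefl _ hlt
  have hs : expSum c 0 t = Complex.exp (-t * c) * (1 - Complex.exp (-t))⁻¹ := by
    rw [← tsum_geometric_of_norm_lt_one hlt, ← tsum_mul_left, expSum]
    refine tsum_congr fun n => ?_
    rw [pow_zero, one_mul, ← Complex.exp_nat_mul, ← Complex.exp_add]
    congr 1; push_cast; ring
  rw [hs, dslope_of_ne _ ht0, slope_def_field, bernGen_zero, bernGen, dslope_of_ne _ ht0,
    slope_def_field, Complex.exp_zero]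
  have e1 : Complex.exp (((1 - c : ℝ) : ℂ) * t) = Complex.exp (-t * c) * Complex.exp t := by
    rw [← Complex.exp_add]; congr 1; push_cast; ring
  have e2 : Complex.exp (-t) = (Complex.exp t)⁻¹ := Complex.exp_neg t
  have e3 := Complex.exp_ne_zero t
  rw [e1]
  rw [e2] at hne ⊢
  generalize Complex.exp t = E at *
  generalize Complex.exp (-t * c) = G at *
  have e4 : E - 1 ≠ 0 := fun h => hne (by rw [sub_eq_zero.1 h, inv_one])
  rw [sub_zero]
  field_simp
  ring

lemma tendsto_expSum {c : ℝ} (hc : c ∈ Set.Ioc (0 : ℝ) 1) (N : ℕ) :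
    Filter.Tendsto (fun t => expSum c N t - (N.factorial : ℂ) / t ^ (N + 1))
      (nhdsWithin 0 {t | 0 < t.re})
      (nhds (HurwitzZeta.hurwitzZeta (c : UnitAddCircle) (-N))) := by
  set H := dslope (bernGen (1 - c)) 0 with hH
  have hHa : AnalyticAt ℂ H 0 := analyticAt_dslope (analyticAt_bernGen _)
  obtain ⟨r, hr, hball⟩ := Metric.eventually_nhds_iff_ball.1 hHa.eventually_analyticAt
  have ho : IsOpen {z : ℂ | 0 < z.re} := isOpen_lt continuous_const Complex.continuous_re
  have key : ∀ N : ℕ, ∀ t ∈ Metric.ball (0 : ℂ) r ∩ {z : ℂ | 0 < z.re},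
      expSum c N t = (N.factorial : ℂ) / t ^ (N + 1) + (-1) ^ N * iteratedDeriv N H t := by
    intro N
    induction N with
    | zero =>
      intro t ht
      simpa using expSum_zero ht.2
    | succ N ih =>
      intro t ht
      have ht0 : t ≠ 0 := by rintro rfl; simpa using ht.2
      have h1 := (hasDerivAt_expSum hc.1 N ht.2)
      have hd : HasDerivAt (iteratedDeriv N H) (iteratedDeriv (N + 1) H t) t := by
        rw [iteratedDeriv_succ]
        exact ((analyticAt_iteratedDeriv (hball t ht.1) N).differentiableAt).hasDerivAt
      have h2 := ((((hasDerivAt_id t).fun_pow (N + 1)).fun_inv (pow_ne_zero _ ht0)).const_mul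
        (N.factorial : ℂ)).fun_add (hd.const_mul ((-1) ^ N))
      have h3 := h1.unique (h2.congr_of_eventuallyEq (by
        filter_upwards [(Metric.isOpen_ball.inter ho).mem_nhds ht] with z hz
        rw [ih z hz, div_eq_mul_inv]; rfl))
      rw [neg_eq_iff_eq_neg] at h3
      rw [h3, Nat.factorial_succ]
      simp only [id, Nat.add_sub_cancel]
      push_cast
      field_simp
      ring
  have hlim : (-1) ^ N * iteratedDeriv N H 0 =
      HurwitzZeta.hurwitzZeta (c : UnitAddCircle) (-N) := by
    rw [hH, iteratedDeriv_dslope (analyticAt_bernGen _), iteratedDeriv_bernGen,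
      bernoulliFun_eval_one_sub]
    rcases Nat.eq_zero_or_pos N with rfl | hN
    · rw [Nat.cast_zero, neg_zero, hurwitzZeta_apply_zero hc]
      simp [bernoulliFun]
    · rw [HurwitzZeta.hurwitzZeta_neg_nat hN.ne' ⟨hc.1.le, hc.2⟩]
      have := BpolyC_eq (N + 1) c
      rw [BpolyC, ← Polynomial.eval_map_algebraMap] at this
      rw [this]
      push_cast
      have h1 : ((-1 : ℂ) ^ N) * (-1) ^ N = 1 := by rw [← mul_pow]; norm_num
      rw [pow_succ]
      linear_combination (-(bernoulliFun (N + 1) c : ℂ) / (N + 1)) * h1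
  rw [← hlim]
  have hcont : Filter.Tendsto (fun t => (-1) ^ N * iteratedDeriv N H t) (nhds 0)
      (nhds ((-1) ^ N * iteratedDeriv N H 0)) :=
    ((analyticAt_iteratedDeriv hHa N).continuousAt.const_mul _).tendsto
  refine (hcont.mono_left nhdsWithin_le_nhds).congr' ?_
  filter_upwards [inter_mem_nhdsWithin {t : ℂ | 0 < t.re} (Metric.ball_mem_nhds 0 hr)] with t ht
  rw [key N t ⟨ht.2, ht.1⟩]
  ring

lemma summable_shift_lipKer {d b : ℝ} (hd : 0 < d) {τ : ℂ} (hτ : 0 < τ.re) (hb : 0 < b) (k : ℤ) :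
    Summable fun n : ℕ => ((n + d : ℝ) : ℂ) ^ (-k) * lipKer b (τ * (n + d : ℝ)) :=
  (summable_shift_exp hd hτ hb (-k) _).of_norm_bounded fun n =>
    norm_shift_lipKer_le hd hτ le_rfl k n

lemma continuousAt_tsum_shift_lipKer {d b : ℝ} (hd : 0 < d) {τ : ℂ} (hτ : 0 < τ.re) (hb : 0 < b)
    (k : ℤ) : ContinuousAt (fun b : ℝ =>
      ∑' n : ℕ, ((n + d : ℝ) : ℂ) ^ (-k) * lipKer b (τ * (n + d : ℝ))) b := by
  refine tendsto_tsum_of_dominated_convergence (summable_shift_exp hd hτ (half_pos hb) (-k)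
    (1 / (1 - Real.exp (-2 * π * (τ.re * d)))))
    (fun n => ((continuous_lipKer _).continuousAt.const_mul _).tendsto) ?_
  filter_upwards [lt_mem_nhds (half_lt_self hb)] with y hy n
  exact norm_shift_lipKer_le hd hτ (le_of_lt hy) k n

lemma lipKer_one_add (b : ℝ) {y : ℂ} (hy : y.re ≠ 0) :
    lipKer b y = Complex.exp (-2 * π * y * b) + lipKer (1 + b) y := by
  have h1 := one_sub_exp_ne_zero hy
  have e : Complex.exp (-2 * π * y * (1 + b : ℝ)) =
      Complex.exp (-2 * π * y) * Complex.exp (-2 * π * y * b) := by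
    rw [← Complex.exp_add]; congr 1; push_cast; ring
  rw [lipKer, lipKer, e]
  generalize Complex.exp (-2 * π * y) = E at *
  generalize Complex.exp (-2 * π * y * b) = G at *
  field_simp
  ring

lemma tsum_lipTerm_neg_eq (μ : ℝ) {τ : ℂ} (hτ : 0 < τ.re) (N : ℕ) {b : ℝ}
    (hb : b ∈ Set.Ioo (0 : ℝ) 1) :
    ∑' i, lipTerm μ τ (-N) i b = expSum (fracP (-μ)) N (2 * π * τ * b) +
      (∑' n : ℕ, ((n + fracP (-μ) : ℝ) : ℂ) ^ (-(-N : ℤ)) *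
        lipKer (1 + b) (τ * (n + fracP (-μ) : ℝ)) +
      (-1 : ℂ) ^ (-(N : ℤ) - 1) * ∑' n : ℕ, ((n + fracP μ : ℝ) : ℂ) ^ (-(-N : ℤ)) *
        lipKer (1 - b) (τ * (n + fracP μ : ℝ))) := by
  have hre : 0 < (2 * π * τ * b : ℂ).re := by
    have : (2 * π * τ * b : ℂ) = ((2 * π * b : ℝ) : ℂ) * τ := by push_cast; ring
    rw [this, Complex.re_ofReal_mul]
    have := hb.1
    positivity
  have s1 := (summable_expSum (fracP_pos (-μ)) N hre).hasSum.add
    (summable_shift_lipKer (fracP_pos (-μ)) hτ (b := 1 + b) (by linarith [hb.1]) (-N)).hasSum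
  have s2 := (summable_shift_lipKer (fracP_pos μ) hτ (b := 1 - b) (by linarith [hb.2])
    (-N)).hasSum.mul_left ((-1 : ℂ) ^ (-(N : ℤ) - 1))
  have h : HasSum (fun i => lipTerm μ τ (-N) i b) _ := HasSum.sum
    (s1.congr_fun (g := (fun i => lipTerm μ τ (-N) i b) ∘ Sum.inl) fun n => by
      have hre := mul_shiftPts_re_ne_zero μ hτ (.inl n)
      simp only [shiftPts, Sum.elim_inl] at hre
      simp only [Function.comp_def, lipTerm_inl]
      rw [lipKer_one_add b hre, mul_add, neg_neg, zpow_natCast]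
      congr 3
      ring)
    (s2.congr_fun (g := (fun i => lipTerm μ τ (-N) i b) ∘ Sum.inr) fun n =>
      (lipTerm_inr μ hτ _ n b))
  rw [h.tsum_eq, add_assoc]
  rfl

lemma tendsto_lipSum_neg {β : ℝ} (hβ : Int.fract β = 0) (μ : ℝ) {τ : ℂ} (hτ : 0 < τ.re) (N : ℕ) :
    Filter.Tendsto
      (fun b : ℝ => ∑' i, lipTerm μ τ (-N) i b - (N.factorial : ℂ) / (2 * π * τ * b) ^ (N + 1))
      (nhdsWithin 0 (Set.Ioi 0))
      (nhds (HurwitzZeta.hurwitzZeta (fracP (-μ) : UnitAddCircle) (-N) +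
        (Scal ((-N : ℤ) : ℂ) β (-μ) 0 0 τ +
          (-1 : ℂ) ^ (-(N : ℤ) - 1) * Scal ((-N : ℤ) : ℂ) (-β) μ 0 0 τ))) := by
  rw [(Scal_left _ β (-μ) hτ).1, (Scal_left _ (-β) μ hτ).1, fracP_of_fract_eq_zero hβ,
    fracP_neg β, hβ, sub_zero]
  have hτb : Filter.Tendsto (fun b : ℝ => (2 * π * τ * b : ℂ)) (nhdsWithin 0 (Set.Ioi 0))
      (nhdsWithin 0 {t : ℂ | 0 < t.re}) := by
    refine tendsto_nhdsWithin_iff.2 ⟨?_, ?_⟩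
    · have : Continuous fun b : ℝ => (2 * π * τ * b : ℂ) := by fun_prop
      simpa using (this.tendsto 0).mono_left nhdsWithin_le_nhds
    · filter_upwards [self_mem_nhdsWithin] with b hb
      have hb : 0 < b := hb
      have : (2 * π * τ * b : ℂ) = ((2 * π * b : ℝ) : ℂ) * τ := by push_cast; ring
      rw [this, Complex.re_ofReal_mul]
      positivity
  have l1 := (tendsto_expSum (c := fracP (-μ)) ⟨fracP_pos _, fracP_le_one _⟩ N).comp hτb
  have a1 : Filter.Tendsto (fun b : ℝ => 1 + b) (nhdsWithin 0 (Set.Ioi 0)) (nhds 1) := by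
    have : Continuous fun b : ℝ => 1 + b := by fun_prop
    simpa using (this.tendsto 0).mono_left nhdsWithin_le_nhds
  have a2 : Filter.Tendsto (fun b : ℝ => 1 - b) (nhdsWithin 0 (Set.Ioi 0)) (nhds 1) := by
    have : Continuous fun b : ℝ => 1 - b := by fun_prop
    simpa using (this.tendsto 0).mono_left nhdsWithin_le_nhds
  have l2 := (continuousAt_tsum_shift_lipKer (fracP_pos (-μ)) hτ one_pos (-N)).tendsto.comp a1
  have l3 := ((continuousAt_tsum_shift_lipKer (fracP_pos μ) hτ one_pos (-N)).tendsto.comp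
    a2).const_mul ((-1 : ℂ) ^ (-(N : ℤ) - 1))
  refine (l1.add (l2.add l3)).congr' ?_
  filter_upwards [Ioo_mem_nhdsGT one_pos] with b hb
  rw [tsum_lipTerm_neg_eq μ hτ N hb]
  simp only [Function.comp_def]
  ring

lemma lipSum_neg_zero_eq {β : ℝ} (hβ : Int.fract β = 0) (μ : ℝ) {τ : ℂ} (hτ : 0 < τ.re) {A : ℕ → ℂ}
    (hA : ∀ᶠ Z in nhdsWithin (0 : ℂ) {(0 : ℂ)}ᶜ,
      HasSum (fun j : ℕ => A j * Z ^ j / (Nat.factorial j : ℂ)) (Z / (ee μ * Complex.exp Z - 1)))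
    (N : ℕ) :
    HurwitzZeta.hurwitzZeta (fracP (-μ) : UnitAddCircle) (-N) +
        (Scal ((-N : ℤ) : ℂ) β (-μ) 0 0 τ +
          (-1 : ℂ) ^ (-(N : ℤ) - 1) * Scal ((-N : ℤ) : ℂ) (-β) μ 0 0 τ) - bernPart A τ (-N) 0 =
      (-I * τ) ^ (-(N : ℤ) - 1) * (HurwitzZeta.expZeta ((-0 : ℝ) : UnitAddCircle) (-N) +
        ∑' i, dualTerm μ τ (-N) i 0) := by
  have hτ0 : τ ≠ 0 := by rintro rfl; simp at hτ
  have l1 := (tendsto_lipSum_neg hβ μ hτ N).sub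
    (((continuous_bernPart A τ (-N)).tendsto 0).mono_left
      (nhdsWithin_le_nhds (s := Set.Ioi (0 : ℝ))))
  have l2 := ((tendsto_expZeta_neg N).add
    ((hasDerivAt_tsum_dualTerm μ hτ (-N) 0).continuousAt.tendsto.mono_left
      nhdsWithin_le_nhds)).const_mul ((-I * τ) ^ (-(N : ℤ) - 1))
  refine tendsto_nhds_unique l1 (l2.congr' ?_)
  filter_upwards [Ioo_mem_nhdsGT one_pos] with b hb
  have h := lipSum_neg_eq μ hτ hA N b hb
  have e : (-I * τ) ^ (-(N : ℤ) - 1) * ((N.factorial : ℂ) / (2 * π * I * b) ^ (N + 1)) =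
      (N.factorial : ℂ) / (2 * π * τ * b) ^ (N + 1) := by
    have hc : (2 * π * τ * b : ℂ) = (-I * τ) * (2 * π * I * b) := by
      linear_combination (2 * π * τ * b : ℂ) * I_sq
    rw [hc, mul_pow (-I * τ), show -(N : ℤ) - 1 = -((N + 1 : ℕ) : ℤ) by push_cast; ring,
      zpow_neg, zpow_natCast, div_mul_eq_div_div_swap]
    rw [inv_mul_eq_div]
  rw [sub_right_comm, h, ← e]
  ring

theorem transformation_of_nonpos (β μ : ℝ) {τ : ℂ} (hτ : 0 < τ.re) {A : ℕ → ℂ}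
    (hA : ∀ᶠ Z in nhdsWithin (0 : ℂ) {(0 : ℂ)}ᶜ,
      HasSum (fun j : ℕ => A j * Z ^ j / (Nat.factorial j : ℂ)) (Z / (ee μ * Complex.exp Z - 1)))
    (N : ℕ) :
    dInt β * HurwitzZeta.hurwitzZeta ((-μ : ℝ) : UnitAddCircle) ((-N : ℤ) : ℂ) +
        Scal ((-N : ℤ) : ℂ) β (-μ) 0 0 τ +
        (-1 : ℂ) ^ (-(N : ℤ) - 1) * Scal ((-N : ℤ) : ℂ) (-β) μ 0 0 τ -
        bernPart A τ (-N) (Int.fract β) =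
      (-I * τ) ^ (-(N : ℤ) - 1) *
        (HurwitzZeta.expZeta ((-β : ℝ) : UnitAddCircle) ((-N : ℤ) : ℂ) +
          Scal ((-N : ℤ) : ℂ) 0 0 μ (-β) (1 / τ) +
          (-1 : ℂ) ^ (-(N : ℤ) - 1) * Scal ((-N : ℤ) : ℂ) 0 0 (-μ) β (1 / τ)) := by
  have hcast : ((-N : ℤ) : ℂ) = -(N : ℂ) := by push_cast; ring
  have hd := (hasSum_dualTerm β μ hτ (-N)).tsum_eq
  rw [dInt_eq, expZeta_fract, hurwitzZeta_fracP, add_assoc (HurwitzZeta.expZeta _ _), ← hd,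
    add_assoc (_ * HurwitzZeta.hurwitzZeta _ _)]
  split_ifs with hβ
  · have h := lipSum_neg_zero_eq hβ μ hτ hA N
    rw [hβ, one_mul]
    rw [hcast] at h ⊢
    exact h
  · have hl := (hasSum_lipTerm hβ μ hτ (-N)).tsum_eq
    have h := lipSum_neg_eq μ hτ hA N (Int.fract β)
      ⟨(Int.fract_nonneg β).lt_of_ne' hβ, Int.fract_lt_one β⟩
    rw [hl] at h
    rw [zero_mul, zero_add]
    rw [hcast] at h ⊢
    exact h

/-- Corollary 4.4 of the paper: the pairing of `ζ(k,-μ)` and `ζ_{-β}(k)`. -/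
theorem statement7 (β μ : ℝ) (k : ℤ) (hk : k ≠ 1) (τ : ℂ) (hτ : 0 < τ.re)
    (A : ℕ → ℂ → ℂ)
    (hA : ∀ Y : ℂ, ∀ᶠ Z in nhdsWithin (0 : ℂ) {(0 : ℂ)}ᶜ,
      HasSum (fun j : ℕ => A j Y * Z ^ j / (Nat.factorial j : ℂ))
        (Z / (Y * Complex.exp Z - 1))) :
    dInt β * HurwitzZeta.hurwitzZeta ((-μ : ℝ) : UnitAddCircle) ((k : ℤ) : ℂ) +
          Scal (k : ℂ) β (-μ) 0 0 τ +
          (-1 : ℂ) ^ (k - 1) * Scal (k : ℂ) (-β) μ 0 0 τ -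
        (-2 * (Real.pi : ℂ)) ^ k *
          ∑ j ∈ Finset.range (k + 2).toNat,
            (-Complex.I) ^ j * A j (ee ((μ : ℝ) : ℂ)) *
                BpolyC ((k + 1).toNat - j) ((Int.fract β : ℝ) : ℂ) /
                ((Nat.factorial j : ℂ) * (Nat.factorial ((k + 1).toNat - j) : ℂ)) *
              τ ^ (k - (j : ℤ)) =
      (-Complex.I * τ) ^ (k - 1) *
        (HurwitzZeta.expZeta ((-β : ℝ) : UnitAddCircle) ((k : ℤ) : ℂ) +
          Scal (k : ℂ) 0 0 μ (-β) (1 / τ) +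
          (-1 : ℂ) ^ (k - 1) * Scal (k : ℂ) 0 0 (-μ) β (1 / τ)) := by
  rcases lt_or_gt_of_ne hk with hk | hk
  · obtain ⟨N, rfl⟩ : ∃ N : ℕ, k = -N := ⟨(-k).toNat, by omega⟩
    exact transformation_of_nonpos β μ hτ (hA (ee μ)) N
  · lift k to ℕ using by omega
    have h := transformation_of_two_le β μ hτ (hA (ee μ)) (k := k) (by omega)
    simp only [Int.cast_natCast] at h ⊢
    exact h

end
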